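/- Let β > 1 and ε > 0, and suppose Ψ=(ψ₊,ψ₋) is admissible with degrees (1,1) and attains the infimum, i.e. E_ε(Ψ) = I_{[1,1]}(ε;β). Then the spin of Ψ vanishes identically on the open unit disk (so |ψ₊| = |ψ₋| everywhere), ψ₊ = ψ₋ on the closed unit disk, and the map u := √2·ψ₊ satisfies G_ε(u) = I_GL(ε). -/

import Mathlib

open MeasureTheory Metric Set Filter Complex

noncomputable section

/-- Sum of squared norms of the two first-order partial derivatives (plane identified with `ℂ`). -/
def gradSq (f : ℂ → ℂ) (x : ℂ) : ℝ :=
  ‖fderiv ℝ f x 1‖ ^ 2 + ‖fderiv ℝ f x Complex.I‖ ^ 2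

/-- Two-component Ginzburg–Landau energy density on the unit disk. -/
def eDen (ε β : ℝ) (ψp ψm : ℂ → ℂ) (x : ℂ) : ℝ :=
  (1 / 2) * (gradSq ψp x + gradSq ψm x)
    + (1 / (4 * ε ^ 2)) * ((‖ψp x‖ ^ 2 + ‖ψm x‖ ^ 2 - 1) ^ 2)
    + (β / (4 * ε ^ 2)) * ((‖ψp x‖ ^ 2 - ‖ψm x‖ ^ 2) ^ 2)

/-- Two-component Ginzburg–Landau energy on the unit disk. -/
def En (ε β : ℝ) (ψp ψm : ℂ → ℂ) : ℝ := ∫ x in ball (0 : ℂ) 1, eDen ε β ψp ψm x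

/-- Scalar Ginzburg–Landau energy density. -/
def gDen (ε : ℝ) (u : ℂ → ℂ) (x : ℂ) : ℝ :=
  (1 / 2) * gradSq u x + (1 / (4 * ε ^ 2)) * ((1 - ‖u x‖ ^ 2) ^ 2)

/-- Scalar Ginzburg–Landau energy on the unit disk. -/
def Gn (ε : ℝ) (u : ℂ → ℂ) : ℝ := ∫ x in ball (0 : ℂ) 1, gDen ε u x

/-- Admissible two-component map with boundary degrees `(np, nm)`. -/
def AdmissiblePair (ε β : ℝ) (np nm : ℕ) (ψp ψm : ℂ → ℂ) : Prop :=
  ContinuousOn ψp (closedBall 0 1) ∧ ContinuousOn ψm (closedBall 0 1) ∧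
  ContDiffOn ℝ 1 ψp (ball 0 1) ∧ ContDiffOn ℝ 1 ψm (ball 0 1) ∧
  IntegrableOn (eDen ε β ψp ψm) (ball 0 1) ∧
  ∀ x : ℂ, ‖x‖ = 1 →
    ψp x = (Real.sqrt 2 : ℂ)⁻¹ * x ^ np ∧ ψm x = (Real.sqrt 2 : ℂ)⁻¹ * x ^ nm

/-- The infimum `I_{[np,nm]}(ε;β)`. -/
def Ival (ε β : ℝ) (np nm : ℕ) : ℝ :=
  sInf { e : ℝ | ∃ ψp ψm : ℂ → ℂ, AdmissiblePair ε β np nm ψp ψm ∧ e = En ε β ψp ψm }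

/-- Admissible scalar map with degree-one boundary condition. -/
def AdmissibleScalar (ε : ℝ) (u : ℂ → ℂ) : Prop :=
  ContinuousOn u (closedBall 0 1) ∧ ContDiffOn ℝ 1 u (ball 0 1) ∧
  IntegrableOn (gDen ε u) (ball 0 1) ∧ ∀ x : ℂ, ‖x‖ = 1 → u x = x

/-- The infimum `I_GL(ε)`. -/
def IGL (ε : ℝ) : ℝ :=
  sInf { e : ℝ | ∃ u : ℂ → ℂ, AdmissibleScalar ε u ∧ e = Gn ε u }

/-- Spin of a two-component map. -/
def spin (ψp ψm : ℂ → ℂ) (x : ℂ) : ℝ := (1 / 2) * (‖ψm x‖ ^ 2 - ‖ψp x‖ ^ 2)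

/-! ### Continuous maps on the closed disk with finite Dirichlet energy -/

/-- Hilbert–Schmidt inner product of the differentials of two planar maps. -/
def gradInner (f g : ℂ → ℂ) (x : ℂ) : ℝ :=
  inner ℝ (fderiv ℝ f x 1) (fderiv ℝ g x 1) + inner ℝ (fderiv ℝ f x I) (fderiv ℝ g x I)

/-- Maps continuous on the closed disk and `C¹` with finite Dirichlet energy inside. -/
structure FiniteDirichlet (f : ℂ → ℂ) : Prop where
  cont : ContinuousOn f (closedBall 0 1)
  smooth : ContDiffOn ℝ 1 f (ball 0 1)
  integrable : IntegrableOn (gradSq f) (ball 0 1)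

lemma gradSq_nonneg (f : ℂ → ℂ) (x : ℂ) : 0 ≤ gradSq f x := by
  unfold gradSq; positivity

lemma gradInner_self (f : ℂ → ℂ) (x : ℂ) : gradInner f f x = gradSq f x := by
  simp [gradInner, gradSq]

lemma abs_gradInner_le (f g : ℂ → ℂ) (x : ℂ) :
    |gradInner f g x| ≤ (gradSq f x + gradSq g x) / 2 := by
  have h1 := abs_real_inner_le_norm (fderiv ℝ f x 1) (fderiv ℝ g x 1)
  have h2 := abs_real_inner_le_norm (fderiv ℝ f x I) (fderiv ℝ g x I)
  unfold gradInner gradSq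
  refine (abs_add_le _ _).trans ?_
  nlinarith [sq_nonneg (‖fderiv ℝ f x 1‖ - ‖fderiv ℝ g x 1‖),
    sq_nonneg (‖fderiv ℝ f x I‖ - ‖fderiv ℝ g x I‖)]

lemma fderiv_apply_eq (f : ℂ → ℂ) (x v : ℂ) :
    fderiv ℝ f x v = v.re • fderiv ℝ f x 1 + v.im • fderiv ℝ f x I := by
  conv_lhs => rw [← Complex.re_add_im v]
  rw [map_add]
  congr 1
  · rw [← map_smul]; simp
  · rw [← map_smul]; simp

lemma norm_fderiv_apply_sq_le (f : ℂ → ℂ) (x v : ℂ) :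
    ‖fderiv ℝ f x v‖ ^ 2 ≤ ‖v‖ ^ 2 * gradSq f x := by
  rw [fderiv_apply_eq]
  have h : ‖v.re • fderiv ℝ f x 1 + v.im • fderiv ℝ f x I‖
      ≤ |v.re| * ‖fderiv ℝ f x 1‖ + |v.im| * ‖fderiv ℝ f x I‖ := by
    refine (norm_add_le _ _).trans ?_
    simp
  have h2 : ‖v‖ ^ 2 = |v.re| ^ 2 + |v.im| ^ 2 := by
    rw [Complex.sq_norm, Complex.normSq_apply, sq_abs, sq_abs]; ring
  rw [h2, gradSq]
  calc _ ≤ (|v.re| * ‖fderiv ℝ f x 1‖ + |v.im| * ‖fderiv ℝ f x I‖) ^ 2 := by gcongr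
    _ ≤ _ := by nlinarith [sq_nonneg (|v.re| * ‖fderiv ℝ f x I‖ - |v.im| * ‖fderiv ℝ f x 1‖)]

lemma ContDiffOn.differentiableAt_disk {f : ℂ → ℂ} (hf : ContDiffOn ℝ 1 f (ball 0 1)) {x : ℂ}
    (hx : x ∈ ball (0 : ℂ) 1) : DifferentiableAt ℝ f x :=
  (hf.differentiableOn one_ne_zero).differentiableAt (isOpen_ball.mem_nhds hx)

lemma ContDiffOn.continuousOn_fderiv_disk {f : ℂ → ℂ} (hf : ContDiffOn ℝ 1 f (ball 0 1)) (v : ℂ) :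
    ContinuousOn (fun x => fderiv ℝ f x v) (ball 0 1) :=
  (hf.continuousOn_fderiv_of_isOpen isOpen_ball le_rfl).clm_apply continuousOn_const

lemma ContDiffOn.continuousOn_gradInner {f g : ℂ → ℂ} (hf : ContDiffOn ℝ 1 f (ball 0 1))
    (hg : ContDiffOn ℝ 1 g (ball 0 1)) : ContinuousOn (gradInner f g) (ball 0 1) :=
  ((hf.continuousOn_fderiv_disk 1).inner (𝕜 := ℝ) (hg.continuousOn_fderiv_disk 1)).add
    ((hf.continuousOn_fderiv_disk I).inner (𝕜 := ℝ) (hg.continuousOn_fderiv_disk I))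

lemma ContDiffOn.continuousOn_gradSq {f : ℂ → ℂ} (hf : ContDiffOn ℝ 1 f (ball 0 1)) :
    ContinuousOn (gradSq f) (ball 0 1) := by
  have := hf.continuousOn_gradInner hf
  rwa [show gradInner f f = gradSq f from funext (gradInner_self f)] at this

lemma ContinuousOn.aestronglyMeasurable_disk {E : Type*} [NormedAddCommGroup E]
    [SecondCountableTopology E] {f : ℂ → E}
    (hf : ContinuousOn f (ball 0 1)) : AEStronglyMeasurable f (volume.restrict (ball (0 : ℂ) 1)) :=
  hf.aestronglyMeasurable measurableSet_ball

lemma integrableOn_disk_of_le {E : Type*} [NormedAddCommGroup E] [SecondCountableTopology E]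
    {f : ℂ → E} {g : ℂ → ℝ} (hf : ContinuousOn f (ball 0 1))
    (hg : IntegrableOn g (ball 0 1)) (h : ∀ x ∈ ball (0 : ℂ) 1, ‖f x‖ ≤ g x) :
    IntegrableOn f (ball 0 1) :=
  Integrable.mono' hg hf.aestronglyMeasurable_disk
    ((ae_restrict_iff' measurableSet_ball).2 (ae_of_all _ h))

lemma ContinuousOn.exists_bound_disk {E : Type*} [NormedAddCommGroup E]
    {f : ℂ → E} (hf : ContinuousOn f (closedBall 0 1)) :
    ∃ M, 0 ≤ M ∧ ∀ x ∈ closedBall (0 : ℂ) 1, ‖f x‖ ≤ M := by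
  obtain ⟨M, hM⟩ := (isCompact_closedBall (0 : ℂ) 1).exists_bound_of_continuousOn hf
  exact ⟨M, (norm_nonneg _).trans (hM 0 (by simp)), hM⟩

lemma ContinuousOn.integrableOn_disk {E : Type*} [NormedAddCommGroup E]
    {f : ℂ → E} (hf : ContinuousOn f (closedBall 0 1)) : IntegrableOn f (ball 0 1) :=
  (hf.integrableOn_compact (isCompact_closedBall _ _)).mono_set ball_subset_closedBall

namespace FiniteDirichlet

variable {f g : ℂ → ℂ}

lemma integrable_gradInner (hf : FiniteDirichlet f) (hg : FiniteDirichlet g) :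
    IntegrableOn (gradInner f g) (ball 0 1) :=
  integrableOn_disk_of_le (hf.smooth.continuousOn_gradInner hg.smooth)
    ((hf.integrable.add hg.integrable).div_const 2) fun x _ => abs_gradInner_le f g x

lemma of_contDiff (hf : ContDiff ℝ 1 f) : FiniteDirichlet f := by
  refine ⟨hf.continuous.continuousOn, hf.contDiffOn, ContinuousOn.integrableOn_disk ?_⟩
  have h : ∀ v, Continuous fun x => fderiv ℝ f x v := fun v =>
    (hf.continuous_fderiv one_ne_zero).clm_apply continuous_const
  exact (((h 1).norm.pow 2).add ((h I).norm.pow 2)).continuousOn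

lemma mul (hf : FiniteDirichlet f) (hg : FiniteDirichlet g) :
    FiniteDirichlet (fun x => f x * g x) := by
  refine ⟨hf.cont.mul hg.cont, hf.smooth.mul hg.smooth, ?_⟩
  obtain ⟨M, hM0, hM⟩ := hf.cont.exists_bound_disk
  obtain ⟨N, hN0, hN⟩ := hg.cont.exists_bound_disk
  refine integrableOn_disk_of_le (hf.smooth.mul hg.smooth).continuousOn_gradSq
    ((hf.integrable.const_mul (2 * N ^ 2)).add (hg.integrable.const_mul (2 * M ^ 2)))
    fun x hx => ?_
  have hd : ∀ v, ‖fderiv ℝ (fun x => f x * g x) x v‖ ^ 2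
      ≤ 2 * N ^ 2 * ‖fderiv ℝ f x v‖ ^ 2 + 2 * M ^ 2 * ‖fderiv ℝ g x v‖ ^ 2 := by
    intro v
    rw [fderiv_fun_mul (hf.smooth.differentiableAt_disk hx) (hg.smooth.differentiableAt_disk hx)]
    have h1 : ‖(f x • fderiv ℝ g x + g x • fderiv ℝ f x) v‖
        ≤ M * ‖fderiv ℝ g x v‖ + N * ‖fderiv ℝ f x v‖ := by
      refine (norm_add_le _ _).trans ?_
      change ‖f x • fderiv ℝ g x v‖ + ‖g x • fderiv ℝ f x v‖ ≤ _
      rw [norm_smul, norm_smul]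
      gcongr
      · exact hM x (ball_subset_closedBall hx)
      · exact hN x (ball_subset_closedBall hx)
    calc _ ≤ (M * ‖fderiv ℝ g x v‖ + N * ‖fderiv ℝ f x v‖) ^ 2 := by gcongr
      _ ≤ _ := by nlinarith [sq_nonneg (M * ‖fderiv ℝ g x v‖ - N * ‖fderiv ℝ f x v‖)]
  rw [Real.norm_of_nonneg (gradSq_nonneg _ _)]
  have h1 := hd 1
  have h2 := hd I
  simp only [gradSq, Pi.add_apply]
  linarith

lemma const_mul (c : ℂ) (hf : FiniteDirichlet f) : FiniteDirichlet (fun x => c * f x) :=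
  (of_contDiff contDiff_const).mul hf

lemma add (hf : FiniteDirichlet f) (hg : FiniteDirichlet g) :
    FiniteDirichlet (fun x => f x + g x) := by
  refine ⟨hf.cont.add hg.cont, hf.smooth.add hg.smooth, ?_⟩
  refine integrableOn_disk_of_le (hf.smooth.add hg.smooth).continuousOn_gradSq
    ((hf.integrable.const_mul 2).add (hg.integrable.const_mul 2)) fun x hx => ?_
  rw [Real.norm_of_nonneg (gradSq_nonneg _ _)]
  simp only [gradSq, Pi.add_apply]
  rw [fderiv_fun_add (hf.smooth.differentiableAt_disk hx) (hg.smooth.differentiableAt_disk hx)]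
  have key : ∀ a b : ℂ, ‖a + b‖ ^ 2 ≤ 2 * ‖a‖ ^ 2 + 2 * ‖b‖ ^ 2 := fun a b => by
    have := pow_le_pow_left₀ (norm_nonneg _) (norm_add_le a b) 2
    nlinarith [sq_nonneg (‖a‖ - ‖b‖)]
  have h1 := key (fderiv ℝ f x 1) (fderiv ℝ g x 1)
  have h2 := key (fderiv ℝ f x I) (fderiv ℝ g x I)
  simp only [add_apply]
  linarith

lemma sub (hf : FiniteDirichlet f) (hg : FiniteDirichlet g) :
    FiniteDirichlet (fun x => f x - g x) := by
  have := hf.add (hg.const_mul (-1))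
  simpa [sub_eq_add_neg] using this

end FiniteDirichlet

/-! ### Euler–Lagrange equation -/

lemma quartic_min_linear_coeff_eq_zero {k a b c d : ℝ}
    (h : ∀ s : ℝ, k ≤ k + s * a + s ^ 2 * b + s ^ 3 * c + s ^ 4 * d) : a = 0 := by
  have hd : HasDerivAt (fun s : ℝ => k + s * a + s ^ 2 * b + s ^ 3 * c + s ^ 4 * d) a 0 := by
    have := (((((hasDerivAt_id (0 : ℝ)).mul_const a).const_add k).fun_add
      ((hasDerivAt_pow 2 (0 : ℝ)).mul_const b)).fun_add
      ((hasDerivAt_pow 3 (0 : ℝ)).mul_const c)).fun_add ((hasDerivAt_pow 4 (0 : ℝ)).mul_const d)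
    simpa using this
  refine IsLocalMin.hasDerivAt_eq_zero (Eventually.of_forall fun s => ?_) hd
  simpa using h s

lemma integral_quartic_combination {α : Type*} [MeasurableSpace α] {μ : Measure α}
    {F₀ F₁ F₂ F₃ F₄ : α → ℝ} (h₀ : Integrable F₀ μ) (h₁ : Integrable F₁ μ) (h₂ : Integrable F₂ μ)
    (h₃ : Integrable F₃ μ) (h₄ : Integrable F₄ μ) (s : ℝ) :
    ∫ x, F₀ x + s * F₁ x + s ^ 2 * F₂ x + s ^ 3 * F₃ x + s ^ 4 * F₄ x ∂μ =
      ∫ x, F₀ x ∂μ + s * ∫ x, F₁ x ∂μ + s ^ 2 * ∫ x, F₂ x ∂μ + s ^ 3 * ∫ x, F₃ x ∂μ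
        + s ^ 4 * ∫ x, F₄ x ∂μ := by
  have j₁ := h₁.const_mul s
  have j₂ := h₂.const_mul (s ^ 2)
  have j₃ := h₃.const_mul (s ^ 3)
  have j₄ := h₄.const_mul (s ^ 4)
  have e₁ : ∫ x, F₀ x + s * F₁ x ∂μ = _ := integral_add h₀ j₁
  have e₂ : ∫ x, F₀ x + s * F₁ x + s ^ 2 * F₂ x ∂μ = _ := integral_add (h₀.add j₁) j₂
  have e₃ : ∫ x, F₀ x + s * F₁ x + s ^ 2 * F₂ x + s ^ 3 * F₃ x ∂μ = _ :=
    integral_add ((h₀.add j₁).add j₂) j₃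
  have e₄ : ∫ x, F₀ x + s * F₁ x + s ^ 2 * F₂ x + s ^ 3 * F₃ x + s ^ 4 * F₄ x ∂μ = _ :=
    integral_add (((h₀.add j₁).add j₂).add j₃) j₄
  simp only [integral_const_mul] at e₁ e₂ e₃ e₄
  rw [e₄, e₃, e₂, e₁]

/-- The weak Euler–Lagrange equation of `Gn ε` for `u`, tested against maps vanishing on the
unit circle. -/
def WeakGL (ε : ℝ) (u : ℂ → ℂ) : Prop :=
  ∀ φ : ℂ → ℂ, FiniteDirichlet φ → (∀ x : ℂ, ‖x‖ = 1 → φ x = 0) →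
    ∫ x in ball (0 : ℂ) 1, gradInner u φ x =
      ∫ x in ball (0 : ℂ) 1, (1 - ‖u x‖ ^ 2) / ε ^ 2 * inner ℝ (u x) (φ x)

lemma FiniteDirichlet.integrable_gDen {u : ℂ → ℂ} (hu : FiniteDirichlet u) (ε : ℝ) :
    IntegrableOn (gDen ε u) (ball 0 1) := by
  refine (hu.integrable.const_mul _).add (ContinuousOn.integrableOn_disk ?_)
  exact ((continuousOn_const.sub (hu.cont.norm.pow 2)).pow 2).const_smul (1 / (4 * ε ^ 2))

lemma FiniteDirichlet.admissibleScalar {u : ℂ → ℂ} (hu : FiniteDirichlet u) (ε : ℝ)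
    (hb : ∀ x : ℂ, ‖x‖ = 1 → u x = x) : AdmissibleScalar ε u :=
  ⟨hu.cont, hu.smooth, hu.integrable_gDen ε, hb⟩

lemma AdmissibleScalar.finiteDirichlet {ε : ℝ} {u : ℂ → ℂ} (hu : AdmissibleScalar ε u) :
    FiniteDirichlet u := by
  obtain ⟨h1, h2, h3, -⟩ := hu
  refine ⟨h1, h2, integrableOn_disk_of_le h2.continuousOn_gradSq (h3.const_mul 2) fun x _ => ?_⟩
  rw [Real.norm_of_nonneg (gradSq_nonneg _ _), gDen]
  have : 0 ≤ 1 / (4 * ε ^ 2) * (1 - ‖u x‖ ^ 2) ^ 2 := by positivity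
  linarith

lemma gDen_add_smul (ε : ℝ) {u φ : ℂ → ℂ} {x : ℂ} (hu : DifferentiableAt ℝ u x)
    (hφ : DifferentiableAt ℝ φ x) (s : ℝ) :
    gDen ε (fun y => u y + s * φ y) x = gDen ε u x
      + s * (gradInner u φ x - (1 - ‖u x‖ ^ 2) / ε ^ 2 * inner ℝ (u x) (φ x))
      + s ^ 2 * (1 / 2 * gradSq φ x + 1 / (4 * ε ^ 2) *
          (4 * (inner ℝ (u x) (φ x)) ^ 2 - 2 * ((1 - ‖u x‖ ^ 2) * ‖φ x‖ ^ 2)))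
      + s ^ 3 * (1 / (4 * ε ^ 2) * (4 * (inner ℝ (u x) (φ x) * ‖φ x‖ ^ 2)))
      + s ^ 4 * (1 / (4 * ε ^ 2) * ‖φ x‖ ^ 4) := by
  have key : ∀ a b : ℂ, ‖a + s * b‖ ^ 2 = ‖a‖ ^ 2 + 2 * s * inner ℝ a b + s ^ 2 * ‖b‖ ^ 2 := by
    intro a b
    rw [show (s : ℂ) * b = s • b by simp, norm_add_sq_real, real_inner_smul_right, norm_smul,
      Real.norm_eq_abs, mul_pow, sq_abs]
    ring
  have hd : ∀ v, fderiv ℝ (fun y => u y + s * φ y) x v = fderiv ℝ u x v + s * fderiv ℝ φ x v := by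
    intro v
    rw [fderiv_fun_add hu (hφ.const_mul _), fderiv_const_mul hφ]
    simp
  simp only [gDen, gradSq, gradInner, hd, key]
  ring

lemma weakGL_of_minimizer {ε : ℝ} {u : ℂ → ℂ} (hu : FiniteDirichlet u)
    (hmin : ∀ φ : ℂ → ℂ, FiniteDirichlet φ → (∀ x : ℂ, ‖x‖ = 1 → φ x = 0) →
      Gn ε u ≤ Gn ε (fun x => u x + φ x)) : WeakGL ε u := by
  intro φ hφ hb
  have hi : ContinuousOn (fun x => inner ℝ (u x) (φ x)) (closedBall 0 1) :=
    hu.cont.inner (𝕜 := ℝ) hφ.cont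
  have hV : ContinuousOn (fun x => 1 - ‖u x‖ ^ 2) (closedBall 0 1) :=
    continuousOn_const.sub (hu.cont.norm.pow 2)
  have hn : ContinuousOn (fun x => ‖φ x‖ ^ 2) (closedBall 0 1) := hφ.cont.norm.pow 2
  have i0 := hu.integrable_gDen ε
  have i1a := hu.integrable_gradInner hφ
  have i1b : IntegrableOn (fun x => (1 - ‖u x‖ ^ 2) / ε ^ 2 * inner ℝ (u x) (φ x)) (ball 0 1) :=
    ((hV.div_const _).mul hi).integrableOn_disk
  have i1 := i1a.sub i1b
  have i2 : IntegrableOn (fun x => 1 / 2 * gradSq φ x + 1 / (4 * ε ^ 2) *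
          (4 * (inner ℝ (u x) (φ x)) ^ 2 - 2 * ((1 - ‖u x‖ ^ 2) * ‖φ x‖ ^ 2))) (ball 0 1) := by
    refine (hφ.integrable.const_mul _).add (ContinuousOn.integrableOn_disk ?_)
    exact continuousOn_const.mul
      ((continuousOn_const.mul (hi.pow 2)).sub (continuousOn_const.mul (hV.mul hn)))
  have i3 : IntegrableOn (fun x => 1 / (4 * ε ^ 2) * (4 * (inner ℝ (u x) (φ x) * ‖φ x‖ ^ 2)))
      (ball 0 1) :=
    (continuousOn_const.mul (continuousOn_const.mul (hi.mul hn))).integrableOn_disk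
  have i4 : IntegrableOn (fun x => 1 / (4 * ε ^ 2) * ‖φ x‖ ^ 4) (ball 0 1) :=
    (continuousOn_const.mul (hφ.cont.norm.pow 4)).integrableOn_disk
  have expand : ∀ s : ℝ, Gn ε (fun y => u y + s * φ y) = Gn ε u
      + s * (∫ x in ball (0 : ℂ) 1,
          (gradInner u φ x - (1 - ‖u x‖ ^ 2) / ε ^ 2 * inner ℝ (u x) (φ x)))
      + s ^ 2 * (∫ x in ball (0 : ℂ) 1, (1 / 2 * gradSq φ x + 1 / (4 * ε ^ 2) *
          (4 * (inner ℝ (u x) (φ x)) ^ 2 - 2 * ((1 - ‖u x‖ ^ 2) * ‖φ x‖ ^ 2))))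
      + s ^ 3 * (∫ x in ball (0 : ℂ) 1, 1 / (4 * ε ^ 2) * (4 * (inner ℝ (u x) (φ x) * ‖φ x‖ ^ 2)))
      + s ^ 4 * (∫ x in ball (0 : ℂ) 1, 1 / (4 * ε ^ 2) * ‖φ x‖ ^ 4) := by
    intro s
    have e : ∀ x ∈ ball (0 : ℂ) 1, _ := fun x hx =>
      gDen_add_smul ε (hu.smooth.differentiableAt_disk hx) (hφ.smooth.differentiableAt_disk hx) s
    rw [Gn, setIntegral_congr_fun measurableSet_ball e]
    exact integral_quartic_combination i0 i1 i2 i3 i4 s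
  have h0 := quartic_min_linear_coeff_eq_zero fun s => by
    rw [← expand s]
    exact hmin (fun x => s * φ x) (hφ.const_mul s) fun x hx => by simp [hb x hx]
  rw [← sub_eq_zero, ← integral_sub i1a i1b]
  exact h0

/-! ### Reduction to the scalar problem -/

/-- `u` has boundary values `z` and minimizes `Gn ε` among admissible scalar maps. -/
structure ScalarMinimizer (ε : ℝ) (u : ℂ → ℂ) : Prop where
  fin : FiniteDirichlet u
  boundary : ∀ x : ℂ, ‖x‖ = 1 → u x = x
  min : ∀ v, AdmissibleScalar ε v → Gn ε u ≤ Gn ε v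

lemma ScalarMinimizer.weakGL {ε : ℝ} {u : ℂ → ℂ} (hu : ScalarMinimizer ε u) : WeakGL ε u :=
  weakGL_of_minimizer hu.fin fun φ hφ hb => hu.min _ <|
    (hu.fin.add hφ).admissibleScalar ε fun x hx => by simp [hu.boundary x hx, hb x hx]

lemma gDen_nonneg (ε : ℝ) (u : ℂ → ℂ) (x : ℂ) : 0 ≤ gDen ε u x := by
  have := gradSq_nonneg u x
  unfold gDen
  positivity

lemma ScalarMinimizer.Gn_eq {ε : ℝ} {u : ℂ → ℂ} (hu : ScalarMinimizer ε u) :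
    Gn ε u = IGL ε := by
  have ha := hu.fin.admissibleScalar ε hu.boundary
  refine le_antisymm (le_csInf ⟨_, u, ha, rfl⟩ ?_) (csInf_le ⟨0, ?_⟩ ⟨u, ha, rfl⟩)
  · rintro _ ⟨v, hv, rfl⟩
    exact hu.min v hv
  · rintro _ ⟨v, -, rfl⟩
    exact integral_nonneg fun x => gDen_nonneg ε v x

lemma gradSq_const_mul {f : ℂ → ℂ} {x : ℂ} (hf : DifferentiableAt ℝ f x) (c : ℂ) :
    gradSq (fun y => c * f y) x = ‖c‖ ^ 2 * gradSq f x := by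
  simp only [gradSq, fderiv_const_mul hf]
  simp only [FunLike.coe_smul, Pi.smul_apply, smul_eq_mul, norm_mul]
  ring

lemma norm_sqrt_two_sq : ‖(Real.sqrt 2 : ℂ)‖ ^ 2 = 2 := by
  rw [Complex.norm_real, Real.norm_eq_abs, sq_abs, Real.sq_sqrt zero_le_two]

lemma sqrt_two_ne_zero : (Real.sqrt 2 : ℂ) ≠ 0 := by
  simp

lemma eDen_eq {β ε : ℝ} {ψp ψm : ℂ → ℂ} {x : ℂ} (hp : DifferentiableAt ℝ ψp x)
    (hm : DifferentiableAt ℝ ψm x) :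
    eDen ε β ψp ψm x = 1 / 2 * (gDen ε (fun y => (Real.sqrt 2 : ℂ) * ψp y) x
      + gDen ε (fun y => (Real.sqrt 2 : ℂ) * ψm y) x)
      + (β - 1) / (4 * ε ^ 2) * (‖ψp x‖ ^ 2 - ‖ψm x‖ ^ 2) ^ 2 := by
  simp only [eDen, gDen, gradSq_const_mul hp, gradSq_const_mul hm, norm_mul, mul_pow,
    norm_sqrt_two_sq]
  ring

lemma AdmissiblePair.finiteDirichlet {ε β : ℝ} (hβ : 1 < β) {np nm : ℕ} {ψp ψm : ℂ → ℂ}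
    (h : AdmissiblePair ε β np nm ψp ψm) : FiniteDirichlet ψp ∧ FiniteDirichlet ψm := by
  obtain ⟨h1, h2, h3, h4, h5, -⟩ := h
  have key : ∀ x, 0 ≤ gradSq ψp x ∧ 0 ≤ gradSq ψm x ∧
      gradSq ψp x + gradSq ψm x ≤ 2 * eDen ε β ψp ψm x := by
    intro x
    refine ⟨gradSq_nonneg _ _, gradSq_nonneg _ _, ?_⟩
    have a : 0 ≤ (1 / (4 * ε ^ 2)) * ((‖ψp x‖ ^ 2 + ‖ψm x‖ ^ 2 - 1) ^ 2) := by positivity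
    have b : 0 ≤ (β / (4 * ε ^ 2)) * ((‖ψp x‖ ^ 2 - ‖ψm x‖ ^ 2) ^ 2) := by positivity
    unfold eDen
    linarith
  refine ⟨⟨h1, h3, integrableOn_disk_of_le h3.continuousOn_gradSq (h5.const_mul 2) ?_⟩,
    ⟨h2, h4, integrableOn_disk_of_le h4.continuousOn_gradSq (h5.const_mul 2) ?_⟩⟩ <;>
  · intro x _
    obtain ⟨a, b, c⟩ := key x
    rw [Real.norm_of_nonneg (gradSq_nonneg _ _)]
    linarith

lemma integrable_excess (ε β : ℝ) {ψp ψm : ℂ → ℂ} (hp : FiniteDirichlet ψp)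
    (hm : FiniteDirichlet ψm) : IntegrableOn
      (fun x => (β - 1) / (4 * ε ^ 2) * (‖ψp x‖ ^ 2 - ‖ψm x‖ ^ 2) ^ 2) (ball 0 1) :=
  (continuousOn_const.mul (((hp.cont.norm.pow 2).sub (hm.cont.norm.pow 2)).pow 2)).integrableOn_disk

lemma En_eq (ε β : ℝ) {ψp ψm : ℂ → ℂ} (hp : FiniteDirichlet ψp) (hm : FiniteDirichlet ψm) :
    IntegrableOn (eDen ε β ψp ψm) (ball 0 1) ∧
    En ε β ψp ψm = 1 / 2 * (Gn ε (fun y => (Real.sqrt 2 : ℂ) * ψp y)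
      + Gn ε (fun y => (Real.sqrt 2 : ℂ) * ψm y))
      + ∫ x in ball (0 : ℂ) 1, (β - 1) / (4 * ε ^ 2) * (‖ψp x‖ ^ 2 - ‖ψm x‖ ^ 2) ^ 2 := by
  have ip := (hp.const_mul (Real.sqrt 2)).integrable_gDen ε
  have im := (hm.const_mul (Real.sqrt 2)).integrable_gDen ε
  have ie := integrable_excess ε β hp hm
  have e : ∀ x ∈ ball (0 : ℂ) 1, _ := fun x hx =>
    eDen_eq (β := β) (ε := ε) (hp.smooth.differentiableAt_disk hx)
      (hm.smooth.differentiableAt_disk hx)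
  have i : IntegrableOn _ (ball (0 : ℂ) 1) := ((ip.add im).const_mul (1 / 2)).add ie
  refine ⟨i.congr_fun (fun x hx => (e x hx).symm) measurableSet_ball, ?_⟩
  rw [En, setIntegral_congr_fun measurableSet_ball e]
  have e1 : ∫ x in ball (0 : ℂ) 1, _ = _ := integral_add ((ip.add im).const_mul (1 / 2)) ie
  have e2 : ∫ x in ball (0 : ℂ) 1, _ = _ := integral_add ip im
  simp only [Pi.add_apply, integral_const_mul] at e1 e2 ⊢
  rw [e1, e2, Gn, Gn]

lemma continuousOn_eq_zero_of_integral_eq_zero {g : ℂ → ℝ} (hg : ContinuousOn g (ball 0 1))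
    (hi : IntegrableOn g (ball 0 1)) (h0 : ∀ x ∈ ball (0 : ℂ) 1, 0 ≤ g x)
    (h : ∫ x in ball (0 : ℂ) 1, g x = 0) : ∀ x ∈ ball (0 : ℂ) 1, g x = 0 := by
  have h1 := (setIntegral_eq_zero_iff_of_nonneg_ae
    ((ae_restrict_iff' measurableSet_ball).2 (ae_of_all _ h0)) hi).1 h
  exact Measure.eqOn_open_of_ae_eq h1 isOpen_ball hg continuousOn_const

lemma minimizing_pair_reduction {ε β : ℝ} (hε : 0 < ε) (hβ : 1 < β) {ψp ψm : ℂ → ℂ}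
    (hadm : AdmissiblePair ε β 1 1 ψp ψm) (hmin : En ε β ψp ψm = Ival ε β 1 1) :
    (∀ x ∈ ball (0 : ℂ) 1, ‖ψp x‖ = ‖ψm x‖) ∧
    ScalarMinimizer ε (fun x => (Real.sqrt 2 : ℂ) * ψp x) ∧
    ScalarMinimizer ε (fun x => (Real.sqrt 2 : ℂ) * ψm x) := by
  obtain ⟨hp, hm⟩ := hadm.finiteDirichlet hβ
  obtain ⟨-, -, -, -, -, hb⟩ := hadm
  have hE := (En_eq ε β hp hm).2
  have hle : ∀ v, AdmissibleScalar ε v → En ε β ψp ψm ≤ Gn ε v := by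
    intro v hv
    have hv' := hv.finiteDirichlet.const_mul ((Real.sqrt 2 : ℂ)⁻¹)
    obtain ⟨i, e⟩ := En_eq ε β hv' hv'
    simp only [mul_inv_cancel_left₀ sqrt_two_ne_zero] at e
    have e' : En ε β (fun x => (Real.sqrt 2 : ℂ)⁻¹ * v x) (fun x => (Real.sqrt 2 : ℂ)⁻¹ * v x)
        = Gn ε v := by
      rw [e]; simp; ring
    rw [hmin, ← e']
    refine csInf_le ⟨0, ?_⟩ ⟨_, _, ⟨hv'.cont, hv'.cont, hv'.smooth, hv'.smooth, i, ?_⟩, rfl⟩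
    · rintro _ ⟨a, b, -, rfl⟩
      refine integral_nonneg fun x => ?_
      have h1 := gradSq_nonneg a x
      have h2 := gradSq_nonneg b x
      unfold eDen
      positivity
    · intro x hx
      rw [hv.2.2.2 x hx]; simp
  have hbd : ∀ x : ℂ, ‖x‖ = 1 → (Real.sqrt 2 : ℂ) * ψp x = x ∧ (Real.sqrt 2 : ℂ) * ψm x = x := by
    intro x hx
    rw [(hb x hx).1, (hb x hx).2, pow_one, mul_inv_cancel_left₀ sqrt_two_ne_zero]
    exact ⟨rfl, rfl⟩
  have fp := hp.const_mul (Real.sqrt 2)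
  have fm := hm.const_mul (Real.sqrt 2)
  have h1 := hle _ (fp.admissibleScalar ε fun x hx => (hbd x hx).1)
  have h2 := hle _ (fm.admissibleScalar ε fun x hx => (hbd x hx).2)
  have hc : 0 < (β - 1) / (4 * ε ^ 2) := div_pos (by linarith) (by positivity)
  have h3 : 0 ≤ ∫ x in ball (0 : ℂ) 1, (β - 1) / (4 * ε ^ 2) * (‖ψp x‖ ^ 2 - ‖ψm x‖ ^ 2) ^ 2 :=
    integral_nonneg fun x => by positivity
  refine ⟨fun x hx => ?_, ⟨fp, fun x hx => (hbd x hx).1, fun v hv => ?_⟩,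
    ⟨fm, fun x hx => (hbd x hx).2, fun v hv => ?_⟩⟩
  · have h4 := continuousOn_eq_zero_of_integral_eq_zero
        (g := fun x => (β - 1) / (4 * ε ^ 2) * (‖ψp x‖ ^ 2 - ‖ψm x‖ ^ 2) ^ 2) (ContinuousOn.mono
      (continuousOn_const.mul (((hp.cont.norm.pow 2).sub (hm.cont.norm.pow 2)).pow 2))
        ball_subset_closedBall) (integrable_excess ε β hp hm) (fun x _ => by positivity)
        (by linarith) x hx
    have h5 : (‖ψp x‖ ^ 2 - ‖ψm x‖ ^ 2) ^ 2 = 0 := by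
      rcases mul_eq_zero.1 h4 with h | h
      · exact absurd h hc.ne'
      · exact h
    have h6 : ‖ψp x‖ ^ 2 = ‖ψm x‖ ^ 2 := by
      have := pow_eq_zero_iff (two_ne_zero) |>.1 h5
      linarith
    exact (pow_left_inj₀ (norm_nonneg _) (norm_nonneg _) two_ne_zero).1 h6
  · have := hle v hv
    linarith
  · have := hle v hv
    linarith

/-! ### Equality of the Dirichlet densities -/

lemma gradInner_ofReal_mul {f h : ℂ → ℂ} {a : ℂ → ℝ} {x : ℂ} (ha : DifferentiableAt ℝ a x)
    (hh : DifferentiableAt ℝ h x) :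
    gradInner f (fun y => (a y : ℂ) * h y) x = a x * gradInner f h x
      + (fderiv ℝ a x 1 * inner ℝ (fderiv ℝ f x 1) (h x)
        + fderiv ℝ a x I * inner ℝ (fderiv ℝ f x I) (h x)) := by
  have hd : ∀ v, fderiv ℝ (fun y => (a y : ℂ) * h y) x v
      = a x • fderiv ℝ h x v + fderiv ℝ a x v • h x := by
    intro v
    have e : (fun y => (a y : ℂ) * h y) = fun y => a y • h y := by
      funext y; simp
    rw [e, fderiv_fun_smul ha hh]
    rfl
  simp only [gradInner, hd, inner_add_right, real_inner_smul_right]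
  ring

lemma inner_fderiv_eq_of_norm_eq {p m : ℂ → ℂ} (hp : ContDiffOn ℝ 1 p (ball 0 1))
    (hm : ContDiffOn ℝ 1 m (ball 0 1)) (hn : ∀ x ∈ ball (0 : ℂ) 1, ‖p x‖ = ‖m x‖) {x : ℂ}
    (hx : x ∈ ball (0 : ℂ) 1) (v : ℂ) :
    inner ℝ (fderiv ℝ p x v) (p x) = inner ℝ (fderiv ℝ m x v) (m x) := by
  have h1 := (hp.differentiableAt_disk hx).hasFDerivAt.norm_sq
  have h2 := (hm.differentiableAt_disk hx).hasFDerivAt.norm_sq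
  have e : (fun y => ‖m y‖ ^ 2) =ᶠ[nhds x] fun y => ‖p y‖ ^ 2 := by
    filter_upwards [isOpen_ball.mem_nhds hx] with y hy
    rw [hn y hy]
  have h3 := congrArg (fun L => L v) (h1.unique (h2.congr_of_eventuallyEq e.symm))
  simp at h3 ⊢
  linarith

lemma eqOn_disk_zero_of_integral_smul_eq_zero {g : ℂ → ℝ} (hg : ContinuousOn g (ball 0 1))
    (hi : IntegrableOn g (ball 0 1))
    (h : ∀ a : ℂ → ℝ, ContDiff ℝ 1 a → HasCompactSupport a → tsupport a ⊆ ball 0 1 →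
      ∫ x in ball (0 : ℂ) 1, a x * g x = 0) : ∀ x ∈ ball (0 : ℂ) 1, g x = 0 := by
  have h1 := isOpen_ball.ae_eq_zero_of_integral_contDiff_smul_eq_zero
    (hi.locallyIntegrableOn) (μ := volume) fun a h1 h2 h3 => by
      rw [← h a (h1.of_le (by simp)) h2 h3, setIntegral_eq_integral_of_forall_compl_eq_zero]
      · rfl
      · intro x hx
        rw [image_eq_zero_of_notMem_tsupport fun h => hx (h3 h), zero_mul]
  refine Measure.eqOn_open_of_ae_eq (μ := volume) ?_ isOpen_ball hg continuousOn_const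
  exact (ae_restrict_iff' measurableSet_ball).2 h1

lemma FiniteDirichlet.ofReal_mul {h : ℂ → ℂ} {a : ℂ → ℝ} (ha : ContDiff ℝ 1 a)
    (hh : FiniteDirichlet h) : FiniteDirichlet (fun y => (a y : ℂ) * h y) :=
  (FiniteDirichlet.of_contDiff (ofRealCLM.contDiff.comp ha)).mul hh

lemma FiniteDirichlet.integrable_mul_gradInner {f h : ℂ → ℂ} {a : ℂ → ℝ} (ha : ContDiff ℝ 1 a)
    (hf : FiniteDirichlet f) (hh : FiniteDirichlet h) :
    IntegrableOn (fun x => a x * gradInner f h x) (ball 0 1) := by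
  obtain ⟨M, -, hM⟩ := ha.continuous.continuousOn.exists_bound_disk
  exact Integrable.bdd_mul (hf.integrable_gradInner hh)
    ha.continuous.continuousOn.aestronglyMeasurable_disk (c := M)
    ((ae_restrict_iff' measurableSet_ball).2
      (ae_of_all _ fun x hx => hM x (ball_subset_closedBall hx)))

lemma integrable_fderiv_mul_inner {f h : ℂ → ℂ} {a : ℂ → ℝ} (ha : ContDiff ℝ 1 a)
    (hf : FiniteDirichlet f) (hh : FiniteDirichlet h) : IntegrableOn
      (fun x => fderiv ℝ a x 1 * inner ℝ (fderiv ℝ f x 1) (h x)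
        + fderiv ℝ a x I * inner ℝ (fderiv ℝ f x I) (h x)) (ball 0 1) := by
  have h1 := hf.integrable_gradInner (hh.ofReal_mul ha)
  have h2 := hf.integrable_mul_gradInner ha hh
  refine IntegrableOn.congr_fun (h1.sub h2) (fun x hx => ?_) measurableSet_ball
  rw [Pi.sub_apply, gradInner_ofReal_mul (ha.differentiable one_ne_zero).differentiableAt
    (hh.smooth.differentiableAt_disk hx)]
  ring

lemma integral_gradInner_ofReal_mul {f h : ℂ → ℂ} {a : ℂ → ℝ} (ha : ContDiff ℝ 1 a)
    (hf : FiniteDirichlet f) (hh : FiniteDirichlet h) :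
    ∫ x in ball (0 : ℂ) 1, gradInner f (fun y => (a y : ℂ) * h y) x =
      (∫ x in ball (0 : ℂ) 1, a x * gradInner f h x) +
      ∫ x in ball (0 : ℂ) 1, (fderiv ℝ a x 1 * inner ℝ (fderiv ℝ f x 1) (h x)
        + fderiv ℝ a x I * inner ℝ (fderiv ℝ f x I) (h x)) := by
  rw [setIntegral_congr_fun measurableSet_ball fun x hx => gradInner_ofReal_mul
    (ha.differentiable one_ne_zero).differentiableAt (hh.smooth.differentiableAt_disk hx)]
  exact integral_add (hf.integrable_mul_gradInner ha hh) (integrable_fderiv_mul_inner ha hf hh)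

lemma gradSq_eq_of_norm_eq {ε : ℝ} {p m : ℂ → ℂ} (hp : FiniteDirichlet p) (hm : FiniteDirichlet m)
    (wp : WeakGL ε p) (wm : WeakGL ε m) (hn : ∀ x ∈ ball (0 : ℂ) 1, ‖p x‖ = ‖m x‖) :
    ∀ x ∈ ball (0 : ℂ) 1, gradSq p x = gradSq m x := by
  suffices h : ∀ x ∈ ball (0 : ℂ) 1, gradSq p x - gradSq m x = 0 from
    fun x hx => sub_eq_zero.1 (h x hx)
  refine eqOn_disk_zero_of_integral_smul_eq_zero
    (hp.smooth.continuousOn_gradSq.sub hm.smooth.continuousOn_gradSq)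
    (hp.integrable.sub hm.integrable) fun a ha hc hs => ?_
  have hb : ∀ x : ℂ, ‖x‖ = 1 → a x = 0 := fun x hx =>
    image_eq_zero_of_notMem_tsupport fun h => by
      have := hs h
      simp [hx] at this
  have e1 := wp _ (hp.ofReal_mul ha) fun x hx => by simp [hb x hx]
  have e2 := wm _ (hm.ofReal_mul ha) fun x hx => by simp [hb x hx]
  rw [integral_gradInner_ofReal_mul ha hp hp] at e1
  rw [integral_gradInner_ofReal_mul ha hm hm] at e2
  have e3 : ∫ x in ball (0 : ℂ) 1, (fderiv ℝ a x 1 * inner ℝ (fderiv ℝ p x 1) (p x)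
        + fderiv ℝ a x I * inner ℝ (fderiv ℝ p x I) (p x)) =
      ∫ x in ball (0 : ℂ) 1, (fderiv ℝ a x 1 * inner ℝ (fderiv ℝ m x 1) (m x)
        + fderiv ℝ a x I * inner ℝ (fderiv ℝ m x I) (m x)) :=
    setIntegral_congr_fun measurableSet_ball fun x hx => by
      simp only [inner_fderiv_eq_of_norm_eq hp.smooth hm.smooth hn hx]
  have e4 : ∫ x in ball (0 : ℂ) 1, (1 - ‖p x‖ ^ 2) / ε ^ 2 * inner ℝ (p x) ((a x : ℂ) * p x) =
      ∫ x in ball (0 : ℂ) 1, (1 - ‖m x‖ ^ 2) / ε ^ 2 * inner ℝ (m x) ((a x : ℂ) * m x) :=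
    setIntegral_congr_fun measurableSet_ball fun x hx => by
      have : ∀ c : ℂ, inner ℝ c ((a x : ℂ) * c) = a x * ‖c‖ ^ 2 := fun c => by
        rw [← Complex.real_smul, real_inner_smul_right, real_inner_self_eq_norm_sq]
      simp only [this, hn x hx]
  have e5 := integral_sub (hp.integrable_mul_gradInner ha hp) (hm.integrable_mul_gradInner ha hm)
  simp only [gradInner_self] at e1 e2 e5
  have e6 : ∀ x, a x * (gradSq p x - gradSq m x) = a x * gradSq p x - a x * gradSq m x :=
    fun x => by ring
  simp only [e6]
  rw [e5]
  linarith

/-! ### Domain variations -/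

/-- The Jacobian determinant of a planar vector field. -/
def jac (X : ℂ → ℂ) (x : ℂ) : ℝ :=
  (fderiv ℝ X x 1).re * (fderiv ℝ X x I).im - (fderiv ℝ X x I).re * (fderiv ℝ X x 1).im

/-- The divergence of a planar vector field. -/
def divg (X : ℂ → ℂ) (x : ℂ) : ℝ := (fderiv ℝ X x 1).re + (fderiv ℝ X x I).im

lemma det_complex (L : ℂ →L[ℝ] ℂ) : L.det = (L 1).re * (L I).im - (L I).re * (L 1).im := by
  rw [ContinuousLinearMap.det, ← LinearMap.det_toMatrix Complex.basisOneI, Matrix.det_fin_two]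
  simp [LinearMap.toMatrix_apply]

lemma jac_deformation {X : ℂ → ℂ} {x : ℂ} (hX : DifferentiableAt ℝ X x) (t : ℝ) :
    HasFDerivAt (fun y => y + t • X y) (ContinuousLinearMap.id ℝ ℂ + t • fderiv ℝ X x) x ∧
    (ContinuousLinearMap.id ℝ ℂ + t • fderiv ℝ X x).det = 1 + t * divg X x + t ^ 2 * jac X x := by
  refine ⟨(hasFDerivAt_id x).add (hX.hasFDerivAt.const_smul t), ?_⟩
  rw [det_complex]
  simp [divg, jac]
  ring

/-- Basic properties of the deformation `x ↦ x + t • X x` of the disk. -/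
structure IsDeformation (X : ℂ → ℂ) (t : ℝ) : Prop where
  inj : Function.Injective fun x => x + t • X x
  mapsTo_tsupport : MapsTo (fun x => x + t • X x) (tsupport X) (tsupport X)
  mapsTo_ball : MapsTo (fun x => x + t • X x) (ball 0 1) (ball 0 1)
  image_ball : (fun x => x + t • X x) '' ball 0 1 = ball 0 1
  det_pos : ∀ x, 0 < 1 + t * divg X x + t ^ 2 * jac X x

lemma hasCompactSupport_of_tsupport_subset_ball {E : Type*} [Zero E] {X : ℂ → E}
    (hs : tsupport X ⊆ ball 0 1) : HasCompactSupport X :=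
  (isCompact_closedBall (0 : ℂ) 1).of_isClosed_subset (isClosed_tsupport X)
    (hs.trans ball_subset_closedBall)

lemma exists_bound_fderiv {E : Type*} [NormedAddCommGroup E] [NormedSpace ℝ E] {X : ℂ → E}
    (hX : ContDiff ℝ 1 X) (hs : HasCompactSupport X) :
    ∃ N, 0 ≤ N ∧ ∀ x, ‖fderiv ℝ X x‖ ≤ N := by
  obtain ⟨N, hN⟩ := (hX.continuous_fderiv one_ne_zero).bounded_above_of_compact_support
    (hs.fderiv ℝ)
  exact ⟨N, (norm_nonneg _).trans (hN 0), hN⟩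

lemma bijective_add_smul {X : ℂ → ℂ} {C : NNReal} (hC : LipschitzWith C X) {t : ℝ}
    (ht : |t| * C < 1) : Function.Bijective fun x => x + t • X x := by
  have hcon : ∀ y : ℂ, ContractingWith (‖t‖₊ * C) fun x => y - t • X x := by
    intro y
    refine ⟨?_, ?_⟩
    · rw [← NNReal.coe_lt_coe]
      simpa using ht
    · refine LipschitzWith.of_dist_le_mul fun a b => ?_
      have := hC.dist_le_mul a b
      rw [dist_sub_left, dist_smul₀]
      push_cast
      rw [mul_assoc]
      gcongr
  constructor
  · intro a b hab
    refine (hcon (a + t • X a)).fixedPoint_unique' ?_ ?_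
    · simp [Function.IsFixedPt]
    · change a + t • X a - t • X b = b
      rw [show a + t • X a = b + t • X b from hab]
      simp
  · intro y
    have := (hcon y).fixedPoint_isFixedPt
    exact ⟨_, (sub_eq_iff_eq_add.1 this).symm⟩

lemma bijective_mapsTo_of_eq_off {Φ : ℂ → ℂ} {K : Set ℂ} (hΦ : Function.Injective Φ)
    (h : ∀ x, x ∉ K → Φ x = x) {S : Set ℂ} (hS : K ⊆ S) : MapsTo Φ S S := by
  intro x hx
  by_contra hn
  have h1 : Φ (Φ x) = Φ x := h _ fun h' => hn (hS h')
  exact hn ((hΦ h1).symm ▸ hx)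

lemma eventually_isDeformation {X : ℂ → ℂ} (hX : ContDiff ℝ 1 X) (hs : tsupport X ⊆ ball 0 1) :
    ∃ r > 0, r ≤ 1 ∧ ∀ t : ℝ, |t| ≤ r → IsDeformation X t := by
  have hc := hasCompactSupport_of_tsupport_subset_ball hs
  obtain ⟨C, hC⟩ := hX.lipschitzWith_of_hasCompactSupport hc one_ne_zero
  obtain ⟨N, hN0, hN⟩ := exists_bound_fderiv hX hc
  have hC0 : (0 : ℝ) ≤ C := C.2
  refine ⟨1 / (8 * (N + C + 1)), by positivity, ?_, fun t ht => ?_⟩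
  · rw [div_le_one (by positivity)]
    linarith
  have ht' : |t| * (8 * (N + C + 1)) ≤ 1 := by
    rwa [le_div_iff₀ (by positivity)] at ht
  have a0 := abs_nonneg t
  have tN0 : 0 ≤ |t| * N := by positivity
  have tC0 : 0 ≤ |t| * C := by positivity
  have tN : |t| * N ≤ 1 / 8 := by nlinarith
  have tC : |t| * C < 1 := by nlinarith
  obtain ⟨hinj, hsurj⟩ := bijective_add_smul hC tC
  have hoff : ∀ x, x ∉ tsupport X → x + t • X x = x := fun x hx => by
    rw [image_eq_zero_of_notMem_tsupport hx]; simp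
  have hb := bijective_mapsTo_of_eq_off hinj hoff hs
  refine ⟨hinj, bijective_mapsTo_of_eq_off hinj hoff subset_rfl, hb, ?_, fun x => ?_⟩
  · refine subset_antisymm hb.image_subset fun y hy => ?_
    obtain ⟨x, rfl⟩ := hsurj y
    refine ⟨x, ?_, rfl⟩
    by_contra hn
    exact hn ((hoff x fun h => hn (hs h)) ▸ hy)
  · have h1 : ‖fderiv ℝ X x 1‖ ≤ N := by
      simpa using (fderiv ℝ X x).le_of_opNorm_le (hN x) 1
    have h2 : ‖fderiv ℝ X x I‖ ≤ N := by
      simpa using (fderiv ℝ X x).le_of_opNorm_le (hN x) I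
    have b1 : ∀ a : ℝ, |a| ≤ N → |t * a| ≤ 1 / 8 := fun a ha => by
      rw [abs_mul]
      exact (mul_le_mul_of_nonneg_left ha a0).trans tN
    have c1 := b1 _ ((abs_re_le_norm _).trans h1)
    have c2 := b1 _ ((abs_im_le_norm _).trans h1)
    have c3 := b1 _ ((abs_re_le_norm _).trans h2)
    have c4 := b1 _ ((abs_im_le_norm _).trans h2)
    have d1 : |t * (fderiv ℝ X x 1).re * (t * (fderiv ℝ X x I).im)| ≤ 1 / 8 * (1 / 8) := by
      rw [abs_mul]; gcongr
    have d2 : |t * (fderiv ℝ X x I).re * (t * (fderiv ℝ X x 1).im)| ≤ 1 / 8 * (1 / 8) := by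
      rw [abs_mul]; gcongr
    rw [abs_le] at c1 c4 d1 d2
    unfold divg jac
    nlinarith

/-- The difference quotient of the energy density under a domain deformation. -/
def domVar (ε : ℝ) (u X : ℂ → ℂ) (t : ℝ) (x : ℂ) : ℝ :=
  inner ℝ (fderiv ℝ u (x + t • X x) 1) (fderiv ℝ u (x + t • X x) (fderiv ℝ X x 1))
    + inner ℝ (fderiv ℝ u (x + t • X x) I) (fderiv ℝ u (x + t • X x) (fderiv ℝ X x I))
    + t / 2 * (‖fderiv ℝ u (x + t • X x) (fderiv ℝ X x 1)‖ ^ 2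
      + ‖fderiv ℝ u (x + t • X x) (fderiv ℝ X x I)‖ ^ 2)
    - gDen ε u (x + t • X x) * (divg X x + t * jac X x)

lemma gDen_deformation (ε : ℝ) {u X : ℂ → ℂ} {t : ℝ} {x : ℂ} (hX : DifferentiableAt ℝ X x)
    (hu : DifferentiableAt ℝ u (x + t • X x)) :
    gDen ε (fun y => u (y + t • X y)) x =
      (1 + t * divg X x + t ^ 2 * jac X x) * gDen ε u (x + t • X x) + t * domVar ε u X t x := by
  have hd : ∀ v, fderiv ℝ (fun y => u (y + t • X y)) x v =
      fderiv ℝ u (x + t • X x) v + t • fderiv ℝ u (x + t • X x) (fderiv ℝ X x v) := by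
    intro v
    have := (hu.hasFDerivAt.comp x (jac_deformation hX t).1).fderiv
    change fderiv ℝ (u ∘ fun y => y + t • X y) x v = _
    rw [this]
    simp
  simp only [domVar, gDen, gradSq, hd, norm_add_sq_real, real_inner_smul_right, norm_smul,
    Real.norm_eq_abs, mul_pow, sq_abs]
  ring

lemma FiniteDirichlet.deformation {u X : ℂ → ℂ} (hu : FiniteDirichlet u) (hX : ContDiff ℝ 1 X)
    (hs : tsupport X ⊆ ball 0 1) {t : ℝ} (ht : IsDeformation X t) :
    FiniteDirichlet fun x => u (x + t • X x) := by
  have hΦ : ContDiff ℝ 1 fun x => x + t • X x := contDiff_id.add (hX.const_smul t)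
  have hoff : ∀ x, x ∉ tsupport X → x + t • X x = x := fun x hx => by
    rw [image_eq_zero_of_notMem_tsupport hx]; simp
  have hsm : ContDiffOn ℝ 1 (fun x => u (x + t • X x)) (ball 0 1) :=
    hu.smooth.comp hΦ.contDiffOn ht.mapsTo_ball
  refine ⟨hu.cont.comp hΦ.continuous.continuousOn
    (bijective_mapsTo_of_eq_off ht.inj hoff (hs.trans ball_subset_closedBall)), hsm, ?_⟩
  obtain ⟨M, hM⟩ := (hasCompactSupport_of_tsupport_subset_ball hs).isCompact
    |>.exists_bound_of_continuousOn (hsm.continuousOn_gradSq.mono hs)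
  have hM' : IntegrableOn (fun _ : ℂ => |M|) (ball 0 1) :=
    continuousOn_const.integrableOn_disk
  refine integrableOn_disk_of_le hsm.continuousOn_gradSq (hu.integrable.add hM') fun x hx => ?_
  rw [Pi.add_apply]
  by_cases hK : x ∈ tsupport X
  · have := gradSq_nonneg u x
    linarith [hM x hK, le_abs_self M]
  · have e : (fun x => u (x + t • X x)) =ᶠ[nhds x] u := by
      filter_upwards [(isClosed_tsupport X).isOpen_compl.mem_nhds hK] with y hy
      rw [hoff y hy]
    rw [Real.norm_of_nonneg (gradSq_nonneg _ _), gradSq, e.fderiv_eq, ← gradSq]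
    linarith [abs_nonneg M]

lemma Gn_deformation {ε : ℝ} {u X : ℂ → ℂ} (hu : FiniteDirichlet u) (hX : ContDiff ℝ 1 X)
    (hs : tsupport X ⊆ ball 0 1) {t : ℝ} (ht : IsDeformation X t) :
    Gn ε (fun x => u (x + t • X x)) = Gn ε u + t * ∫ x in ball (0 : ℂ) 1, domVar ε u X t x := by
  have hd : ∀ x, DifferentiableAt ℝ X x := (hX.differentiable one_ne_zero)
  have hder : ∀ x ∈ ball (0 : ℂ) 1, HasFDerivWithinAt (fun y => y + t • X y)
      (ContinuousLinearMap.id ℝ ℂ + t • fderiv ℝ X x) (ball 0 1) x := fun x _ =>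
    (jac_deformation (hd x) t).1.hasFDerivWithinAt
  have hcv := integral_image_eq_integral_abs_det_fderiv_smul volume measurableSet_ball hder
    ht.inj.injOn (gDen ε u)
  have hci := integrableOn_image_iff_integrableOn_abs_det_fderiv_smul volume measurableSet_ball
    hder ht.inj.injOn (gDen ε u)
  rw [ht.image_ball] at hcv hci
  have hdet : ∀ x, |(ContinuousLinearMap.id ℝ ℂ + t • fderiv ℝ X x).det|
      = 1 + t * divg X x + t ^ 2 * jac X x := fun x => by
    rw [(jac_deformation (hd x) t).2, abs_of_pos (ht.det_pos x)]
  simp only [hdet, smul_eq_mul] at hcv hci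
  have i1 := hci.1 (hu.integrable_gDen ε)
  have i2 := (hu.deformation hX hs ht).integrable_gDen ε
  have e : ∀ x ∈ ball (0 : ℂ) 1, t * domVar ε u X t x = gDen ε (fun y => u (y + t • X y)) x
      - (1 + t * divg X x + t ^ 2 * jac X x) * gDen ε u (x + t • X x) := fun x hx => by
    rw [gDen_deformation ε (hd x) (hu.smooth.differentiableAt_disk (ht.mapsTo_ball hx))]
    ring
  rw [← integral_const_mul, setIntegral_congr_fun measurableSet_ball e, integral_sub i2 i1, ← hcv,
    Gn, Gn]
  ring

lemma continuousOn_domVar {ε : ℝ} {u X : ℂ → ℂ} (hu : FiniteDirichlet u) (hX : ContDiff ℝ 1 X) :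
    ContinuousOn (fun q : ℝ × ℂ => domVar ε u X q.1 q.2)
      {q : ℝ × ℂ | q.2 + q.1 • X q.2 ∈ ball (0 : ℂ) 1} := by
  have hΦ : Continuous fun q : ℝ × ℂ => q.2 + q.1 • X q.2 :=
    continuous_snd.add (continuous_fst.smul (hX.continuous.comp continuous_snd))
  have hm : MapsTo (fun q : ℝ × ℂ => q.2 + q.1 • X q.2)
      {q : ℝ × ℂ | q.2 + q.1 • X q.2 ∈ ball (0 : ℂ) 1} (ball 0 1) := fun q hq => hq
  have hL := (hu.smooth.continuousOn_fderiv_of_isOpen isOpen_ball le_rfl).comp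
    hΦ.continuousOn hm
  have hXd : ∀ v, Continuous fun q : ℝ × ℂ => fderiv ℝ X q.2 v := fun v =>
    ((hX.continuous_fderiv one_ne_zero).comp continuous_snd).clm_apply continuous_const
  have h1 := hL.clm_apply (continuousOn_const (c := (1 : ℂ)))
  have h2 := hL.clm_apply (continuousOn_const (c := I))
  have h3 := hL.clm_apply (hXd 1).continuousOn
  have h4 := hL.clm_apply (hXd I).continuousOn
  have hg : ContinuousOn (gDen ε u) (ball 0 1) :=
    (continuousOn_const.mul hu.smooth.continuousOn_gradSq).add (continuousOn_const.mul
      ((continuousOn_const.sub ((hu.cont.mono ball_subset_closedBall).norm.pow 2)).pow 2))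
  have h5 := hg.comp hΦ.continuousOn hm
  have hdiv : Continuous fun q : ℝ × ℂ => divg X q.2 + q.1 * jac X q.2 := by
    have a := hXd 1
    have b := hXd I
    unfold divg jac
    fun_prop
  exact (((h1.inner (𝕜 := ℝ) h3).add (h2.inner (𝕜 := ℝ) h4)).add
    (((continuous_fst.div_const 2).continuousOn).mul ((h3.norm.pow 2).add (h4.norm.pow 2)))).sub
      (h5.mul hdiv.continuousOn)

lemma domVar_of_notMem_tsupport {ε t : ℝ} {u X : ℂ → ℂ} {x : ℂ} (hx : x ∉ tsupport X) :
    domVar ε u X t x = 0 := by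
  simp [domVar, divg, jac, fderiv_of_notMem_tsupport ℝ hx]

lemma tendsto_domVar {ε : ℝ} {u X : ℂ → ℂ} (hu : FiniteDirichlet u) (hX : ContDiff ℝ 1 X)
    {x : ℂ} (hx : x ∈ ball (0 : ℂ) 1) :
    Tendsto (fun t => domVar ε u X t x) (nhds 0) (nhds (domVar ε u X 0 x)) := by
  have hΦ : Continuous fun t : ℝ => x + t • X x := by fun_prop
  have hO : IsOpen {t : ℝ | x + t • X x ∈ ball (0 : ℂ) 1} := isOpen_ball.preimage hΦ
  have hc : ContinuousOn (fun t => domVar ε u X t x) {t : ℝ | x + t • X x ∈ ball (0 : ℂ) 1} :=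
    (continuousOn_domVar (ε := ε) hu hX).comp (f := fun t : ℝ => (t, x)) (by fun_prop)
      fun t ht => ht
  exact hc.continuousAt (hO.mem_nhds (by simpa using hx))

lemma tendsto_integral_domVar {ε : ℝ} {u X : ℂ → ℂ} (hu : FiniteDirichlet u)
    (hX : ContDiff ℝ 1 X) (hs : tsupport X ⊆ ball 0 1) :
    Tendsto (fun t => ∫ x in ball (0 : ℂ) 1, domVar ε u X t x) (nhds 0)
      (nhds (∫ x in ball (0 : ℂ) 1, domVar ε u X 0 x)) := by
  obtain ⟨r, hr, -, hdef⟩ := eventually_isDeformation hX hs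
  have hK := (hasCompactSupport_of_tsupport_subset_ball hs).isCompact
  have hcont := continuousOn_domVar (ε := ε) hu hX
  obtain ⟨M, hM⟩ := (isCompact_Icc (a := -r) (b := r)).prod hK |>.exists_bound_of_continuousOn
    (hcont.mono fun q hq => hs ((hdef q.1 (abs_le.2 hq.1)).mapsTo_tsupport hq.2))
  have hev : ∀ᶠ t in nhds (0 : ℝ), |t| ≤ r := by
    filter_upwards [Icc_mem_nhds (neg_lt_zero.2 hr) hr] with t ht using abs_le.2 ht
  refine tendsto_integral_filter_of_dominated_convergence (fun _ => |M|) ?_ ?_ ?_ ?_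
  · filter_upwards [hev] with t ht
    refine ContinuousOn.aestronglyMeasurable_disk ?_
    exact hcont.comp (f := fun x : ℂ => (t, x)) (by fun_prop)
      fun x hx => (hdef t ht).mapsTo_ball hx
  · filter_upwards [hev] with t ht
    refine ae_of_all _ fun x => ?_
    by_cases hx : x ∈ tsupport X
    · exact (hM (t, x) ⟨abs_le.1 ht, hx⟩).trans (le_abs_self M)
    · rw [domVar_of_notMem_tsupport hx, norm_zero]
      exact abs_nonneg M
  · exact (continuousOn_const (c := |M|)).integrableOn_disk
  · refine (ae_restrict_iff' measurableSet_ball).2 (ae_of_all _ fun x hx => ?_)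
    exact tendsto_domVar hu hX hx

/-- Stationarity with respect to domain variations. -/
lemma ScalarMinimizer.integral_domVar_eq_zero {ε : ℝ} {u X : ℂ → ℂ} (hu : ScalarMinimizer ε u)
    (hX : ContDiff ℝ 1 X) (hs : tsupport X ⊆ ball 0 1) :
    ∫ x in ball (0 : ℂ) 1, domVar ε u X 0 x = 0 := by
  obtain ⟨r, hr, -, hdef⟩ := eventually_isDeformation hX hs
  have hlim := tendsto_integral_domVar (ε := ε) hu.fin hX hs
  have hev : ∀ᶠ t in nhds (0 : ℝ), 0 ≤ t * ∫ x in ball (0 : ℂ) 1, domVar ε u X t x := by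
    filter_upwards [Icc_mem_nhds (neg_lt_zero.2 hr) hr] with t ht
    have hd := hdef t (abs_le.2 ht)
    have := hu.min _ ((hu.fin.deformation hX hs hd).admissibleScalar ε fun x hx => ?_)
    · rw [Gn_deformation hu.fin hX hs hd] at this
      linarith
    · have hx' : x ∉ tsupport X := fun h => by
        have := hs h
        simp [hx] at this
      rw [image_eq_zero_of_notMem_tsupport hx', smul_zero, add_zero, hu.boundary x hx]
  refine le_antisymm
    (le_of_tendsto (hlim.mono_left (nhdsWithin_le_nhds (s := Iio 0))) ?_)
    (ge_of_tendsto (hlim.mono_left (nhdsWithin_le_nhds (s := Ioi 0))) ?_)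
  · filter_upwards [nhdsWithin_le_nhds hev, self_mem_nhdsWithin] with t h1 h2
    exact nonpos_of_mul_nonneg_right h1 h2
  · filter_upwards [nhdsWithin_le_nhds hev, self_mem_nhdsWithin] with t h1 h2
    exact nonneg_of_mul_nonneg_right h1 h2

/-- The difference of the stress tensors of two maps, as a bilinear form. -/
def stressDiff (p m : ℂ → ℂ) (x a b : ℂ) : ℝ :=
  inner ℝ (fderiv ℝ p x a) (fderiv ℝ p x b) - inner ℝ (fderiv ℝ m x a) (fderiv ℝ m x b)

lemma integrable_domVar {ε : ℝ} {u X : ℂ → ℂ} (hu : FiniteDirichlet u)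
    (hX : ContDiff ℝ 1 X) (hs : tsupport X ⊆ ball 0 1) :
    IntegrableOn (domVar ε u X 0) (ball 0 1) := by
  have hK := (hasCompactSupport_of_tsupport_subset_ball hs).isCompact
  have hcont : ContinuousOn (domVar ε u X 0) (ball 0 1) :=
    (continuousOn_domVar (ε := ε) hu hX).comp (f := fun x : ℂ => ((0 : ℝ), x)) (by fun_prop)
      fun x hx => by simpa using hx
  obtain ⟨M, hM⟩ := hK.exists_bound_of_continuousOn (hcont.mono hs)
  refine integrableOn_disk_of_le hcont (continuousOn_const (c := |M|)).integrableOn_disk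
    fun x _ => ?_
  by_cases hx : x ∈ tsupport X
  · exact (hM x hx).trans (le_abs_self M)
  · rw [domVar_of_notMem_tsupport hx, norm_zero]
    exact abs_nonneg M

lemma integral_stressDiff_eq_zero {ε : ℝ} {p m : ℂ → ℂ} (hp : ScalarMinimizer ε p)
    (hm : ScalarMinimizer ε m) (hn : ∀ x ∈ ball (0 : ℂ) 1, ‖p x‖ = ‖m x‖) {X : ℂ → ℂ}
    (hX : ContDiff ℝ 1 X) (hs : tsupport X ⊆ ball 0 1) :
    ∫ x in ball (0 : ℂ) 1, (stressDiff p m x 1 (fderiv ℝ X x 1)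
      + stressDiff p m x I (fderiv ℝ X x I)) = 0 := by
  have hg := gradSq_eq_of_norm_eq hp.fin hm.fin hp.weakGL hm.weakGL hn
  have e : ∀ x ∈ ball (0 : ℂ) 1, stressDiff p m x 1 (fderiv ℝ X x 1)
      + stressDiff p m x I (fderiv ℝ X x I) = domVar ε p X 0 x - domVar ε m X 0 x :=
    fun x hx => by
      simp only [domVar, stressDiff, gDen, zero_smul, add_zero, hg x hx, hn x hx]
      ring
  rw [setIntegral_congr_fun measurableSet_ball e,
    integral_sub (integrable_domVar hp.fin hX hs) (integrable_domVar hm.fin hX hs),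
    hp.integral_domVar_eq_zero hX hs, hm.integral_domVar_eq_zero hX hs, sub_zero]

/-! ### A boundary estimate -/

lemma sq_lintegral_le {α : Type*} [MeasurableSpace α] {μ : Measure α} {g : α → ENNReal}
    (hg : AEMeasurable g μ) : (∫⁻ a, g a ∂μ) ^ 2 ≤ μ univ * ∫⁻ a, g a ^ 2 ∂μ := by
  have h := ENNReal.lintegral_mul_le_Lp_mul_Lq μ Real.HolderConjugate.two_two
    (f := fun _ => 1) (g := g) aemeasurable_const hg
  have h2 : ∀ z : ENNReal, (z ^ (2⁻¹ : ℝ)) ^ 2 = z := fun z => by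
    rw [← ENNReal.rpow_natCast, ← ENNReal.rpow_mul]; norm_num
  have h3 := pow_le_pow_left' h 2
  simpa [mul_pow, h2] using h3

lemma lintegral_comp_mul_le (H : ℂ → ENNReal) (hH : Measurable H) {c : ℂ} (hc : 1 ≤ ‖c‖) :
    ∫⁻ x, H (c * x) ≤ ∫⁻ x, H x := by
  have hd : LinearMap.det (LinearMap.mulLeft ℝ c) = ‖c‖ ^ 2 := by
    rw [← LinearMap.det_toMatrix Complex.basisOneI, Matrix.det_fin_two, Complex.sq_norm,
      Complex.normSq_apply]
    simp [LinearMap.toMatrix_apply]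
  have hm := Measure.map_linearMap_addHaar_eq_smul_addHaar (volume : Measure ℂ)
    (f := LinearMap.mulLeft ℝ c) (by rw [hd]; positivity)
  have e : ∫⁻ x, H (c * x) = ∫⁻ x, H x ∂(Measure.map (LinearMap.mulLeft ℝ c) volume) :=
    (lintegral_map hH (by fun_prop)).symm
  rw [e, hm, lintegral_smul_measure, hd]
  refine mul_le_of_le_one_left' ?_
  rw [ENNReal.ofReal_le_one, abs_of_nonneg (by positivity)]
  exact inv_le_one_of_one_le₀ (one_le_pow₀ hc)

lemma lintegral_sq_le_of_enorm_le {f : ℂ → ℂ} {S : Set ℂ} (hS : MeasurableSet S) {G : ℂ → ENNReal}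
    (hG : Measurable G) {a b : ℝ} {c : ℝ → ℂ} (hc : Measurable c) (h1 : ∀ s ∈ Ioo a b, 1 ≤ ‖c s‖)
    (hf : ∀ x ∈ S, ‖f x‖ₑ ≤ ∫⁻ s in Ioo a b, G (c s * x)) :
    ∫⁻ x in S, ‖f x‖ₑ ^ 2 ≤ ENNReal.ofReal (b - a) ^ 2 * ∫⁻ x, G x ^ 2 := by
  have hm : Measurable fun q : ℂ × ℝ => G (c q.2 * q.1) := by fun_prop
  calc ∫⁻ x in S, ‖f x‖ₑ ^ 2
      ≤ ∫⁻ x in S, ENNReal.ofReal (b - a) * ∫⁻ s in Ioo a b, G (c s * x) ^ 2 := by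
        refine setLIntegral_mono' hS fun x hx => ?_
        refine (pow_le_pow_left' (hf x hx) 2).trans ?_
        have := sq_lintegral_le (μ := volume.restrict (Ioo a b)) (g := fun s => G (c s * x))
          (by fun_prop)
        simpa using this
    _ ≤ ∫⁻ x, ENNReal.ofReal (b - a) * ∫⁻ s in Ioo a b, G (c s * x) ^ 2 :=
        setLIntegral_le_lintegral _ _
    _ = ENNReal.ofReal (b - a) * ∫⁻ s in Ioo a b, ∫⁻ x, G (c s * x) ^ 2 := by
        rw [lintegral_const_mul' _ _ ENNReal.ofReal_ne_top, lintegral_lintegral_swap]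
        exact (hm.pow_const 2).aemeasurable
    _ ≤ ENNReal.ofReal (b - a) * ∫⁻ s in Ioo a b, ∫⁻ x, G x ^ 2 := by
        gcongr ENNReal.ofReal (b - a) * ?_
        exact setLIntegral_mono' measurableSet_Ioo fun s hs =>
          lintegral_comp_mul_le _ (hG.pow_const 2) (h1 s hs)
    _ = _ := by
        rw [setLIntegral_const, Real.volume_Ioo]
        ring

lemma enorm_sub_le_lintegral_of_hasDerivAt {F F' : ℝ → ℂ} {a b : ℝ} (hab : a ≤ b)
    (hc : ContinuousOn F (Icc a b)) (hd : ∀ s ∈ Ioo a b, HasDerivAt F (F' s) s)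
    (hc' : ContinuousOn F' (Ioo a b)) : ‖F b - F a‖ₑ ≤ ∫⁻ s in Ioo a b, ‖F' s‖ₑ := by
  by_cases hfin : ∫⁻ s in Ioo a b, ‖F' s‖ₑ = ⊤
  · rw [hfin]; exact le_top
  have hi : IntegrableOn F' (Ioo a b) :=
    ⟨hc'.aestronglyMeasurable measurableSet_Ioo, lt_top_iff_ne_top.2 hfin⟩
  have hii : IntervalIntegrable F' volume a b :=
    (intervalIntegrable_iff_integrableOn_Ioo_of_le hab).2 hi
  rw [← intervalIntegral.integral_eq_sub_of_hasDerivAt_of_le hab hc hd hii,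
    intervalIntegral.integral_of_le hab, integral_Ioc_eq_integral_Ioo]
  exact enorm_integral_le_lintegral_enorm _

lemma ContinuousOn.measurable_indicator_disk {g : ℂ → ENNReal} (hg : ContinuousOn g (ball 0 1)) :
    Measurable ((ball (0 : ℂ) 1).indicator g) := by
  classical
  rw [← piecewise_eq_indicator]
  exact hg.measurable_piecewise continuousOn_const measurableSet_ball

/-- The rotation defect `Dp(x)[ix] - i p(x)`. -/
def rotDefect (p : ℂ → ℂ) (x : ℂ) : ℂ := fderiv ℝ p x (I * x) - I * p x

/-- The map `p` conjugated by the rotation `c`. -/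
def rotConj (c : Circle) (p : ℂ → ℂ) (x : ℂ) : ℂ := (c : ℂ)⁻¹ * p (c * x)

lemma mapsTo_circle_mul (c : Circle) : MapsTo (fun x : ℂ => (c : ℂ) * x) (ball 0 1) (ball 0 1) := by
  intro x hx
  simpa [Circle.norm_coe] using hx

lemma fderiv_rotConj (c : Circle) {p : ℂ → ℂ} {x : ℂ} (hp : DifferentiableAt ℝ p (c * x)) (v : ℂ) :
    fderiv ℝ (rotConj c p) x v = (c : ℂ)⁻¹ * fderiv ℝ p (c * x) (c * v) := by
  have h1 : HasFDerivAt (fun y : ℂ => (c : ℂ) * y) (ContinuousLinearMap.mul ℝ ℂ (c : ℂ)) x :=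
    (ContinuousLinearMap.mul ℝ ℂ (c : ℂ)).hasFDerivAt
  have h2 := ((hp.hasFDerivAt.comp x h1).const_mul ((c : ℂ)⁻¹)).fderiv
  change fderiv ℝ (fun y => (c : ℂ)⁻¹ * (p ∘ fun y : ℂ => (c : ℂ) * y) y) x v = _
  rw [h2]
  simp

lemma gradSq_rotConj (c : Circle) {p : ℂ → ℂ} {x : ℂ} (hp : DifferentiableAt ℝ p (c * x)) :
    gradSq (rotConj c p) x = gradSq p (c * x) := by
  have h := Circle.normSq_coe c
  rw [Complex.normSq_apply] at h
  simp only [gradSq, fderiv_rotConj c hp, norm_mul, norm_inv, Circle.norm_coe, inv_one, one_mul,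
    fderiv_apply_eq p _ (c * 1), fderiv_apply_eq p _ (c * I), norm_add_sq_real,
    real_inner_smul_left, real_inner_smul_right, norm_smul, mul_pow, Real.norm_eq_abs, sq_abs]
  simp only [mul_one, mul_I_re, mul_I_im]
  linear_combination (‖fderiv ℝ p (c * x) 1‖ ^ 2 + ‖fderiv ℝ p (c * x) I‖ ^ 2) * h

lemma measurePreserving_circle_mul (c : Circle) :
    MeasurePreserving (fun x : ℂ => (c : ℂ) * x) volume volume :=
  (rotation c).measurePreserving

lemma measurableEmbedding_circle_mul (c : Circle) :
    MeasurableEmbedding (fun x : ℂ => (c : ℂ) * x) :=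
  (rotation c).toHomeomorph.measurableEmbedding

lemma preimage_circle_mul_ball (c : Circle) :
    (fun x : ℂ => (c : ℂ) * x) ⁻¹' ball 0 1 = ball 0 1 := by
  ext x; simp [Circle.norm_coe]

lemma FiniteDirichlet.rotConj (c : Circle) {p : ℂ → ℂ} (hp : FiniteDirichlet p) :
    FiniteDirichlet (rotConj c p) := by
  have hm : MapsTo (fun x : ℂ => (c : ℂ) * x) (closedBall 0 1) (closedBall 0 1) := fun x hx => by
    simpa [Circle.norm_coe] using hx
  refine ⟨continuousOn_const.mul (hp.cont.comp (by fun_prop) hm),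
    contDiffOn_const.mul (hp.smooth.comp (by fun_prop) (mapsTo_circle_mul c)), ?_⟩
  have h := ((measurePreserving_circle_mul c).integrableOn_comp_preimage
    (measurableEmbedding_circle_mul c) (f := gradSq p) (s := ball 0 1)).2 hp.integrable
  rw [preimage_circle_mul_ball] at h
  exact h.congr_fun (fun x hx => (gradSq_rotConj c
    (hp.smooth.differentiableAt_disk (mapsTo_circle_mul c hx))).symm) measurableSet_ball

lemma ScalarMinimizer.rotConj (c : Circle) {ε : ℝ} {p : ℂ → ℂ} (hp : ScalarMinimizer ε p) :
    ScalarMinimizer ε (rotConj c p) := by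
  refine ⟨hp.fin.rotConj c, fun x hx => ?_, fun v hv => ?_⟩
  · rw [_root_.rotConj, hp.boundary _ (by simpa [Circle.norm_coe] using hx)]
    simp
  · convert hp.min v hv using 1
    have h := (measurePreserving_circle_mul c).setIntegral_preimage_emb
      (measurableEmbedding_circle_mul c) (gDen ε p) (ball 0 1)
    rw [preimage_circle_mul_ball] at h
    rw [Gn, Gn, ← h]
    refine setIntegral_congr_fun measurableSet_ball fun x hx => ?_
    simp only [gDen, gradSq_rotConj c
      (hp.fin.smooth.differentiableAt_disk (mapsTo_circle_mul c hx))]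
    simp [_root_.rotConj, Circle.norm_coe]

lemma integral_gradSq_sub_le {ε : ℝ} {u v : ℂ → ℂ} (hu : FiniteDirichlet u)
    (hv : FiniteDirichlet v) (wu : WeakGL ε u) (wv : WeakGL ε v)
    (hb : ∀ x : ℂ, ‖x‖ = 1 → u x = v x) :
    ∫ x in ball (0 : ℂ) 1, gradSq (fun y => u y - v y) x ≤
      (ε ^ 2)⁻¹ * ∫ x in ball (0 : ℂ) 1, ‖u x - v x‖ ^ 2 := by
  have hd := hu.sub hv
  have hd0 : ∀ x : ℂ, ‖x‖ = 1 → u x - v x = 0 := fun x hx => by rw [hb x hx, sub_self]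
  have e1 := wu _ hd hd0
  have e2 := wv _ hd hd0
  have i : ∀ w, FiniteDirichlet w → IntegrableOn
      (fun x => (1 - ‖w x‖ ^ 2) / ε ^ 2 * inner ℝ (w x) (u x - v x)) (ball 0 1) := fun w hw =>
    (((continuousOn_const.sub (hw.cont.norm.pow 2)).div_const _).mul
      (hw.cont.inner (𝕜 := ℝ) hd.cont)).integrableOn_disk
  have hs : ∀ x ∈ ball (0 : ℂ) 1, gradSq (fun y => u y - v y) x =
      gradInner u (fun y => u y - v y) x - gradInner v (fun y => u y - v y) x := fun x hx => by
    rw [← gradInner_self]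
    simp only [gradInner, fderiv_fun_sub (hu.smooth.differentiableAt_disk hx)
      (hv.smooth.differentiableAt_disk hx), FunLike.coe_sub, Pi.sub_apply, inner_sub_left]
    ring
  rw [setIntegral_congr_fun measurableSet_ball hs,
    integral_sub (hu.integrable_gradInner hd) (hv.integrable_gradInner hd), e1, e2,
    ← integral_sub (i u hu) (i v hv), ← integral_const_mul]
  refine setIntegral_mono_on ((i u hu).sub (i v hv)) ?_ measurableSet_ball fun x _ => ?_
  · exact (continuousOn_const.mul (hd.cont.norm.pow 2)).integrableOn_disk
  · have key : ∀ a b : ℂ, (1 - ‖a‖ ^ 2) * inner ℝ a (a - b) - (1 - ‖b‖ ^ 2) * inner ℝ b (a - b)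
        ≤ ‖a - b‖ ^ 2 := fun a b => by
      rw [norm_sub_sq_real, inner_sub_right, inner_sub_right, real_inner_self_eq_norm_sq,
        real_inner_self_eq_norm_sq, real_inner_comm a b]
      have := norm_sub_sq_real a b
      nlinarith [sq_nonneg (‖a‖ ^ 2 - ‖b‖ ^ 2), sq_nonneg (‖a - b‖ ), sq_nonneg ‖a‖, sq_nonneg ‖b‖,
        mul_nonneg (sq_nonneg (‖a - b‖)) (add_nonneg (sq_nonneg ‖a‖) (sq_nonneg ‖b‖))]
    have hε : 0 ≤ (ε ^ 2)⁻¹ := by positivity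
    have := mul_le_mul_of_nonneg_left (key (u x) (v x)) hε
    simp only [div_eq_mul_inv]
    linarith

/-- The part of the disk where `1 - |x|² ≤ 2δ`. -/
def boundaryLayer (δ : ℝ) : Set ℂ := {x | ‖x‖ < 1 ∧ 1 - ‖x‖ ^ 2 ≤ 2 * δ}

lemma measurableSet_boundaryLayer (δ : ℝ) : MeasurableSet (boundaryLayer δ) := by
  have h1 : MeasurableSet {x : ℂ | ‖x‖ < 1} :=
    (isOpen_lt continuous_norm continuous_const).measurableSet
  have h2 : MeasurableSet {x : ℂ | 1 - ‖x‖ ^ 2 ≤ 2 * δ} :=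
    (isClosed_le (by fun_prop) continuous_const).measurableSet
  exact h1.inter h2

lemma boundaryLayer_subset (δ : ℝ) : boundaryLayer δ ⊆ ball 0 1 := fun x hx => by
  simpa using hx.1

lemma lintegral_indicator_sq {g : ℂ → ENNReal} :
    ∫⁻ x, (ball (0 : ℂ) 1).indicator g x ^ 2 = ∫⁻ x in ball (0 : ℂ) 1, g x ^ 2 := by
  rw [← lintegral_indicator measurableSet_ball]
  refine lintegral_congr fun x => ?_
  by_cases hx : x ∈ ball (0 : ℂ) 1 <;> simp [hx]

lemma ContDiffOn.continuousOn_rotDefect {p : ℂ → ℂ} (hp : ContDiffOn ℝ 1 p (ball 0 1)) :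
    ContinuousOn (rotDefect p) (ball 0 1) :=
  ((hp.continuousOn_fderiv_of_isOpen isOpen_ball le_rfl).clm_apply
    (continuousOn_const.mul continuousOn_id)).sub (continuousOn_const.mul hp.continuousOn)

lemma hasDerivAt_rotConj {p : ℂ → ℂ} {x : ℂ} {s : ℝ}
    (hp : DifferentiableAt ℝ p (exp (s * I) * x)) :
    HasDerivAt (fun s : ℝ => (exp (s * I))⁻¹ * p (exp (s * I) * x))
      ((exp (s * I))⁻¹ * rotDefect p (exp (s * I) * x)) s := by
  have h0 : HasDerivAt (fun s : ℝ => exp (s * I)) (exp (s * I) * I) s := by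
    have h1 : HasDerivAt (fun s : ℝ => (s : ℂ) * I) I s := by
      simpa using (hasDerivAt_id s).ofReal_comp.mul_const I
    exact h1.cexp
  have h2 : HasDerivAt (fun s : ℝ => (exp (s * I))⁻¹) (-(exp (s * I))⁻¹ * I) s := by
    have := h0.fun_inv (exp_ne_zero _)
    refine this.congr_deriv ?_
    have := exp_ne_zero (s * I)
    generalize exp (s * I) = E at this
    field_simp
  have h3 := hp.hasFDerivAt.comp_hasDerivAt s (h0.mul_const x)
  refine (h2.mul h3).congr_deriv ?_
  simp only [rotDefect, Function.comp_apply]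
  rw [show exp (s * I) * I * x = I * (exp (s * I) * x) by ring]
  ring

lemma lintegral_rotConj_sub_le {p : ℂ → ℂ} (hp : ContDiffOn ℝ 1 p (ball 0 1)) {t : ℝ}
    (ht : 0 ≤ t) :
    ∫⁻ x in ball (0 : ℂ) 1, ‖rotConj (Circle.exp t) p x - p x‖ₑ ^ 2 ≤
      ENNReal.ofReal t ^ 2 * ∫⁻ x in ball (0 : ℂ) 1, ‖rotDefect p x‖ₑ ^ 2 := by
  have hmem : ∀ x ∈ ball (0 : ℂ) 1, ∀ s : ℝ, exp (s * I) * x ∈ ball (0 : ℂ) 1 := by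
    intro x hx s
    simpa [norm_exp_ofReal_mul_I] using hx
  have h := lintegral_sq_le_of_enorm_le (S := ball 0 1)
    (f := fun x => rotConj (Circle.exp t) p x - p x)
    measurableSet_ball
    (hp.continuousOn_rotDefect.enorm.measurable_indicator_disk) (a := 0) (b := t)
    (c := fun s : ℝ => exp (s * I)) (by fun_prop)
    (fun s _ => (norm_exp_ofReal_mul_I s).ge) (fun x hx => ?_)
  · rwa [lintegral_indicator_sq, sub_zero] at h
  · have hd : ∀ s : ℝ, _ := fun s =>
      hasDerivAt_rotConj (s := s) (hp.differentiableAt_disk (hmem x hx s))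
    have := enorm_sub_le_lintegral_of_hasDerivAt ht
      (fun s _ => (hd s).continuousAt.continuousWithinAt) (fun s _ => hd s) ?_
    · simp only [ofReal_zero, zero_mul, exp_zero, inv_one, one_mul] at this
      rw [rotConj, Circle.coe_exp]
      refine this.trans (le_of_eq (lintegral_congr fun s => ?_))
      rw [indicator_of_mem (hmem x hx s), enorm_mul]
      have : ‖(exp (s * I))⁻¹‖ₑ = 1 := by
        rw [← ofReal_norm, norm_inv, norm_exp_ofReal_mul_I]; simp
      rw [this, one_mul]
    · refine Continuous.continuousOn ((Continuous.inv₀ (by fun_prop) fun s => exp_ne_zero _).mul ?_)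
      exact hp.continuousOn_rotDefect.comp_continuous (by fun_prop) (hmem x hx)

lemma enorm_fderiv_le_sqrt_gradSq (d : ℂ → ℂ) {x v : ℂ} (hv : ‖v‖ ≤ 1) :
    ‖fderiv ℝ d x v‖ₑ ≤ ENNReal.ofReal (Real.sqrt (gradSq d x)) := by
  rw [← ofReal_norm]
  refine ENNReal.ofReal_le_ofReal (Real.le_sqrt_of_sq_le ?_)
  refine (norm_fderiv_apply_sq_le d x v).trans ?_
  exact mul_le_of_le_one_left (gradSq_nonneg _ _) (pow_le_one₀ (norm_nonneg _) hv)

lemma lintegral_boundaryLayer_le {d : ℂ → ℂ} (hd : FiniteDirichlet d)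
    (hb : ∀ x : ℂ, ‖x‖ = 1 → d x = 0) {δ : ℝ} (hδ : 0 < δ) (hδ' : δ ≤ 1 / 4) :
    ∫⁻ x in boundaryLayer δ, ‖d x‖ₑ ^ 2 ≤
      ENNReal.ofReal (4 * δ) ^ 2 * ∫⁻ x in ball (0 : ℂ) 1, ENNReal.ofReal (gradSq d x) := by
  have hG : ContinuousOn (fun x => ENNReal.ofReal (Real.sqrt (gradSq d x))) (ball 0 1) :=
    ENNReal.continuous_ofReal.comp_continuousOn hd.smooth.continuousOn_gradSq.sqrt
  have h := lintegral_sq_le_of_enorm_le (measurableSet_boundaryLayer δ) (f := d)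
    hG.measurable_indicator_disk (a := 1) (b := 1 + 4 * δ) (c := fun s : ℝ => (s : ℂ))
    (by fun_prop) (fun s hs => ?_) (fun x hx => ?_)
  · rw [lintegral_indicator_sq, add_sub_cancel_left] at h
    refine h.trans (le_of_eq ?_)
    congr 1
    refine lintegral_congr fun x => ?_
    rw [← ENNReal.ofReal_pow (Real.sqrt_nonneg _), Real.sq_sqrt (gradSq_nonneg _ _)]
  · rw [Complex.norm_real, Real.norm_eq_abs]
    exact hs.1.le.trans (le_abs_self s)
  · obtain ⟨hx1, hx2⟩ := hx
    have hx0 : 0 < ‖x‖ := by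
      by_contra hn
      have : ‖x‖ = 0 := le_antisymm (not_lt.1 hn) (norm_nonneg _)
      rw [this] at hx2
      nlinarith
    have hr : 1 ≤ ‖x‖⁻¹ := (one_le_inv₀ hx0).2 hx1.le
    have hr' : ‖x‖⁻¹ ≤ 1 + 4 * δ := by
      rw [inv_le_iff_one_le_mul₀ hx0]
      nlinarith
    have hin : ∀ s ∈ Ioo 1 ‖x‖⁻¹, (s : ℂ) * x ∈ ball (0 : ℂ) 1 := fun s hs => by
      rw [mem_ball_zero_iff, norm_mul, Complex.norm_real, Real.norm_eq_abs,
        abs_of_pos (zero_lt_one.trans hs.1)]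
      calc s * ‖x‖ < ‖x‖⁻¹ * ‖x‖ := by gcongr; exact hs.2
        _ = 1 := inv_mul_cancel₀ hx0.ne'
    have hline : ∀ s : ℝ, HasDerivAt (fun s : ℝ => (s : ℂ) * x) x s := fun s => by
      simpa using (hasDerivAt_id s).ofReal_comp.mul_const x
    have key := enorm_sub_le_lintegral_of_hasDerivAt (F := fun s : ℝ => d (s * x))
      (F' := fun s : ℝ => fderiv ℝ d (s * x) x) hr ?_ ?_ ?_
    · have hend : d (((‖x‖⁻¹ : ℝ) : ℂ) * x) = 0 := hb _ (by
        rw [norm_mul, Complex.norm_real, norm_inv, norm_norm, inv_mul_cancel₀ hx0.ne'])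
      simp only [hend, ofReal_one, one_mul, zero_sub, enorm_neg] at key
      refine key.trans ?_
      refine (setLIntegral_mono' (g := fun s : ℝ => (ball (0 : ℂ) 1).indicator
        (fun x => ENNReal.ofReal (Real.sqrt (gradSq d x))) (s * x)) measurableSet_Ioo
          fun s hs => ?_).trans (lintegral_mono_set (Ioo_subset_Ioo_right hr'))
      rw [indicator_of_mem (hin s hs)]
      exact enorm_fderiv_le_sqrt_gradSq d hx1.le
    · refine hd.cont.comp (by fun_prop) fun s hs => ?_
      rw [mem_closedBall_zero_iff, norm_mul, Complex.norm_real, Real.norm_eq_abs,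
        abs_of_pos (zero_lt_one.trans_le hs.1)]
      calc s * ‖x‖ ≤ ‖x‖⁻¹ * ‖x‖ := by gcongr; exact hs.2
        _ = 1 := inv_mul_cancel₀ hx0.ne'
    · intro s hs
      exact (hd.smooth.differentiableAt_disk (hin s hs)).hasFDerivAt.comp_hasDerivAt s (hline s)
    · exact (hd.smooth.continuousOn_fderiv_disk x).comp (by fun_prop) hin

lemma lintegral_enorm_sq_eq {g : ℂ → ℂ} {S : Set ℂ} (h : IntegrableOn (fun x => ‖g x‖ ^ 2) S) :
    ∫⁻ x in S, ‖g x‖ₑ ^ 2 = ENNReal.ofReal (∫ x in S, ‖g x‖ ^ 2) := by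
  rw [ofReal_integral_eq_lintegral_ofReal h (ae_of_all _ fun x => by positivity)]
  refine lintegral_congr fun x => ?_
  rw [ENNReal.ofReal_pow (norm_nonneg _), ofReal_norm]

lemma FiniteDirichlet.integrable_rotDefect_sq {p : ℂ → ℂ} (hp : FiniteDirichlet p) :
    IntegrableOn (fun x => ‖rotDefect p x‖ ^ 2) (ball 0 1) := by
  have h1 : IntegrableOn (fun x => ‖p x‖ ^ 2) (ball 0 1) := (hp.cont.norm.pow 2).integrableOn_disk
  refine integrableOn_disk_of_le (hp.smooth.continuousOn_rotDefect.norm.pow 2)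
    ((hp.integrable.const_mul 2).add (h1.const_mul 2)) fun x hx => ?_
  have hx' : ‖x‖ ≤ 1 := by simpa using (ball_subset_closedBall hx)
  have h2 := norm_fderiv_apply_sq_le p x (I * x)
  have h3 : ‖I * x‖ ^ 2 * gradSq p x ≤ gradSq p x := by
    refine mul_le_of_le_one_left (gradSq_nonneg _ _) (pow_le_one₀ (norm_nonneg _) ?_)
    simpa using hx'
  have h4 : ‖rotDefect p x‖ ≤ ‖fderiv ℝ p x (I * x)‖ + ‖p x‖ := by
    refine (norm_sub_le _ _).trans (le_of_eq ?_)
    simp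
  have h5 := pow_le_pow_left₀ (norm_nonneg _) h4 2
  rw [Real.norm_of_nonneg (by positivity), Pi.add_apply]
  nlinarith [sq_nonneg (‖fderiv ℝ p x (I * x)‖ - ‖p x‖)]

lemma lintegral_layer_rotConj_le {ε : ℝ} {p : ℂ → ℂ} (hp : ScalarMinimizer ε p) {δ : ℝ}
    (hδ : 0 < δ) (hδ' : δ ≤ 1 / 4) {t : ℝ} (ht : 0 ≤ t) :
    ∫⁻ x in boundaryLayer δ, ‖rotConj (Circle.exp t) p x - p x‖ₑ ^ 2 ≤
      ENNReal.ofReal (4 * δ) ^ 2 * (ENNReal.ofReal (ε ^ 2)⁻¹ * (ENNReal.ofReal t ^ 2 *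
        ∫⁻ x in ball (0 : ℂ) 1, ‖rotDefect p x‖ₑ ^ 2)) := by
  have hr := hp.rotConj (Circle.exp t)
  have hd := hr.fin.sub hp.fin
  have hb : ∀ x : ℂ, ‖x‖ = 1 → rotConj (Circle.exp t) p x = p x := fun x hx => by
    rw [hr.boundary x hx, hp.boundary x hx]
  refine (lintegral_boundaryLayer_le hd (fun x hx => by rw [hb x hx, sub_self]) hδ hδ').trans ?_
  gcongr ENNReal.ofReal (4 * δ) ^ 2 * ?_
  rw [← ofReal_integral_eq_lintegral_ofReal hd.integrable (ae_of_all _ fun x => gradSq_nonneg _ _)]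
  refine (ENNReal.ofReal_le_ofReal
    (integral_gradSq_sub_le hr.fin hp.fin hr.weakGL hp.weakGL hb)).trans ?_
  rw [ENNReal.ofReal_mul (by positivity),
    ← lintegral_enorm_sq_eq (hd.cont.norm.pow 2).integrableOn_disk]
  gcongr ENNReal.ofReal (ε ^ 2)⁻¹ * ?_
  exact lintegral_rotConj_sub_le hp.fin.smooth ht

lemma tendsto_rotConj_quotient {p : ℂ → ℂ} {x : ℂ} (hp : DifferentiableAt ℝ p x) :
    Tendsto (fun n : ℕ => ((1 / ((n : ℝ) + 1))⁻¹ : ℝ) •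
      (rotConj (Circle.exp (1 / ((n : ℝ) + 1))) p x - p x)) atTop (nhds (rotDefect p x)) := by
  have h := hasDerivAt_rotConj (p := p) (x := x) (s := 0) (by simpa using hp)
  have h2 := h.tendsto_slope_zero
  have h3 : Tendsto (fun n : ℕ => 1 / ((n : ℝ) + 1)) atTop (nhdsWithin 0 {0}ᶜ) := by
    refine tendsto_nhdsWithin_iff.2 ⟨tendsto_one_div_add_atTop_nhds_zero_nat, .of_forall fun n => ?_⟩
    exact (Nat.one_div_pos_of_nat (α := ℝ) (n := n)).ne'
  have h4 := h2.comp h3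
  simpa [rotConj, Function.comp_def, Circle.coe_exp] using h4

/-- Quadratic smallness of the rotation defect of a minimizer near the boundary. -/
lemma ScalarMinimizer.lintegral_rotDefect_le {ε : ℝ} {p : ℂ → ℂ} (hp : ScalarMinimizer ε p)
    {δ : ℝ} (hδ : 0 < δ) (hδ' : δ ≤ 1 / 4) :
    ∫⁻ x in boundaryLayer δ, ‖rotDefect p x‖ₑ ^ 2 ≤
      ENNReal.ofReal (4 * δ) ^ 2 * (ENNReal.ofReal (ε ^ 2)⁻¹ *
        ∫⁻ x in ball (0 : ℂ) 1, ‖rotDefect p x‖ₑ ^ 2) := by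
  set τ : ℕ → ℝ := fun n => 1 / ((n : ℝ) + 1) with hτ
  have hτ0 : ∀ n, 0 < τ n := fun n => Nat.one_div_pos_of_nat
  set q : ℕ → ℂ → ENNReal := fun n => (boundaryLayer δ).indicator
    fun x => ‖(τ n)⁻¹ • (_root_.rotConj (Circle.exp (τ n)) p x - p x)‖ₑ ^ 2 with hq
  have hlim : ∀ x ∈ boundaryLayer δ, Tendsto (fun n => q n x) atTop
      (nhds (‖rotDefect p x‖ₑ ^ 2)) := fun x hx => by
    have h := (tendsto_rotConj_quotient
      (hp.fin.smooth.differentiableAt_disk (boundaryLayer_subset δ hx))).enorm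
    replace h := ((ENNReal.continuous_pow 2).tendsto _).comp h
    simpa only [hq, hτ, indicator_of_mem hx, Function.comp_def] using h
  have hmeas : ∀ n, Measurable (q n) := by
    intro n
    have hc : ContinuousOn (fun x => ‖(τ n)⁻¹ • (_root_.rotConj (Circle.exp (τ n)) p x - p x)‖ₑ ^ 2)
        (ball 0 1) := by
      have := (((hp.fin.rotConj (Circle.exp (τ n))).sub hp.fin).cont.mono
        ball_subset_closedBall).const_smul (τ n)⁻¹
      exact (ENNReal.continuous_pow 2).comp_continuousOn this.enorm
    have := hc.measurable_indicator_disk.indicator (measurableSet_boundaryLayer δ)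
    rwa [indicator_indicator, inter_eq_left.2 (boundaryLayer_subset δ)] at this
  have hbound : ∀ n, ∫⁻ x, q n x ≤ ENNReal.ofReal (4 * δ) ^ 2 * (ENNReal.ofReal (ε ^ 2)⁻¹ *
        ∫⁻ x in ball (0 : ℂ) 1, ‖rotDefect p x‖ₑ ^ 2) := by
    intro n
    rw [hq, lintegral_indicator (measurableSet_boundaryLayer δ)]
    have e : ∀ x, ‖(τ n)⁻¹ • (_root_.rotConj (Circle.exp (τ n)) p x - p x)‖ₑ ^ 2 =
        ENNReal.ofReal (τ n)⁻¹ ^ 2 * ‖_root_.rotConj (Circle.exp (τ n)) p x - p x‖ₑ ^ 2 := fun x => by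
      rw [enorm_smul, mul_pow, Real.enorm_of_nonneg (inv_nonneg.2 (hτ0 n).le)]
    simp only [e]
    rw [lintegral_const_mul' _ _ (by finiteness)]
    refine (mul_le_mul_right (lintegral_layer_rotConj_le hp hδ hδ' (hτ0 n).le) _).trans
      (le_of_eq ?_)
    have h1 : ENNReal.ofReal (τ n)⁻¹ ^ 2 * ENNReal.ofReal (τ n) ^ 2 = 1 := by
      rw [← mul_pow, ← ENNReal.ofReal_mul (inv_nonneg.2 (hτ0 n).le),
        inv_mul_cancel₀ (hτ0 n).ne']
      simp
    calc _ = (ENNReal.ofReal (τ n)⁻¹ ^ 2 * ENNReal.ofReal (τ n) ^ 2) *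
          (ENNReal.ofReal (4 * δ) ^ 2 * (ENNReal.ofReal (ε ^ 2)⁻¹ *
          ∫⁻ x in ball (0 : ℂ) 1, ‖rotDefect p x‖ₑ ^ 2)) := by ring
      _ = _ := by rw [h1, one_mul]
  calc ∫⁻ x in boundaryLayer δ, ‖rotDefect p x‖ₑ ^ 2
      ≤ ∫⁻ x, liminf (fun n => q n x) atTop := by
        rw [← lintegral_indicator (measurableSet_boundaryLayer δ)]
        refine lintegral_mono fun x => ?_
        by_cases hx : x ∈ boundaryLayer δ
        · rw [indicator_of_mem hx, (hlim x hx).liminf_eq]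
        · rw [indicator_of_notMem hx]; exact zero_le
    _ ≤ liminf (fun n => ∫⁻ x, q n x) atTop := lintegral_liminf_le hmeas
    _ ≤ _ := by
      refine (liminf_le_liminf (v := fun _ => _) (.of_forall hbound)).trans ?_
      rw [liminf_const]

/-- Real-valued form of the smallness of the rotation defect near the boundary. -/
lemma ScalarMinimizer.exists_integral_rotDefect_le {ε : ℝ} {p : ℂ → ℂ}
    (hp : ScalarMinimizer ε p) : ∃ C, 0 ≤ C ∧ ∀ δ : ℝ, 0 < δ → δ ≤ 1 / 4 →
      ∫ x in boundaryLayer δ, ‖rotDefect p x‖ ^ 2 ≤ C * δ ^ 2 := by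
  have hi := hp.fin.integrable_rotDefect_sq
  refine ⟨16 * ((ε ^ 2)⁻¹ * ∫ x in ball (0 : ℂ) 1, ‖rotDefect p x‖ ^ 2), by positivity,
    fun δ h1 h2 => ?_⟩
  have h := hp.lintegral_rotDefect_le h1 h2
  rw [lintegral_enorm_sq_eq hi, lintegral_enorm_sq_eq (hi.mono_set (boundaryLayer_subset δ)),
    ← ENNReal.ofReal_mul (by positivity), ← ENNReal.ofReal_pow (by positivity),
    ← ENNReal.ofReal_mul (by positivity), ENNReal.ofReal_le_ofReal_iff (by positivity)] at h
  linarith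

/-! ### Comparison of the currents -/

/-- The supercurrent `⟨Dp(x)[v], i p(x)⟩`. -/
def current (p : ℂ → ℂ) (x v : ℂ) : ℝ := inner ℝ (fderiv ℝ p x v) (I * p x)

lemma inner_self_I_mul (a : ℂ) : inner ℝ a (I * a) = (0 : ℝ) := by
  simp [Complex.inner]; ring

lemma inner_fderiv_eq (f : ℂ → ℂ) (x v b : ℂ) : inner ℝ (fderiv ℝ f x v) b =
    v.re * inner ℝ (fderiv ℝ f x 1) b + v.im * inner ℝ (fderiv ℝ f x I) b := by
  rw [fderiv_apply_eq, inner_add_left, real_inner_smul_left, real_inner_smul_left]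

lemma current_eq (p : ℂ → ℂ) (x v : ℂ) :
    current p x v = v.re * current p x 1 + v.im * current p x I := inner_fderiv_eq p x v _

lemma fderiv_I_mul {p : ℂ → ℂ} {x : ℂ} (hp : DifferentiableAt ℝ p x) (v : ℂ) :
    fderiv ℝ (fun y => I * p y) x v = I * fderiv ℝ p x v := by
  rw [fderiv_const_mul hp]; simp

lemma ScalarMinimizer.integral_current_eq_zero {ε : ℝ} {p : ℂ → ℂ} (hp : ScalarMinimizer ε p)
    {ξ : ℂ → ℝ} (hξ : ContDiff ℝ 1 ξ) (hb : ∀ x : ℂ, ‖x‖ = 1 → ξ x = 0) :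
    ∫ x in ball (0 : ℂ) 1, (fderiv ℝ ξ x 1 * current p x 1 + fderiv ℝ ξ x I * current p x I)
      = 0 := by
  have hI := hp.fin.const_mul I
  have h := hp.weakGL _ (hI.ofReal_mul hξ) fun x hx => by simp [hb x hx]
  rw [integral_gradInner_ofReal_mul hξ hp.fin hI] at h
  have e1 : ∫ x in ball (0 : ℂ) 1, ξ x * gradInner p (fun y => I * p y) x = 0 := by
    rw [setIntegral_congr_fun measurableSet_ball (g := fun _ => (0 : ℝ)) fun x hx => ?_]
    · simp
    · simp only [gradInner, fderiv_I_mul (hp.fin.smooth.differentiableAt_disk hx),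
        inner_self_I_mul, add_zero, mul_zero]
  have e2 : ∀ x, inner ℝ (p x) ((ξ x : ℂ) * (I * p x)) = (0 : ℝ) := fun x => by
    rw [← Complex.real_smul, real_inner_smul_right, inner_self_I_mul, mul_zero]
  simp only [e1, e2, mul_zero, integral_zero, zero_add] at h
  exact h

/-- A smooth cutoff equal to one away from the boundary layer. -/
def cutoff (δ : ℝ) (x : ℂ) : ℝ := Real.smoothTransition ((1 - ‖x‖ ^ 2) / δ - 1)

/-- The slope of `cutoff`: its gradient is `-cutoffSlope δ x • x`. -/
def cutoffSlope (δ : ℝ) (x : ℂ) : ℝ :=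
  2 / δ * deriv Real.smoothTransition ((1 - ‖x‖ ^ 2) / δ - 1)

lemma contDiff_cutoff (δ : ℝ) : ContDiff ℝ 1 (cutoff δ) :=
  Real.smoothTransition.contDiff.comp
    (((contDiff_const.sub (contDiff_norm_sq ℝ)).div_const δ).sub contDiff_const)

lemma continuous_deriv_smoothTransition : Continuous (deriv Real.smoothTransition) :=
  (Real.smoothTransition.contDiff (n := 1)).continuous_deriv le_rfl

lemma continuous_cutoffSlope (δ : ℝ) : Continuous (cutoffSlope δ) :=
  continuous_const.mul (continuous_deriv_smoothTransition.comp (by fun_prop))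

lemma fderiv_cutoff (δ : ℝ) (x v : ℂ) :
    fderiv ℝ (cutoff δ) x v = -(cutoffSlope δ x * (x.re * v.re + x.im * v.im)) := by
  have h1 : HasFDerivAt (fun y : ℂ => (1 - ‖y‖ ^ 2) / δ - 1)
      (δ⁻¹ • -((2 : ℝ) • innerSL ℝ x)) x := by
    have := (((hasFDerivAt_id x).norm_sq.const_sub 1).const_mul δ⁻¹).sub_const 1
    simp only [div_eq_inv_mul]
    refine this.congr_fderiv ?_
    ext v
    simp
    left
    ring
  have h2 : HasDerivAt Real.smoothTransition
      (deriv Real.smoothTransition ((1 - ‖x‖ ^ 2) / δ - 1)) ((1 - ‖x‖ ^ 2) / δ - 1) :=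
    (Real.smoothTransition.contDiff (n := 1)).differentiable one_ne_zero |>.differentiableAt
      |>.hasDerivAt
  have h3 := (h2.comp_hasFDerivAt x h1).fderiv
  change fderiv ℝ (Real.smoothTransition ∘ fun y : ℂ => (1 - ‖y‖ ^ 2) / δ - 1) x v = _
  rw [h3]
  simp [cutoffSlope, Complex.inner]
  ring

lemma abs_cutoff_le_one (δ : ℝ) (x : ℂ) : |cutoff δ x| ≤ 1 := by
  rw [cutoff, abs_of_nonneg (Real.smoothTransition.nonneg _)]
  exact Real.smoothTransition.le_one _

lemma cutoff_eq_one {δ : ℝ} (hδ : 0 < δ) {x : ℂ} (hx : 2 * δ ≤ 1 - ‖x‖ ^ 2) : cutoff δ x = 1 :=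
  Real.smoothTransition.one_of_one_le (by
    rw [le_sub_iff_add_le, le_div_iff₀ hδ]; linarith)

lemma tsupport_cutoff_subset {δ : ℝ} (hδ : 0 < δ) : tsupport (cutoff δ) ⊆ ball 0 1 := by
  have h1 : tsupport (cutoff δ) ⊆ {x : ℂ | δ ≤ 1 - ‖x‖ ^ 2} := by
    refine closure_minimal (fun x hx => ?_) (isClosed_le continuous_const (by fun_prop))
    by_contra hn
    refine hx (Real.smoothTransition.zero_of_nonpos ?_)
    rw [sub_nonpos, div_le_one hδ]
    exact (not_le.1 hn).le
  intro x hx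
  have h2 : δ ≤ 1 - ‖x‖ ^ 2 := h1 hx
  rw [mem_ball_zero_iff]
  nlinarith [norm_nonneg x]

lemma cutoffSlope_eq_zero {δ : ℝ} (hδ : 0 < δ) {x : ℂ} (hx : 2 * δ < 1 - ‖x‖ ^ 2) :
    cutoffSlope δ x = 0 := by
  have h : 1 < (1 - ‖x‖ ^ 2) / δ - 1 := by
    rw [lt_sub_iff_add_lt, lt_div_iff₀ hδ]; linarith
  have e : Real.smoothTransition =ᶠ[nhds ((1 - ‖x‖ ^ 2) / δ - 1)] fun _ => 1 := by
    filter_upwards [lt_mem_nhds h] with s hs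
    exact Real.smoothTransition.one_of_one_le hs.le
  rw [cutoffSlope, e.deriv_eq]
  simp

lemma exists_abs_cutoffSlope_le : ∃ C, 0 ≤ C ∧ ∀ δ : ℝ, 0 < δ → ∀ x ∈ boundaryLayer δ,
    |cutoffSlope δ x| ≤ C / δ := by
  obtain ⟨C, hC⟩ := (isCompact_Icc (a := (-1 : ℝ)) (b := 1)).exists_bound_of_continuousOn
    continuous_deriv_smoothTransition.continuousOn
  have hC0 : 0 ≤ C := (norm_nonneg _).trans (hC 0 (by simp))
  refine ⟨2 * C, by positivity, fun δ hδ x hx => ?_⟩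
  have hm : (1 - ‖x‖ ^ 2) / δ - 1 ∈ Icc (-1 : ℝ) 1 := by
    have h0 : 0 ≤ 1 - ‖x‖ ^ 2 := by nlinarith [hx.1, norm_nonneg x]
    constructor
    · linarith [div_nonneg h0 hδ.le]
    · rw [sub_le_iff_le_add, div_le_iff₀ hδ]
      linarith [hx.2]
  rw [cutoffSlope, abs_mul, abs_of_pos (by positivity : 0 < 2 / δ)]
  calc 2 / δ * _ ≤ 2 / δ * C := by gcongr; exact hC _ hm
    _ = 2 * C / δ := by ring

lemma norm_fderiv_sq_add_I_mul (p : ℂ → ℂ) (x : ℂ) :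
    ‖fderiv ℝ p x x‖ ^ 2 + ‖fderiv ℝ p x (I * x)‖ ^ 2 = ‖x‖ ^ 2 * gradSq p x := by
  rw [fderiv_apply_eq p x x, fderiv_apply_eq p x (I * x), norm_add_sq_real, norm_add_sq_real,
    gradSq, Complex.sq_norm x, Complex.normSq_apply]
  simp only [norm_smul, mul_pow, real_inner_smul_left, real_inner_smul_right, Real.norm_eq_abs,
    sq_abs, I_mul_re, I_mul_im]
  ring

lemma fderiv_I_mul_self (p : ℂ → ℂ) (x : ℂ) :
    fderiv ℝ p x (I * x) = rotDefect p x + I * p x := by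
  rw [rotDefect]; ring

/-- The error terms in the boundary comparison of stress and current. -/
def layerError (p m F : ℂ → ℂ) (x : ℂ) : ℝ :=
  (F x).re * (inner ℝ (fderiv ℝ p x x) (rotDefect p x)
      - inner ℝ (fderiv ℝ m x x) (rotDefect m x))
    + (F x).im * (‖rotDefect p x‖ ^ 2 + 2 * inner ℝ (rotDefect p x) (I * p x)
      - ‖rotDefect m x‖ ^ 2 - 2 * inner ℝ (rotDefect m x) (I * m x))

lemma stressDiff_eq_current {p m : ℂ → ℂ} {x : ℂ} (F : ℂ → ℂ) (hg : gradSq p x = gradSq m x)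
    (hn : ‖p x‖ = ‖m x‖) :
    stressDiff p m x x (I * x * F x) =
      (F x).re * (current p x x - current m x x) + layerError p m F x := by
  have hd : ∀ f : ℂ → ℂ, fderiv ℝ f x (I * x * F x) =
      (F x).re • (rotDefect f x + I * f x) - (F x).im • fderiv ℝ f x x := fun f => by
    rw [← fderiv_I_mul_self, ← map_smul, ← map_smul, ← map_sub]
    congr 1
    apply Complex.ext <;> simp <;> ring
  have h1 := norm_fderiv_sq_add_I_mul p x
  have h2 := norm_fderiv_sq_add_I_mul m x
  rw [fderiv_I_mul_self, norm_add_sq_real] at h1 h2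
  simp only [norm_mul, norm_I, one_mul] at h1 h2
  simp only [stressDiff, hd, inner_sub_right, inner_add_right, real_inner_smul_right,
    real_inner_self_eq_norm_sq, current, layerError]
  rw [hg, ← h2, hn] at h1
  linear_combination -(F x).im * h1

lemma abs_layerError_le {p m F : ℂ → ℂ} {x : ℂ} {N l : ℝ} (hx : ‖x‖ ≤ 1) (hF : ‖F x‖ ≤ N)
    (hl : 0 < l) : |layerError p m F x| ≤ 4 * N * (
      (l + 1) * (‖rotDefect p x‖ ^ 2 + ‖rotDefect m x‖ ^ 2)
      + l⁻¹ * (gradSq p x + gradSq m x + ‖p x‖ ^ 2 + ‖m x‖ ^ 2)) := by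
  have hN : 0 ≤ N := (norm_nonneg _).trans hF
  have hre := (abs_re_le_norm (F x)).trans hF
  have him := (abs_im_le_norm (F x)).trans hF
  have amgm : ∀ a b : ℂ, |inner ℝ a b| ≤ l * ‖b‖ ^ 2 + l⁻¹ * ‖a‖ ^ 2 := fun a b => by
    refine (abs_real_inner_le_norm a b).trans ?_
    have h1 : l * l⁻¹ = 1 := mul_inv_cancel₀ hl.ne'
    have h2 : 0 < l⁻¹ := inv_pos.2 hl
    have h3 : 0 ≤ l⁻¹ * (l * ‖b‖ - ‖a‖) ^ 2 := by positivity
    have h4 : l⁻¹ * (l * ‖b‖ - ‖a‖) ^ 2 =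
        (l * l⁻¹) * l * ‖b‖ ^ 2 - 2 * (l * l⁻¹) * (‖a‖ * ‖b‖) + l⁻¹ * ‖a‖ ^ 2 := by ring
    rw [h4, h1] at h3
    have h5 := mul_nonneg (norm_nonneg a) (norm_nonneg b)
    linarith
  have hgrad : ∀ f : ℂ → ℂ, ‖fderiv ℝ f x x‖ ^ 2 ≤ gradSq f x := fun f =>
    (norm_fderiv_apply_sq_le f x x).trans
      (mul_le_of_le_one_left (gradSq_nonneg _ _) (pow_le_one₀ (norm_nonneg _) hx))
  have hI : ∀ z : ℂ, ‖I * z‖ = ‖z‖ := fun z => by simp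
  have hi : 0 ≤ l⁻¹ := (inv_pos.2 hl).le
  have a1 := amgm (fderiv ℝ p x x) (rotDefect p x)
  have a2 := amgm (fderiv ℝ m x x) (rotDefect m x)
  have a3 := amgm (I * p x) (rotDefect p x)
  have a4 := amgm (I * m x) (rotDefect m x)
  rw [real_inner_comm, hI] at a3 a4
  have g1 := mul_le_mul_of_nonneg_left (hgrad p) hi
  have g2 := mul_le_mul_of_nonneg_left (hgrad m) hi
  have q1 := mul_nonneg hi (gradSq_nonneg p x)
  have q2 := mul_nonneg hi (gradSq_nonneg m x)
  have q3 := mul_nonneg hi (sq_nonneg ‖p x‖)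
  have q4 := mul_nonneg hi (sq_nonneg ‖m x‖)
  have q5 := sq_nonneg ‖rotDefect p x‖
  have q6 := sq_nonneg ‖rotDefect m x‖
  have q7 := mul_nonneg hl.le q5
  have q8 := mul_nonneg hl.le q6
  have t1 : |inner ℝ (fderiv ℝ p x x) (rotDefect p x)
      - inner ℝ (fderiv ℝ m x x) (rotDefect m x)| ≤ l * ‖rotDefect p x‖ ^ 2
        + l * ‖rotDefect m x‖ ^ 2 + l⁻¹ * gradSq p x + l⁻¹ * gradSq m x := by
    rw [abs_le] at *; constructor <;> linarith
  have t2 : |‖rotDefect p x‖ ^ 2 + 2 * inner ℝ (rotDefect p x) (I * p x)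
      - ‖rotDefect m x‖ ^ 2 - 2 * inner ℝ (rotDefect m x) (I * m x)| ≤
      ‖rotDefect p x‖ ^ 2 + ‖rotDefect m x‖ ^ 2 + 2 * (l * ‖rotDefect p x‖ ^ 2
        + l * ‖rotDefect m x‖ ^ 2 + l⁻¹ * ‖p x‖ ^ 2 + l⁻¹ * ‖m x‖ ^ 2) := by
    rw [abs_le] at *; constructor <;> linarith
  refine (abs_add_le _ _).trans ?_
  rw [abs_mul, abs_mul]
  refine (add_le_add (mul_le_mul hre t1 (abs_nonneg _) hN)
    (mul_le_mul him t2 (abs_nonneg _) hN)).trans ?_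
  rw [← mul_add, mul_assoc, mul_left_comm]
  refine mul_le_mul_of_nonneg_left ?_ hN
  linarith

/-- The pairing of the gradient of `η` with the supercurrent of `p`. -/
def currentPairing (p : ℂ → ℂ) (η : ℂ → ℝ) (x : ℂ) : ℝ :=
  fderiv ℝ η x 1 * current p x 1 + fderiv ℝ η x I * current p x I

lemma FiniteDirichlet.integrable_currentPairing {p : ℂ → ℂ} {η : ℂ → ℝ} (hp : FiniteDirichlet p)
    (hη : ContDiff ℝ 1 η) : IntegrableOn (currentPairing p η) (ball 0 1) :=
  integrable_fderiv_mul_inner hη hp (hp.const_mul I)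

lemma currentPairing_mul (p : ℂ → ℂ) {χ η : ℂ → ℝ} {x : ℂ} (hχ : DifferentiableAt ℝ χ x)
    (hη : DifferentiableAt ℝ η x) : currentPairing p (fun y => χ y * η y) x =
      χ x * currentPairing p η x + η x * currentPairing p χ x := by
  simp only [currentPairing, fderiv_fun_mul hχ hη]
  simp
  ring

lemma currentPairing_cutoff (p : ℂ → ℂ) (δ : ℝ) (x : ℂ) :
    currentPairing p (cutoff δ) x = -(cutoffSlope δ x * current p x x) := by
  rw [currentPairing, fderiv_cutoff, fderiv_cutoff, current_eq p x x]
  simp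
  ring

lemma stressDiff_cutoff {p m G : ℂ → ℂ} {δ : ℝ} {x : ℂ} (hg : gradSq p x = gradSq m x)
    (hG : DifferentiableAt ℂ G x) :
    stressDiff p m x 1 (fderiv ℝ (fun y => (cutoff δ y : ℂ) * G y) x 1)
      + stressDiff p m x I (fderiv ℝ (fun y => (cutoff δ y : ℂ) * G y) x I) =
    -(cutoffSlope δ x * stressDiff p m x x (G x)) := by
  have hd : ∀ v, fderiv ℝ (fun y => (cutoff δ y : ℂ) * G y) x v =
      cutoff δ x • (deriv G x * v) - (cutoffSlope δ x * (x.re * v.re + x.im * v.im)) • G x := by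
    intro v
    have h1 := ((contDiff_cutoff δ).differentiable one_ne_zero).differentiableAt (x := x)
    have h2 : HasFDerivAt G (deriv G x • (1 : ℂ →L[ℝ] ℂ)) x :=
      hG.hasDerivAt.complexToReal_fderiv
    have e : (fun y => (cutoff δ y : ℂ) * G y) = fun y => cutoff δ y • G y := by
      funext y; simp
    rw [e, (h1.hasFDerivAt.fun_smul h2).fderiv]
    simp [fderiv_cutoff]
    ring
  rw [hd, hd]
  generalize deriv G x = d
  generalize G x = w
  unfold stressDiff
  simp only [gradSq] at hg
  rw [fderiv_apply_eq p x x, fderiv_apply_eq m x x, fderiv_apply_eq p x w, fderiv_apply_eq m x w]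
  rw [fderiv_apply_eq p x (_ - _), fderiv_apply_eq m x (_ - _), fderiv_apply_eq p x (_ - _),
    fderiv_apply_eq m x (_ - _)]
  simp only [inner_add_left, inner_add_right, real_inner_smul_left, real_inner_smul_right,
    real_inner_self_eq_norm_sq]
  rw [real_inner_comm (fderiv ℝ p x 1) (fderiv ℝ p x I),
    real_inner_comm (fderiv ℝ m x 1) (fderiv ℝ m x I)]
  simp
  linear_combination cutoff δ x * d.re * hg

lemma integrable_stressDiff {p m G : ℂ → ℂ} (hp : FiniteDirichlet p) (hm : FiniteDirichlet m)
    (hG : Continuous G) : IntegrableOn (fun x => stressDiff p m x x (G x)) (ball 0 1) := by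
  obtain ⟨N, hN0, hN⟩ := hG.continuousOn.exists_bound_disk
  have hc : ∀ {f g : ℂ → ℂ}, FiniteDirichlet f → Continuous g →
      ContinuousOn (fun x => fderiv ℝ f x (g x)) (ball 0 1) := fun hf hg =>
    (hf.smooth.continuousOn_fderiv_of_isOpen isOpen_ball le_rfl).clm_apply hg.continuousOn
  refine integrableOn_disk_of_le (((hc hp continuous_id).inner (𝕜 := ℝ) (hc hp hG)).sub
    ((hc hm continuous_id).inner (𝕜 := ℝ) (hc hm hG)))
    ((hp.integrable.add hm.integrable).const_mul (1 + N ^ 2)) fun x hx => ?_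
  have hx' := hN x (ball_subset_closedBall hx)
  have hx1 : ‖x‖ ≤ 1 := by simpa using (ball_subset_closedBall hx)
  have key : ∀ f : ℂ → ℂ, |inner ℝ (fderiv ℝ f x x) (fderiv ℝ f x (G x))| ≤
      (1 + N ^ 2) * gradSq f x := fun f => by
    refine (abs_real_inner_le_norm _ _).trans ?_
    have h1 := norm_fderiv_apply_sq_le f x x
    have h2 := norm_fderiv_apply_sq_le f x (G x)
    have h3 : ‖x‖ ^ 2 * gradSq f x ≤ 1 * gradSq f x :=
      mul_le_mul_of_nonneg_right (pow_le_one₀ (norm_nonneg _) hx1) (gradSq_nonneg _ _)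
    have h4 : ‖G x‖ ^ 2 * gradSq f x ≤ N ^ 2 * gradSq f x :=
      mul_le_mul_of_nonneg_right (pow_le_pow_left₀ (norm_nonneg _) hx' 2) (gradSq_nonneg _ _)
    nlinarith [sq_nonneg (‖fderiv ℝ f x x‖ - ‖fderiv ℝ f x (G x)‖), gradSq_nonneg f x,
      sq_nonneg (‖fderiv ℝ f x x‖), sq_nonneg (‖fderiv ℝ f x (G x)‖)]
  refine (norm_sub_le _ _).trans ((add_le_add (key p) (key m)).trans (le_of_eq ?_))
  rw [Pi.add_apply]; ring

lemma integrable_mul_of_continuous {a g : ℂ → ℝ} (ha : Continuous a)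
    (hg : IntegrableOn g (ball 0 1)) : IntegrableOn (fun x => a x * g x) (ball 0 1) := by
  obtain ⟨M, -, hM⟩ := ha.continuousOn.exists_bound_disk
  exact Integrable.bdd_mul hg ha.continuousOn.aestronglyMeasurable_disk (c := M)
    ((ae_restrict_iff' measurableSet_ball).2
      (ae_of_all _ fun x hx => hM x (ball_subset_closedBall hx)))

section Layer

variable {ε : ℝ} {p m F : ℂ → ℂ}

lemma integral_cutoff_mul_currentPairing (hp : ScalarMinimizer ε p) (hm : ScalarMinimizer ε m)
    (hn : ∀ x ∈ ball (0 : ℂ) 1, ‖p x‖ = ‖m x‖) (hF : Differentiable ℂ F)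
    {δ : ℝ} (hδ : 0 < δ) :
    IntegrableOn (fun x => cutoffSlope δ x * layerError p m F x) (ball 0 1) ∧
    ∫ x in ball (0 : ℂ) 1, cutoff δ x * (currentPairing p (fun y => (F y).re) x
      - currentPairing m (fun y => (F y).re) x) =
    -∫ x in ball (0 : ℂ) 1, cutoffSlope δ x * layerError p m F x := by
  have hg := gradSq_eq_of_norm_eq hp.fin hm.fin hp.weakGL hm.weakGL hn
  have hη : ContDiff ℝ 1 fun y => (F y).re :=
    reCLM.contDiff.comp ((hF.contDiff (n := 1)).restrict_scalars ℝ)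
  have hχ := contDiff_cutoff δ
  have hξ : ContDiff ℝ 1 fun y => cutoff δ y * (F y).re := hχ.mul hη
  have hχ0 : ∀ x : ℂ, ‖x‖ = 1 → cutoff δ x = 0 := fun x hx =>
    image_eq_zero_of_notMem_tsupport fun h => by
      have := tsupport_cutoff_subset hδ h
      simp [hx] at this
  have hG : Differentiable ℂ fun x => I * x * F x := by fun_prop
  have hX : ContDiff ℝ 1 fun y => (cutoff δ y : ℂ) * (I * y * F y) :=
    (ofRealCLM.contDiff.comp hχ).mul ((hG.contDiff (n := 1)).restrict_scalars ℝ)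
  have hXs : tsupport (fun y => (cutoff δ y : ℂ) * (I * y * F y)) ⊆ ball 0 1 := by
    refine Subset.trans (closure_mono fun x hx => ?_) (tsupport_cutoff_subset hδ)
    exact fun h => hx (by simp [h])
  have s0 := integral_stressDiff_eq_zero hp hm hn hX hXs
  rw [setIntegral_congr_fun measurableSet_ball fun x hx =>
    stressDiff_cutoff (hg x hx) hG.differentiableAt] at s0
  have is := integrable_mul_of_continuous (continuous_cutoffSlope δ)
    (integrable_stressDiff hp.fin hm.fin hG.continuous)
  have ip := hp.fin.integrable_currentPairing hξ
  have im := hm.fin.integrable_currentPairing hξ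
  have ig := integrable_mul_of_continuous hχ.continuous
    ((hp.fin.integrable_currentPairing hη).sub (hm.fin.integrable_currentPairing hη))
  have p0 := hp.integral_current_eq_zero hξ fun x hx => by simp [hχ0 x hx]
  have m0 := hm.integral_current_eq_zero hξ fun x hx => by simp [hχ0 x hx]
  have hpt : ∀ x ∈ ball (0 : ℂ) 1, cutoffSlope δ x * layerError p m F x =
      currentPairing p (fun y => cutoff δ y * (F y).re) x
      - currentPairing m (fun y => cutoff δ y * (F y).re) x
      + cutoffSlope δ x * stressDiff p m x x (I * x * F x)
      - cutoff δ x * (currentPairing p (fun y => (F y).re) x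
        - currentPairing m (fun y => (F y).re) x) := by
    intro x hx
    have d1 := (hχ.differentiable one_ne_zero).differentiableAt (x := x)
    have d2 := (hη.differentiable one_ne_zero).differentiableAt (x := x)
    rw [currentPairing_mul p d1 d2, currentPairing_mul m d1 d2, currentPairing_cutoff,
      currentPairing_cutoff, stressDiff_eq_current F (hg x hx) (hn x hx)]
    ring
  have isum := ((ip.sub im).add is).sub ig
  refine ⟨isum.congr_fun (fun x hx => (hpt x hx).symm) measurableSet_ball, ?_⟩
  rw [setIntegral_congr_fun measurableSet_ball hpt]
  have e1 := integral_sub ((ip.sub im).add is) ig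
  have e2 := integral_add (ip.sub im) is
  have e3 := integral_sub ip im
  have p0' : ∫ x in ball (0 : ℂ) 1, currentPairing p (fun y => cutoff δ y * (F y).re) x = 0 := p0
  have m0' : ∫ x in ball (0 : ℂ) 1, currentPairing m (fun y => cutoff δ y * (F y).re) x = 0 := m0
  rw [integral_neg] at s0
  simp only [Pi.add_apply, Pi.sub_apply] at e1 e2 e3 ⊢
  rw [e1, e2, e3, p0', m0', neg_eq_zero.1 s0]
  ring

lemma tendsto_integral_boundaryLayer {H : ℂ → ℝ} (hH : IntegrableOn H (ball 0 1)) :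
    Tendsto (fun δ => ∫ x in boundaryLayer δ, H x) (nhdsWithin 0 (Ioi 0)) (nhds 0) := by
  have e : ∀ δ, ∫ x in boundaryLayer δ, H x =
      ∫ x in ball (0 : ℂ) 1, (boundaryLayer δ).indicator H x := fun δ => by
    rw [setIntegral_indicator (measurableSet_boundaryLayer δ),
      inter_eq_right.2 (boundaryLayer_subset δ)]
  simp only [e]
  have e0 : ∫ _ in ball (0 : ℂ) 1, (0 : ℝ) = 0 := integral_zero _ _
  conv => arg 3; rw [← e0]
  refine tendsto_integral_filter_of_dominated_convergence (fun x => ‖H x‖) (.of_forall fun δ =>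
    (hH.indicator (measurableSet_boundaryLayer δ)).aestronglyMeasurable)
    (.of_forall fun δ => ae_of_all _ fun x => norm_indicator_le_norm_self _ _) hH.norm ?_
  refine (ae_restrict_iff' measurableSet_ball).2 (ae_of_all _ fun x hx => ?_)
  have hx' : 0 < (1 - ‖x‖ ^ 2) / 2 := by
    have : ‖x‖ < 1 := by simpa using hx
    nlinarith [norm_nonneg x]
  refine tendsto_const_nhds.congr' ?_
  filter_upwards [mem_nhdsWithin_of_mem_nhds (gt_mem_nhds hx')] with δ hδ
  rw [indicator_of_notMem]
  exact fun h => by linarith [h.2]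

lemma tendsto_integral_cutoff_smul {E : Type*} [NormedAddCommGroup E] [NormedSpace ℝ E]
    {g : ℂ → E} (hg : IntegrableOn g (ball 0 1)) :
    Tendsto (fun δ => ∫ x in ball (0 : ℂ) 1, cutoff δ x • g x) (nhdsWithin 0 (Ioi 0))
      (nhds (∫ x in ball (0 : ℂ) 1, g x)) := by
  refine tendsto_integral_filter_of_dominated_convergence (fun x => ‖g x‖) (.of_forall fun δ =>
    (contDiff_cutoff δ).continuous.aestronglyMeasurable.smul hg.aestronglyMeasurable)
    (.of_forall fun δ => ae_of_all _ fun x => ?_) hg.norm ?_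
  · rw [norm_smul]
    exact mul_le_of_le_one_left (norm_nonneg _) (abs_cutoff_le_one δ x)
  refine (ae_restrict_iff' measurableSet_ball).2 (ae_of_all _ fun x hx => ?_)
  have hx' : 0 < (1 - ‖x‖ ^ 2) / 2 := by
    have : ‖x‖ < 1 := by simpa using hx
    nlinarith [norm_nonneg x]
  refine tendsto_const_nhds.congr' ?_
  filter_upwards [mem_nhdsWithin_of_mem_nhds (gt_mem_nhds hx'), self_mem_nhdsWithin] with δ hδ h0
  rw [cutoff_eq_one h0 (by linarith), one_smul]

/-- The difference of the currents is orthogonal to gradients of harmonic functions. -/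
lemma integral_currentPairing_eq (hp : ScalarMinimizer ε p) (hm : ScalarMinimizer ε m)
    (hn : ∀ x ∈ ball (0 : ℂ) 1, ‖p x‖ = ‖m x‖) (hF : Differentiable ℂ F) :
    ∫ x in ball (0 : ℂ) 1, currentPairing p (fun y => (F y).re) x =
      ∫ x in ball (0 : ℂ) 1, currentPairing m (fun y => (F y).re) x := by
  have hη : ContDiff ℝ 1 fun y => (F y).re :=
    reCLM.contDiff.comp ((hF.contDiff (n := 1)).restrict_scalars ℝ)
  have jp := hp.fin.integrable_currentPairing hη
  have jm := hm.fin.integrable_currentPairing hη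
  rw [← sub_eq_zero, ← integral_sub jp jm]
  set L := ∫ x in ball (0 : ℂ) 1, (currentPairing p (fun y => (F y).re) x
      - currentPairing m (fun y => (F y).re) x) with hL
  obtain ⟨Cp, hCp0, hCp⟩ := hp.exists_integral_rotDefect_le
  obtain ⟨Cm, hCm0, hCm⟩ := hm.exists_integral_rotDefect_le
  obtain ⟨C, hC0, hC⟩ := exists_abs_cutoffSlope_le
  obtain ⟨N, hN0, hN⟩ := hF.continuous.continuousOn.exists_bound_disk
  set E : ℂ → ℝ := fun x => ‖rotDefect p x‖ ^ 2 + ‖rotDefect m x‖ ^ 2 with hE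
  set H : ℂ → ℝ := fun x => gradSq p x + gradSq m x + ‖p x‖ ^ 2 + ‖m x‖ ^ 2 with hH
  have iE : IntegrableOn E (ball 0 1) :=
    hp.fin.integrable_rotDefect_sq.add hm.fin.integrable_rotDefect_sq
  have iH : IntegrableOn H (ball 0 1) := ((hp.fin.integrable.add hm.fin.integrable).add
    (hp.fin.cont.norm.pow 2).integrableOn_disk).add (hm.fin.cont.norm.pow 2).integrableOn_disk
  have bound : ∀ l > 0, |L| ≤ 4 * N * C * (Cp + Cm) * l := by
    intro l hl
    have hlim : Tendsto (fun δ : ℝ => 4 * N * C * ((l + δ) * (Cp + Cm)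
        + l⁻¹ * ∫ x in boundaryLayer δ, H x)) (nhdsWithin 0 (Ioi 0))
        (nhds (4 * N * C * ((l + 0) * (Cp + Cm) + l⁻¹ * 0))) := by
      have hid : Tendsto (fun δ : ℝ => δ) (nhdsWithin 0 (Ioi 0)) (nhds 0) :=
        tendsto_id.mono_left nhdsWithin_le_nhds
      exact (((hid.const_add l).mul_const _).add
        ((tendsto_integral_boundaryLayer iH).const_mul _)).const_mul _
    have hleft := (tendsto_integral_cutoff_smul (jp.sub jm)).abs
    refine (le_of_tendsto_of_tendsto hleft hlim ?_).trans (le_of_eq (by ring))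
    filter_upwards [self_mem_nhdsWithin,
      mem_nhdsWithin_of_mem_nhds (gt_mem_nhds (by norm_num : (0 : ℝ) < 1 / 4))] with δ h0 h1
    have h0 : 0 < δ := h0
    obtain ⟨ie, he⟩ := integral_cutoff_mul_currentPairing hp hm hn hF h0
    simp only [Pi.sub_apply, smul_eq_mul]
    rw [he, abs_neg]
    have hA := measurableSet_boundaryLayer δ
    have iEA := iE.mono_set (boundaryLayer_subset δ)
    have iHA := iH.mono_set (boundaryLayer_subset δ)
    have eA : ∫ x in ball (0 : ℂ) 1, cutoffSlope δ x * layerError p m F x =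
        ∫ x in boundaryLayer δ, cutoffSlope δ x * layerError p m F x := by
      refine setIntegral_eq_of_subset_of_forall_sdiff_eq_zero measurableSet_ball
        (boundaryLayer_subset δ) fun x hx => ?_
      have hx1 : ‖x‖ < 1 := by simpa using hx.1
      rw [cutoffSlope_eq_zero h0 (not_le.1 fun h => hx.2 ⟨hx1, h⟩), zero_mul]
    rw [eA]
    have hE' : ∫ x in boundaryLayer δ, E x ≤ (Cp + Cm) * δ ^ 2 := by
      have := integral_add (hp.fin.integrable_rotDefect_sq.mono_set (boundaryLayer_subset δ))
        (hm.fin.integrable_rotDefect_sq.mono_set (boundaryLayer_subset δ))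
      simp only [hE]
      rw [this]
      linarith [hCp δ h0 h1.le, hCm δ h0 h1.le]
    calc |∫ x in boundaryLayer δ, cutoffSlope δ x * layerError p m F x|
        ≤ ∫ x in boundaryLayer δ, C / δ * (4 * N * ((l / δ + 1) * E x + (l / δ)⁻¹ * H x)) := by
          refine norm_integral_le_of_norm_le (G := ℝ)
            ((((iEA.const_mul (l / δ + 1)).add (iHA.const_mul (l / δ)⁻¹)).const_mul
              (4 * N)).const_mul (C / δ))
            ((ae_restrict_iff' hA).2 (ae_of_all _ fun x hx => ?_))
          have hx1 : ‖x‖ ≤ 1 := hx.1.le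
          rw [norm_mul]
          exact mul_le_mul (hC δ h0 x hx) (abs_layerError_le hx1 (hN x (by simpa using hx1))
            (div_pos hl h0)) (abs_nonneg _) (by positivity)
      _ = C / δ * (4 * N * ((l / δ + 1) * (∫ x in boundaryLayer δ, E x)
            + (l / δ)⁻¹ * ∫ x in boundaryLayer δ, H x)) := by
          have := integral_add (iEA.const_mul (l / δ + 1)) (iHA.const_mul (l / δ)⁻¹)
          rw [integral_const_mul, integral_const_mul, this, integral_const_mul, integral_const_mul]
      _ ≤ C / δ * (4 * N * ((l / δ + 1) * ((Cp + Cm) * δ ^ 2)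
            + (l / δ)⁻¹ * ∫ x in boundaryLayer δ, H x)) := by gcongr
      _ = _ := by field_simp
  by_contra hne
  have hpos : 0 < |L| := abs_pos.2 hne
  have hK : 0 ≤ 4 * N * C * (Cp + Cm) := by positivity
  have := bound (|L| / (2 * (4 * N * C * (Cp + Cm) + 1))) (by positivity)
  rw [← mul_div_assoc, le_div_iff₀ (by positivity)] at this
  nlinarith

end Layer

/-- The weak form of the Ginzburg–Landau operator at `u`, tested against `φ`. -/
def glForm (ε : ℝ) (u φ : ℂ → ℂ) : ℝ :=
  ∫ x in ball (0 : ℂ) 1, (gradInner u φ x - (1 - ‖u x‖ ^ 2) / ε ^ 2 * inner ℝ (u x) (φ x))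

lemma FiniteDirichlet.integrable_potential {u φ : ℂ → ℂ} (hu : FiniteDirichlet u)
    (hφ : FiniteDirichlet φ) (ε : ℝ) :
    IntegrableOn (fun x => (1 - ‖u x‖ ^ 2) / ε ^ 2 * inner ℝ (u x) (φ x)) (ball 0 1) :=
  ContinuousOn.integrableOn_disk (((continuousOn_const.sub (hu.cont.norm.pow 2)).div_const _).mul
    (hu.cont.inner (𝕜 := ℝ) hφ.cont))

lemma FiniteDirichlet.integrable_glForm {u φ : ℂ → ℂ} (hu : FiniteDirichlet u)
    (hφ : FiniteDirichlet φ) (ε : ℝ) : IntegrableOn (fun x => gradInner u φ x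
      - (1 - ‖u x‖ ^ 2) / ε ^ 2 * inner ℝ (u x) (φ x)) (ball 0 1) :=
  (hu.integrable_gradInner hφ).sub (hu.integrable_potential hφ ε)

lemma gradInner_add_right {f g h : ℂ → ℂ} {x : ℂ} (hg : DifferentiableAt ℝ g x)
    (hh : DifferentiableAt ℝ h x) :
    gradInner f (fun y => g y + h y) x = gradInner f g x + gradInner f h x := by
  simp only [gradInner, fderiv_fun_add hg hh, add_apply, inner_add_right]
  ring

lemma gradInner_sub_right {f g h : ℂ → ℂ} {x : ℂ} (hg : DifferentiableAt ℝ g x)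
    (hh : DifferentiableAt ℝ h x) :
    gradInner f (fun y => g y - h y) x = gradInner f g x - gradInner f h x := by
  simp only [gradInner, fderiv_fun_sub hg hh, sub_apply, inner_sub_right]
  ring

lemma glForm_add {ε : ℝ} {u f g : ℂ → ℂ} (hu : FiniteDirichlet u) (hf : FiniteDirichlet f)
    (hg : FiniteDirichlet g) :
    glForm ε u (fun y => f y + g y) = glForm ε u f + glForm ε u g := by
  rw [glForm, glForm, glForm, ← integral_add (hu.integrable_glForm hf ε) (hu.integrable_glForm hg ε)]
  refine setIntegral_congr_fun measurableSet_ball fun x hx => ?_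
  simp only [gradInner_add_right (hf.smooth.differentiableAt_disk hx)
    (hg.smooth.differentiableAt_disk hx), inner_add_right]
  ring

lemma glForm_sub {ε : ℝ} {u f g : ℂ → ℂ} (hu : FiniteDirichlet u) (hf : FiniteDirichlet f)
    (hg : FiniteDirichlet g) :
    glForm ε u (fun y => f y - g y) = glForm ε u f - glForm ε u g := by
  rw [glForm, glForm, glForm, ← integral_sub (hu.integrable_glForm hf ε) (hu.integrable_glForm hg ε)]
  refine setIntegral_congr_fun measurableSet_ball fun x hx => ?_
  simp only [gradInner_sub_right (hf.smooth.differentiableAt_disk hx)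
    (hg.smooth.differentiableAt_disk hx), inner_sub_right]
  ring

lemma WeakGL.glForm_eq_zero {ε : ℝ} {u φ : ℂ → ℂ} (hw : WeakGL ε u) (hu : FiniteDirichlet u)
    (hφ : FiniteDirichlet φ) (h0 : ∀ x : ℂ, ‖x‖ = 1 → φ x = 0) : glForm ε u φ = 0 := by
  rw [glForm, integral_sub (hu.integrable_gradInner hφ) (hu.integrable_potential hφ ε),
    hw φ hφ h0, sub_self]

lemma gradInner_self_mul {p η : ℂ → ℂ} {x : ℂ} (hp : DifferentiableAt ℝ p x)
    (hη : DifferentiableAt ℝ η x) : gradInner p (fun y => p y * η y) x =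
      (η x).re * gradSq p x + (fderiv ℝ (fun y => (η y).re) x 1 * inner ℝ (fderiv ℝ p x 1) (p x)
        + fderiv ℝ (fun y => (η y).re) x I * inner ℝ (fderiv ℝ p x I) (p x))
      + currentPairing p (fun y => (η y).im) x := by
  have hr : DifferentiableAt ℝ (fun y => (η y).re) x := reCLM.differentiableAt.comp x hη
  have hi : DifferentiableAt ℝ (fun y => (η y).im) x := imCLM.differentiableAt.comp x hη
  have hI : DifferentiableAt ℝ (fun y => I * p y) x := hp.const_mul I
  have e : (fun y => p y * η y) =
      fun y => ((η y).re : ℂ) * p y + ((η y).im : ℂ) * (I * p y) := by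
    funext y
    conv_lhs => rw [← re_add_im (η y)]
    ring
  have hr' : DifferentiableAt ℝ (fun y => ((η y).re : ℂ)) x := ofRealCLM.differentiableAt.comp x hr
  have hi' : DifferentiableAt ℝ (fun y => ((η y).im : ℂ)) x := ofRealCLM.differentiableAt.comp x hi
  rw [e, gradInner_add_right (hr'.fun_mul hp) (hi'.fun_mul hI), gradInner_ofReal_mul hr hp,
    gradInner_ofReal_mul hi hI, gradInner_self]
  have : gradInner p (fun y => I * p y) x = 0 := by
    simp only [gradInner, fderiv_I_mul hp, inner_self_I_mul, add_zero]
  rw [this, currentPairing, current, current]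
  ring

section Difference

variable {ε : ℝ} {p m : ℂ → ℂ}

lemma glForm_self_mul_eq (hp : ScalarMinimizer ε p) (hm : ScalarMinimizer ε m)
    (hn : ∀ x ∈ ball (0 : ℂ) 1, ‖p x‖ = ‖m x‖)
    {η F : ℂ → ℂ} (hη : ContDiff ℝ 1 η) (hF : Differentiable ℂ F)
    (h : ∀ y, (η y).im = (F y).re) :
    glForm ε p (fun y => p y * η y) = glForm ε m (fun y => m y * η y) := by
  have hg := gradSq_eq_of_norm_eq hp.fin hm.fin hp.weakGL hm.weakGL hn
  have hη' := FiniteDirichlet.of_contDiff hη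
  have hi : ContDiff ℝ 1 fun y => (F y).re :=
    reCLM.contDiff.comp ((hF.contDiff (n := 1)).restrict_scalars ℝ)
  rw [← sub_eq_zero, glForm, glForm, ← integral_sub (hp.fin.integrable_glForm (hp.fin.mul hη') ε)
    (hm.fin.integrable_glForm (hm.fin.mul hη') ε),
    ← sub_eq_zero.2 (integral_currentPairing_eq hp hm hn hF),
    ← integral_sub (hp.fin.integrable_currentPairing hi) (hm.fin.integrable_currentPairing hi)]
  refine setIntegral_congr_fun measurableSet_ball fun x hx => ?_
  have d := (hη.differentiable one_ne_zero).differentiableAt (x := x)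
  have hin := inner_fderiv_eq_of_norm_eq hp.fin.smooth hm.fin.smooth hn hx
  have hmul : ∀ a b : ℂ, inner ℝ a (a * b) = ‖a‖ ^ 2 * b.re := fun a b => by
    rw [Complex.inner, mul_right_comm, mul_conj, normSq_eq_norm_sq, re_ofReal_mul]
  simp only [gradInner_self_mul (hp.fin.smooth.differentiableAt_disk hx) d,
    gradInner_self_mul (hm.fin.smooth.differentiableAt_disk hx) d, hg x hx, hin, hn x hx, hmul, h]
  ring

/-- The weak forms of `p` and `m` agree on test maps whose boundary trace is `x` times a harmonic
phase. -/
lemma glForm_eq_of_boundary (hp : ScalarMinimizer ε p) (hm : ScalarMinimizer ε m)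
    (hn : ∀ x ∈ ball (0 : ℂ) 1, ‖p x‖ = ‖m x‖)
    {φ η F : ℂ → ℂ} (hφ : FiniteDirichlet φ) (hη : ContDiff ℝ 1 η)
    (hF : Differentiable ℂ F) (h : ∀ y, (η y).im = (F y).re)
    (hb : ∀ x : ℂ, ‖x‖ = 1 → φ x = x * η x) : glForm ε p φ = glForm ε m φ := by
  have hη' := FiniteDirichlet.of_contDiff hη
  have key : ∀ {u : ℂ → ℂ}, ScalarMinimizer ε u →
      glForm ε u φ = glForm ε u (fun y => u y * η y) := fun {u} hu => by
    rw [← sub_eq_zero, ← glForm_sub hu.fin hφ (hu.fin.mul hη')]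
    exact hu.weakGL.glForm_eq_zero hu.fin (hφ.sub (hu.fin.mul hη')) fun x hx => by
      rw [hb x hx, hu.boundary x hx, sub_self]
  rw [key hp, key hm, glForm_self_mul_eq hp hm hn hη hF h]

lemma glForm_monomial_eq (hp : ScalarMinimizer ε p) (hm : ScalarMinimizer ε m)
    (hn : ∀ x ∈ ball (0 : ℂ) 1, ‖p x‖ = ‖m x‖)
    (c : ℂ) (j k : ℕ) :
    glForm ε p (fun y => c * (y ^ j * (starRingEnd ℂ y) ^ k)) =
      glForm ε m (fun y => c * (y ^ j * (starRingEnd ℂ y) ^ k)) := by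
  have hconj : ContDiff ℝ 1 (starRingEnd ℂ : ℂ → ℂ) := conjCLE.contDiff
  have hφ : FiniteDirichlet fun y => c * (y ^ j * (starRingEnd ℂ y) ^ k) :=
    .of_contDiff (contDiff_const.mul ((contDiff_id.pow j).mul (hconj.pow k)))
  have hu : ∀ x : ℂ, ‖x‖ = 1 → x * starRingEnd ℂ x = 1 := fun x hx => by
    rw [mul_conj, normSq_eq_norm_sq, hx]; simp
  rcases lt_or_ge k j with hjk | hjk
  · obtain ⟨n, rfl⟩ := Nat.exists_eq_add_of_lt hjk
    refine glForm_eq_of_boundary hp hm hn (η := fun y => c * y ^ n) (F := fun y => -I * (c * y ^ n))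
      hφ (contDiff_const.mul (contDiff_id.pow n)) (by fun_prop) (fun y => by simp) fun x hx => ?_
    calc _ = x * (c * x ^ n) * (x * starRingEnd ℂ x) ^ k := by ring
      _ = _ := by rw [hu x hx]; ring
  · obtain ⟨n, rfl⟩ := Nat.exists_eq_add_of_le hjk
    refine glForm_eq_of_boundary hp hm hn (η := fun y => c * (starRingEnd ℂ y) ^ (n + 1))
      (F := fun y => I * (starRingEnd ℂ c * y ^ (n + 1)))
      hφ (contDiff_const.mul (hconj.pow _)) (by fun_prop) (fun y => ?_) fun x hx => ?_
    · rw [← map_pow]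
      simp only [mul_re, mul_im, conj_re, conj_im, I_re, I_im]
      ring
    · calc _ = (x * starRingEnd ℂ x) ^ j * (c * (starRingEnd ℂ x) ^ n) := by ring
        _ = (x * starRingEnd ℂ x) * (c * (starRingEnd ℂ x) ^ n) := by rw [hu x hx]; ring
        _ = _ := by ring

lemma glForm_linear_pow_eq (hp : ScalarMinimizer ε p) (hm : ScalarMinimizer ε m)
    (hn : ∀ x ∈ ball (0 : ℂ) 1, ‖p x‖ = ‖m x‖)
    (a b c : ℂ) (n : ℕ) :
    glForm ε p (fun y => c * (a * y + b * starRingEnd ℂ y) ^ n) =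
      glForm ε m (fun y => c * (a * y + b * starRingEnd ℂ y) ^ n) := by
  have hconj : ContDiff ℝ 1 (starRingEnd ℂ : ℂ → ℂ) := conjCLE.contDiff
  have hφ : ∀ (d : ℂ) (j k : ℕ), FiniteDirichlet fun y => d * (y ^ j * (starRingEnd ℂ y) ^ k) :=
    fun d j k => .of_contDiff (contDiff_const.mul ((contDiff_id.pow j).mul (hconj.pow k)))
  have hsum : ∀ s : Finset ℕ, FiniteDirichlet (fun y => ∑ j ∈ s,
        c * a ^ j * b ^ (n - j) * (n.choose j) * (y ^ j * (starRingEnd ℂ y) ^ (n - j))) ∧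
      glForm ε p (fun y => ∑ j ∈ s,
        c * a ^ j * b ^ (n - j) * (n.choose j) * (y ^ j * (starRingEnd ℂ y) ^ (n - j))) =
      glForm ε m (fun y => ∑ j ∈ s,
        c * a ^ j * b ^ (n - j) * (n.choose j) * (y ^ j * (starRingEnd ℂ y) ^ (n - j))) := by
    intro s
    induction s using Finset.induction_on with
    | empty => exact ⟨by simpa using hφ 0 0 0, by simpa using glForm_monomial_eq hp hm hn 0 0 0⟩
    | insert j s hj ih =>
      simp only [Finset.sum_insert hj]
      refine ⟨(hφ _ _ _).add ih.1, ?_⟩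
      rw [glForm_add hp.fin (hφ _ _ _) ih.1, glForm_add hm.fin (hφ _ _ _) ih.1, ih.2,
        glForm_monomial_eq hp hm hn]
  have e : (fun y => c * (a * y + b * starRingEnd ℂ y) ^ n) = fun y =>
      ∑ j ∈ Finset.range (n + 1),
        c * a ^ j * b ^ (n - j) * (n.choose j) * (y ^ j * (starRingEnd ℂ y) ^ (n - j)) := by
    funext y
    rw [add_pow, Finset.mul_sum]
    refine Finset.sum_congr rfl fun j _ => ?_
    ring
  rw [e]
  exact (hsum _).2

end Difference

lemma volume_boundaryLayer_le {δ : ℝ} (h0 : 0 < δ) (h1 : 2 * δ < 1) :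
    volume.real (boundaryLayer δ) ≤ 2 * Real.pi * δ := by
  have hs : boundaryLayer δ ⊆ ball (0 : ℂ) 1 \ ball 0 (Real.sqrt (1 - 2 * δ)) := fun x hx =>
    ⟨boundaryLayer_subset δ hx, fun h => by
      have h' : ‖x‖ < Real.sqrt (1 - 2 * δ) := by simpa using h
      have := (Real.lt_sqrt (norm_nonneg x)).1 h'
      linarith [hx.2]⟩
  have hv : ∀ r : ℝ, 0 ≤ r → volume.real (ball (0 : ℂ) r) = r ^ 2 * Real.pi := fun r hr => by
    rw [Measure.real, Complex.volume_ball]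
    rw [ENNReal.toReal_mul, ENNReal.toReal_pow, ENNReal.toReal_ofReal hr]
    rfl
  have hle : Real.sqrt (1 - 2 * δ) ≤ 1 := Real.sqrt_le_one.2 (by linarith)
  refine (measureReal_mono hs ((measure_mono sdiff_subset).trans_lt measure_ball_lt_top).ne).trans ?_
  rw [measureReal_sdiff (ball_subset_ball hle) measurableSet_ball, hv 1 zero_le_one,
    hv _ (Real.sqrt_nonneg _), Real.sq_sqrt (by linarith)]
  linarith

lemma exists_norm_le_boundaryLayer {g : ℂ → ℂ} (hc : ContinuousOn g (closedBall 0 1))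
    (hb : ∀ x : ℂ, ‖x‖ = 1 → g x = 0) {η : ℝ} (hη : 0 < η) :
    ∃ r > 0, ∀ δ < r, ∀ x ∈ boundaryLayer δ, ‖g x‖ ≤ η := by
  have hu := (isCompact_closedBall (0 : ℂ) 1).uniformContinuousOn_of_continuous hc
  obtain ⟨d, hd, h⟩ := Metric.uniformContinuousOn_iff.1 hu η hη
  refine ⟨min (d / 2) (1 / 2), by positivity, fun δ hδ x hx => ?_⟩
  have hδ1 := hδ.trans_le (min_le_left _ _)
  have hδ2 := hδ.trans_le (min_le_right _ _)
  have hx0 : 0 < ‖x‖ := by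
    by_contra h
    have h' : ‖x‖ = 0 := le_antisymm (not_lt.1 h) (norm_nonneg _)
    have := hx.2
    rw [h'] at this
    linarith
  have hy : ‖x / ‖x‖‖ = 1 := by simp [hx0.ne']
  have hdist : dist x (x / ‖x‖) < d := by
    have e : x - x / ‖x‖ = -(((1 - ‖x‖) / ‖x‖ : ℝ) : ℂ) * x := by
      have : (‖x‖ : ℂ) ≠ 0 := by exact_mod_cast hx0.ne'
      push_cast
      field_simp
      ring
    rw [dist_eq, e, norm_mul, norm_neg, norm_real, Real.norm_eq_abs,
      abs_of_nonneg (div_nonneg (by linarith [hx.1]) hx0.le), div_mul_cancel₀ _ hx0.ne']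
    nlinarith [hx.1, hx.2]
  have := h x (by simpa using hx.1.le) (x / ‖x‖) (by simpa using hy.le) hdist
  rw [hb _ hy, dist_zero_right] at this
  exact this.le

lemma FiniteDirichlet.integrable_fderiv {g : ℂ → ℂ} (hg : FiniteDirichlet g) (v : ℂ) :
    IntegrableOn (fun x => fderiv ℝ g x v) (ball 0 1) := by
  refine integrableOn_disk_of_le (hg.smooth.continuousOn_fderiv_disk v)
    ((continuousOn_const (c := (1 : ℝ))).integrableOn_disk.add (hg.integrable.const_mul (‖v‖ ^ 2)))
    fun x _ => ?_
  rw [Pi.add_apply]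
  nlinarith [norm_fderiv_apply_sq_le g x v, sq_nonneg (‖fderiv ℝ g x v‖ - 1)]

lemma FiniteDirichlet.integral_cutoff_smul_fderiv {g : ℂ → ℂ} (hg : FiniteDirichlet g) {δ : ℝ}
    (hδ : 0 < δ) (v : ℂ) : ∫ x in ball (0 : ℂ) 1, cutoff δ x • fderiv ℝ g x v =
      -∫ x in boundaryLayer δ, fderiv ℝ (cutoff δ) x v • g x := by
  have hχ := contDiff_cutoff δ
  have hs := tsupport_cutoff_subset hδ
  have h0 : ∀ x ∉ ball (0 : ℂ) 1, cutoff δ x = 0 := fun x hx =>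
    image_eq_zero_of_notMem_tsupport fun h => hx (hs h)
  have h0' : ∀ x ∉ ball (0 : ℂ) 1, fderiv ℝ (cutoff δ) x = 0 := fun x hx =>
    image_eq_zero_of_notMem_tsupport fun h => hx (hs (tsupport_fderiv_subset ℝ h))
  have hl : ∀ x ∈ ball (0 : ℂ) 1, x ∉ boundaryLayer δ → fderiv ℝ (cutoff δ) x v = 0 :=
    fun x hx hxl => by
      have hx1 : ‖x‖ < 1 := by simpa using hx
      rw [fderiv_cutoff, cutoffSlope_eq_zero hδ (not_le.1 fun h => hxl ⟨hx1, h⟩), zero_mul, neg_zero]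
  have ext : ∀ k : ℂ → ℂ, (∀ x ∉ ball (0 : ℂ) 1, k x = 0) → IntegrableOn k (ball 0 1) →
      Integrable k := fun k hk hi =>
    (integrableOn_iff_integrable_of_support_subset fun x hx => by_contra fun h => hx (hk x h)).1 hi
  have bnd : ∀ {a : ℂ → ℝ} {k : ℂ → ℂ}, Continuous a → IntegrableOn k (ball 0 1) →
      IntegrableOn (fun x => a x • k x) (ball 0 1) := fun {a k} ha hk => by
    obtain ⟨M, -, hM⟩ := ha.continuousOn.exists_bound_disk
    exact Integrable.bdd_smul hk M ha.continuousOn.aestronglyMeasurable_disk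
      ((ae_restrict_iff' measurableSet_ball).2
        (ae_of_all _ fun x hx => hM x (ball_subset_closedBall hx)))
  have key := integral_smul_fderiv_eq_neg_fderiv_smul_of_integrable (𝕜 := ℝ) (μ := volume)
    (f := cutoff δ) (g := g) (v := v)
    (ext _ (fun x hx => by simp [h0' x hx])
      (bnd ((hχ.continuous_fderiv one_ne_zero).clm_apply continuous_const) hg.cont.integrableOn_disk))
    (ext _ (fun x hx => by simp [h0 x hx]) (bnd hχ.continuous (hg.integrable_fderiv v)))
    (ext _ (fun x hx => by simp [h0 x hx]) (bnd hχ.continuous hg.cont.integrableOn_disk))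
    (fun x _ => (hχ.differentiable one_ne_zero).differentiableAt)
    (fun x hx => hg.smooth.differentiableAt_disk (hs hx))
  rw [setIntegral_eq_integral_of_forall_compl_eq_zero (fun x hx => by simp [h0 x hx]), key,
    setIntegral_eq_integral_of_forall_compl_eq_zero]
  intro x hx
  by_cases hxb : x ∈ ball (0 : ℂ) 1
  · rw [hl x hxb hx, zero_smul]
  · simp [h0' x hxb]

/-- Divergence theorem for maps vanishing on the unit circle. -/
lemma FiniteDirichlet.integral_fderiv_eq_zero {g : ℂ → ℂ} (hg : FiniteDirichlet g)
    (hb : ∀ x : ℂ, ‖x‖ = 1 → g x = 0) (v : ℂ) :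
    ∫ x in ball (0 : ℂ) 1, fderiv ℝ g x v = 0 := by
  obtain ⟨C, hC0, hC⟩ := exists_abs_cutoffSlope_le
  have hlim := (tendsto_integral_cutoff_smul (hg.integrable_fderiv v)).norm
  rw [← norm_eq_zero]
  refine le_antisymm (le_of_forall_pos_le_add fun e he => ?_) (norm_nonneg _)
  set η := e / (2 * Real.pi * (C * ‖v‖) + 1) with hη
  have hη0 : 0 < η := by positivity
  obtain ⟨r, hr, h⟩ := exists_norm_le_boundaryLayer hg.cont hb hη0
  rw [zero_add]
  refine le_of_tendsto hlim ?_
  filter_upwards [self_mem_nhdsWithin, mem_nhdsWithin_of_mem_nhds (gt_mem_nhds hr),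
    mem_nhdsWithin_of_mem_nhds (gt_mem_nhds (by norm_num : (0 : ℝ) < 1 / 2))] with δ h0 h1 h2
  have h0 : 0 < δ := h0
  rw [hg.integral_cutoff_smul_fderiv h0, norm_neg]
  have hvol := volume_boundaryLayer_le h0 (by linarith)
  refine (norm_setIntegral_le_of_norm_le_const (C := C / δ * ‖v‖ * η)
    ((measure_mono (boundaryLayer_subset δ)).trans_lt measure_ball_lt_top) fun x hx => ?_).trans ?_
  · rw [norm_smul]
    refine mul_le_mul ?_ (h δ h1 x hx) (norm_nonneg _) (by positivity)
    rw [fderiv_cutoff, norm_neg, norm_mul]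
    refine mul_le_mul (hC δ h0 x hx) ?_ (norm_nonneg _) (by positivity)
    have := abs_real_inner_le_norm x v
    rw [Complex.inner] at this
    have hx1 : ‖x‖ ≤ 1 := hx.1.le
    refine (le_of_eq ?_).trans (this.trans (mul_le_of_le_one_left (norm_nonneg _) hx1))
    rw [Real.norm_eq_abs]
    congr 1
    simp
    ring
  · refine (mul_le_mul_of_nonneg_left hvol (by positivity)).trans ?_
    have : C / δ * ‖v‖ * η * (2 * Real.pi * δ) = (2 * Real.pi * (C * ‖v‖)) * η := by
      field_simp
    rw [this, hη, mul_div_assoc']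
    rw [div_le_iff₀ (by positivity)]
    nlinarith

lemma FiniteDirichlet.integral_fderiv_mul {W ψ : ℂ → ℂ} (hW : FiniteDirichlet W)
    (hb : ∀ x : ℂ, ‖x‖ = 1 → W x = 0) (hψ : ContDiff ℝ 1 ψ) (v : ℂ) :
    IntegrableOn (fun x => fderiv ℝ W x v * ψ x) (ball 0 1) ∧
    ∫ x in ball (0 : ℂ) 1, fderiv ℝ W x v * ψ x = -∫ x in ball (0 : ℂ) 1, W x * fderiv ℝ ψ x v := by
  have hψ' := FiniteDirichlet.of_contDiff hψ
  have hWψ := hW.mul hψ'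
  have i1 : IntegrableOn (fun x => W x * fderiv ℝ ψ x v) (ball 0 1) :=
    (hW.cont.mul ((hψ.continuous_fderiv one_ne_zero).clm_apply
      continuous_const).continuousOn).integrableOn_disk
  have e : ∀ x ∈ ball (0 : ℂ) 1, fderiv ℝ (fun y => W y * ψ y) x v - W x * fderiv ℝ ψ x v =
      fderiv ℝ W x v * ψ x := fun x hx => by
    rw [fderiv_fun_mul (hW.smooth.differentiableAt_disk hx) (hψ'.smooth.differentiableAt_disk hx)]
    simp
    ring
  have i2 := hWψ.integrable_fderiv v
  refine ⟨(i2.sub i1).congr_fun e measurableSet_ball, ?_⟩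
  rw [← setIntegral_congr_fun measurableSet_ball e, integral_sub i2 i1,
    hWψ.integral_fderiv_eq_zero (fun x hx => by simp [hb x hx]) v, zero_sub]

/-- The general real-linear form on `ℂ`, as a function of the coefficients of `x` and `conj x`. -/
def planeForm (a b x : ℂ) : ℂ := a * x + b * starRingEnd ℂ x

lemma hasFDerivAt_planeForm (a b x : ℂ) : ∃ L : ℂ →L[ℝ] ℂ,
    HasFDerivAt (planeForm a b) L x ∧ ∀ v, L v = planeForm a b v := by
  refine ⟨a • (1 : ℂ →L[ℝ] ℂ) + b • (conjCLE : ℂ →L[ℝ] ℂ), ?_, fun v => by simp [planeForm]⟩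
  exact ((hasFDerivAt_id x).const_mul a).add ((conjCLE : ℂ →L[ℝ] ℂ).hasFDerivAt.const_mul b)

lemma contDiff_planeForm (a b : ℂ) : ContDiff ℝ 1 (planeForm a b) := by
  have hconj : ContDiff ℝ 1 (starRingEnd ℂ : ℂ → ℂ) := conjCLE.contDiff
  exact (contDiff_const.mul contDiff_id).add (contDiff_const.mul hconj)

lemma fderiv_const_mul_planeForm_pow (a b c x v : ℂ) (n : ℕ) :
    fderiv ℝ (fun y => c * planeForm a b y ^ n) x v =
      c * (n * planeForm a b x ^ (n - 1) * planeForm a b v) := by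
  obtain ⟨L, hL, h⟩ := hasFDerivAt_planeForm a b x
  rw [((hL.pow n).const_mul c).fderiv]
  simp [h, nsmul_eq_mul]

lemma planeForm_sq_add_sq (a b : ℂ) : planeForm a b 1 ^ 2 + planeForm a b I ^ 2 = 4 * a * b := by
  simp only [planeForm, map_one, conj_I]
  ring_nf
  simp
  ring

lemma norm_planeForm_le (a b : ℂ) {x : ℂ} (hx : ‖x‖ ≤ 1) : ‖planeForm a b x‖ ≤ ‖a‖ + ‖b‖ := by
  refine (norm_add_le _ _).trans ?_
  rw [norm_mul, norm_mul, norm_conj]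
  nlinarith [norm_nonneg a, norm_nonneg b]

lemma hasSum_integral_mul_planeForm_pow {h : ℂ → ℂ} (hh : IntegrableOn h (ball 0 1)) (a b : ℂ) :
    HasSum (fun n : ℕ => (n.factorial : ℂ)⁻¹ * ∫ x in ball (0 : ℂ) 1, h x * planeForm a b x ^ n)
      (∫ x in ball (0 : ℂ) 1, h x * exp (planeForm a b x)) := by
  simp only [← integral_const_mul]
  have hs := Real.summable_pow_div_factorial (‖a‖ + ‖b‖)
  refine hasSum_integral_of_dominated_convergence
    (fun n x => ‖h x‖ * ((‖a‖ + ‖b‖) ^ n / n.factorial)) (fun n => ?_) (fun n => ?_)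
    (ae_of_all _ fun x => hs.mul_left _) ?_ (ae_of_all _ fun x => ?_)
  · exact (hh.aestronglyMeasurable.mul
      ((contDiff_planeForm a b).continuous.pow n).aestronglyMeasurable).const_mul _
  · refine (ae_restrict_iff' measurableSet_ball).2 (ae_of_all _ fun x hx => ?_)
    have hx : ‖x‖ ≤ 1 := by simpa using ball_subset_closedBall hx
    rw [norm_mul, norm_mul, norm_inv, norm_natCast, norm_pow, div_eq_inv_mul]
    rw [mul_left_comm]
    gcongr
    exact norm_planeForm_le a b hx
  · simp only [tsum_mul_left]
    exact hh.norm.mul_const _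
  · have := (NormedSpace.expSeries_div_hasSum_exp (planeForm a b x)).mul_left (h x)
    rw [← Complex.exp_eq_exp_ℂ] at this
    refine this.congr_fun fun n => ?_
    ring

section Difference

variable {ε : ℝ} {p m : ℂ → ℂ}

/-- The conjugate of the difference of two maps. -/
def conjDiff (p m : ℂ → ℂ) (x : ℂ) : ℂ := starRingEnd ℂ (p x - m x)

lemma finiteDirichlet_conjDiff (hp : ScalarMinimizer ε p) (hm : ScalarMinimizer ε m) :
    FiniteDirichlet (conjDiff p m) := by
  have h := hp.fin.sub hm.fin
  have hd : ∀ x ∈ ball (0 : ℂ) 1, gradSq (fun x => p x - m x) x = gradSq (conjDiff p m) x := by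
    intro x hx
    have := ((conjCLE : ℂ →L[ℝ] ℂ).hasFDerivAt.comp x
      (h.smooth.differentiableAt_disk hx).hasFDerivAt).fderiv
    have e : conjDiff p m = (conjCLE : ℂ →L[ℝ] ℂ) ∘ fun x => p x - m x := rfl
    rw [e, gradSq, gradSq, this]
    simp
  exact ⟨continuous_conj.comp_continuousOn h.cont, conjCLE.contDiff.comp_contDiffOn h.smooth,
    h.integrable.congr_fun hd measurableSet_ball⟩

lemma integral_conjDiff_form (hp : ScalarMinimizer ε p) (hm : ScalarMinimizer ε m)
    (hn : ∀ x ∈ ball (0 : ℂ) 1, ‖p x‖ = ‖m x‖)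
    (a b : ℂ) (n : ℕ) : ∫ x in ball (0 : ℂ) 1,
    (fderiv ℝ (conjDiff p m) x 1 * (n * planeForm a b x ^ (n - 1) * planeForm a b 1)
      + fderiv ℝ (conjDiff p m) x I * (n * planeForm a b x ^ (n - 1) * planeForm a b I)) =
    ∫ x in ball (0 : ℂ) 1, ((1 - ‖p x‖ ^ 2) / ε ^ 2 : ℝ) * conjDiff p m x * planeForm a b x ^ n := by
  have hW := finiteDirichlet_conjDiff hp hm
  have hd : ∀ x ∈ ball (0 : ℂ) 1, ∀ v, fderiv ℝ (conjDiff p m) x v =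
      starRingEnd ℂ (fderiv ℝ p x v) - starRingEnd ℂ (fderiv ℝ m x v) := fun x hx v => by
    have hp' := hp.fin.smooth.differentiableAt_disk hx
    have hm' := hm.fin.smooth.differentiableAt_disk hx
    have e : conjDiff p m = (conjCLE : ℂ →L[ℝ] ℂ) ∘ fun x => p x - m x := rfl
    rw [e, ((conjCLE : ℂ →L[ℝ] ℂ).hasFDerivAt.comp x
      (hp'.hasFDerivAt.fun_sub hm'.hasFDerivAt)).fderiv]
    simp
  have hV : ContinuousOn (fun x => (((1 - ‖p x‖ ^ 2) / ε ^ 2 : ℝ) : ℂ)) (closedBall 0 1) :=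
    continuous_ofReal.comp_continuousOn
      ((continuousOn_const.sub (hp.fin.cont.norm.pow 2)).div_const _)
  have hℓ := contDiff_planeForm a b
  have i1 : ∀ v, IntegrableOn (fun x => fderiv ℝ (conjDiff p m) x v *
      (n * planeForm a b x ^ (n - 1) * planeForm a b v)) (ball 0 1) := fun v => by
    have hψ : ContDiff ℝ 1 fun x => n * planeForm a b x ^ (n - 1) * planeForm a b v :=
      (contDiff_const.mul (hℓ.pow _)).mul contDiff_const
    have hb : ∀ x : ℂ, ‖x‖ = 1 → conjDiff p m x = 0 := fun x hx => by
      simp [conjDiff, hp.boundary x hx, hm.boundary x hx]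
    exact (hW.integral_fderiv_mul hb hψ v).1
  have i2 : IntegrableOn (fun x => (((1 - ‖p x‖ ^ 2) / ε ^ 2 : ℝ) : ℂ) * conjDiff p m x *
      planeForm a b x ^ n) (ball 0 1) :=
    ((hV.mul hW.cont).mul (hℓ.continuous.pow n).continuousOn).integrableOn_disk
  have iL := (i1 1).add (i1 I)
  rw [← sub_eq_zero]
  have e0 := integral_sub iL i2
  simp only [Pi.add_apply] at e0
  rw [← e0]
  have hre : ∀ c : ℂ, (c * ∫ x in ball (0 : ℂ) 1,
      (fderiv ℝ (conjDiff p m) x 1 * (n * planeForm a b x ^ (n - 1) * planeForm a b 1)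
      + fderiv ℝ (conjDiff p m) x I * (n * planeForm a b x ^ (n - 1) * planeForm a b I)
      - (((1 - ‖p x‖ ^ 2) / ε ^ 2 : ℝ) : ℂ) * conjDiff p m x * planeForm a b x ^ n)).re = 0 := by
    intro c
    have hφ : FiniteDirichlet fun y => c * planeForm a b y ^ n :=
      .of_contDiff (contDiff_const.mul (hℓ.pow n))
    have iD := (iL.sub i2).const_mul c
    simp only [Pi.add_apply, Pi.sub_apply] at iD
    have h : glForm ε p (fun y => c * planeForm a b y ^ n)
        - glForm ε m (fun y => c * planeForm a b y ^ n) = 0 :=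
      sub_eq_zero.2 (glForm_linear_pow_eq hp hm hn a b c n)
    rw [← integral_const_mul, ← RCLike.re_eq_complex_re, ← integral_re iD, ← h]
    refine Eq.trans ?_ (integral_sub (hp.fin.integrable_glForm hφ ε)
      (hm.fin.integrable_glForm hφ ε))
    refine setIntegral_congr_fun measurableSet_ball fun x hx => ?_
    simp only [gradInner, fderiv_const_mul_planeForm_pow, Complex.inner, ← re_ofReal_mul, ← add_re,
      ← sub_re, hd x hx, hn x hx, RCLike.re_eq_complex_re, conjDiff, map_sub]
    congr 1
    ring
  refine Complex.ext (by simpa using hre 1) ?_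
  have := hre I
  rw [I_mul_re, neg_eq_zero] at this
  rw [this, zero_im]

lemma integral_conjDiff_mul_pow (hp : ScalarMinimizer ε p) (hm : ScalarMinimizer ε m)
    (hn : ∀ x ∈ ball (0 : ℂ) 1, ‖p x‖ = ‖m x‖)
    (a b : ℂ) (n : ℕ) :
    n * (n - 1 : ℕ) * (4 * a * b) * ∫ x in ball (0 : ℂ) 1, conjDiff p m x * planeForm a b x ^ (n - 2) =
    -∫ x in ball (0 : ℂ) 1,
      (((1 - ‖p x‖ ^ 2) / ε ^ 2 : ℝ) : ℂ) * conjDiff p m x * planeForm a b x ^ n := by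
  have hW := finiteDirichlet_conjDiff hp hm
  have hb : ∀ x : ℂ, ‖x‖ = 1 → conjDiff p m x = 0 := fun x hx => by
    simp [conjDiff, hp.boundary x hx, hm.boundary x hx]
  have hψ : ∀ v, ContDiff ℝ 1 fun x => n * planeForm a b x ^ (n - 1) * planeForm a b v := fun v =>
    (contDiff_const.mul ((contDiff_planeForm a b).pow _)).mul contDiff_const
  have hD : ∀ v, ∫ x in ball (0 : ℂ) 1, fderiv ℝ (conjDiff p m) x v *
      (n * planeForm a b x ^ (n - 1) * planeForm a b v) =
      -(n * (n - 1 : ℕ) * planeForm a b v ^ 2 *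
        ∫ x in ball (0 : ℂ) 1, conjDiff p m x * planeForm a b x ^ (n - 2)) := fun v => by
    rw [(hW.integral_fderiv_mul hb (hψ v) v).2, ← integral_const_mul]
    congr 2
    funext x
    have e : (fun x => n * planeForm a b x ^ (n - 1) * planeForm a b v) =
        fun x => (n * planeForm a b v) * planeForm a b x ^ (n - 1) := by funext x; ring
    rw [e, fderiv_const_mul_planeForm_pow, Nat.sub_sub]
    ring
  rw [← integral_conjDiff_form hp hm hn, integral_add (hW.integral_fderiv_mul hb (hψ 1) 1).1
    (hW.integral_fderiv_mul hb (hψ I) I).1, hD, hD, ← planeForm_sq_add_sq]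
  ring

/-- The difference of the minimizers solves the linearized equation against exponentials. -/
lemma integral_conjDiff_mul_exp (hp : ScalarMinimizer ε p) (hm : ScalarMinimizer ε m)
    (hn : ∀ x ∈ ball (0 : ℂ) 1, ‖p x‖ = ‖m x‖)
    (a b : ℂ) :
    4 * a * b * ∫ x in ball (0 : ℂ) 1, conjDiff p m x * exp (planeForm a b x) =
    -∫ x in ball (0 : ℂ) 1,
      (((1 - ‖p x‖ ^ 2) / ε ^ 2 : ℝ) : ℂ) * conjDiff p m x * exp (planeForm a b x) := by
  have hW := finiteDirichlet_conjDiff hp hm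
  have hV : ContinuousOn (fun x => (((1 - ‖p x‖ ^ 2) / ε ^ 2 : ℝ) : ℂ)) (closedBall 0 1) :=
    continuous_ofReal.comp_continuousOn
      ((continuousOn_const.sub (hp.fin.cont.norm.pow 2)).div_const _)
  have s1 := (hasSum_integral_mul_planeForm_pow hW.cont.integrableOn_disk a b).mul_left (4 * a * b)
  have iV : IntegrableOn (fun x => (((1 - ‖p x‖ ^ 2) / ε ^ 2 : ℝ) : ℂ) * conjDiff p m x)
    (ball 0 1) := (hV.mul hW.cont).integrableOn_disk
  have s2 := (hasSum_integral_mul_planeForm_pow iV a b).neg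
  have key := integral_conjDiff_mul_pow hp hm hn a b
  refine s1.unique ?_
  have h0 := key 0
  have h1 := key 1
  simp only [Nat.cast_zero, zero_mul, Nat.cast_one, Nat.sub_self, mul_zero] at h0 h1
  have s3 := (hasSum_nat_add_iff' 2).2 s2
  simp only [Finset.sum_range_succ, Finset.sum_range_zero, neg_eq_zero.1 h0.symm,
    neg_eq_zero.1 h1.symm, mul_zero, neg_zero, add_zero, sub_zero] at s3
  refine s3.congr_fun fun n => ?_
  rw [← mul_neg, ← key (n + 2), Nat.add_sub_cancel, show n + 2 - 1 = n + 1 from rfl,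
    Nat.factorial_succ (n + 1), Nat.factorial_succ n]
  have hn1 : ((n + 1 : ℕ) : ℂ) ≠ 0 := by exact_mod_cast n.succ_ne_zero
  have hn2 : ((n + 2 : ℕ) : ℂ) ≠ 0 := by exact_mod_cast (n + 1).succ_ne_zero
  have hf : (n.factorial : ℂ) ≠ 0 := by exact_mod_cast n.factorial_ne_zero
  rw [Nat.cast_mul, Nat.cast_mul, show n + 1 + 1 = n + 2 from rfl]
  field_simp

end Difference

open scoped FourierTransform in
lemma Real.continuous_fourier_of_integrable {f : ℂ → ℂ} (hf : Integrable f) :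
    Continuous (𝓕 f) :=
  VectorFourier.fourierIntegral_continuous Real.continuous_fourierChar
    (by exact continuous_inner) hf

open scoped FourierTransform in
lemma Real.norm_fourier_apply_le (f : ℂ → ℂ) (ξ : ℂ) : ‖𝓕 f ξ‖ ≤ ∫ x, ‖f x‖ :=
  VectorFourier.norm_fourierIntegral_le_integral_norm _ _ _ _ _

open scoped FourierTransform SchwartzMap in
lemma fourier_toLp_ae_eq {f : ℂ → ℂ} (h1 : Integrable f) (h2 : MemLp f 2) :
    (𝓕 (h2.toLp f) : Lp ℂ 2 (volume : Measure ℂ)) =ᵐ[volume] 𝓕 f := by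
  refine ae_eq_of_integral_contDiff_smul_eq
    ((Lp.memLp (𝓕 (h2.toLp f) : Lp ℂ 2 (volume : Measure ℂ))).locallyIntegrable (by norm_num))
    (Real.continuous_fourier_of_integrable h1).locallyIntegrable fun g hg hgs => ?_
  have hgs' : HasCompactSupport fun x => (g x : ℂ) := hgs.comp_left (g := ((↑) : ℝ → ℂ)) rfl
  have hg' : ContDiff ℝ (↑(⊤ : ℕ∞)) fun x => (g x : ℂ) := ofRealCLM.contDiff.comp hg
  set s : 𝓢(ℂ, ℂ) := hgs'.toSchwartzMap hg' with hs
  have hsg : ∀ x, s x = g x := fun x => rfl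
  have key := congrArg (fun T => T s) (Lp.fourier_toTemperedDistribution_eq (h2.toLp f))
  simp only [TemperedDistribution.fourier_apply, Lp.toTemperedDistribution_apply] at key
  have flip := VectorFourier.integral_fourierIntegral_smul_eq_flip (e := Real.fourierChar)
    (μ := (volume : Measure ℂ)) (ν := (volume : Measure ℂ)) (L := innerₗ ℂ) (f := s) (g := f)
    Real.continuous_fourierChar (by exact continuous_inner) s.integrable h1
  rw [flip_innerₗ] at flip
  have hgz : ∀ (x z : ℂ), g x • z = s x • z := fun x z => by rw [hsg, Complex.coe_smul]
  simp only [hgz]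
  rw [← key]
  refine Eq.trans (integral_congr_ae ?_) flip
  filter_upwards [h2.coeFn_toLp] with x hx
  rw [hx]
  rfl

open scoped FourierTransform in
lemma lintegral_enorm_fourier_sq {f : ℂ → ℂ} (h1 : Integrable f) (h2 : MemLp f 2) :
    ∫⁻ ξ, ‖𝓕 f ξ‖ₑ ^ 2 = ∫⁻ x, ‖f x‖ₑ ^ 2 := by
  have h := Lp.norm_fourier_eq (h2.toLp f)
  rw [Lp.norm_toLp, Lp.norm_def, eLpNorm_congr_ae (fourier_toLp_ae_eq h1 h2),
    ENNReal.toReal_eq_toReal_iff' (((memLp_congr_ae (fourier_toLp_ae_eq h1 h2)).1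
      (Lp.memLp _)).eLpNorm_ne_top) h2.eLpNorm_ne_top] at h
  have h' := congrArg (fun t : ENNReal => t ^ (2 : ℝ)) h
  simp only [eLpNorm_eq_lintegral_rpow_enorm_toReal (p := 2) (by norm_num) (by norm_num),
    ENNReal.toReal_ofNat, ← ENNReal.rpow_mul] at h'
  simpa using h'

open scoped FourierTransform in
lemma lintegral_sq_eq_zero_of_fourier_le {W G : ℂ → ℂ} {M K : ℝ} {S : Set ℂ} (hW1 : Integrable W)
    (hW2 : MemLp W 2) (hG1 : Integrable G) (hG2 : MemLp G 2) (hW0 : ∀ x ∉ ball (0 : ℂ) 1, W x = 0)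
    (hM : 0 ≤ M) (hWG : ∀ x, ‖G x‖ ≤ M * ‖W x‖) (hK : 0 < K) (hMK : 2 * M ≤ K)
    (hSm : MeasurableSet S) (hS : volume S * volume (ball (0 : ℂ) 1) ≤ 4⁻¹)
    (h : ∀ ξ ∉ S, K * ‖𝓕 W ξ‖ ≤ ‖𝓕 G ξ‖) : ∫⁻ x, ‖W x‖ₑ ^ 2 = 0 := by
  set A := ∫⁻ x, ‖W x‖ₑ ^ 2 with hA
  have hAtop : A ≠ ⊤ := by
    have h2 := hW2.eLpNorm_ne_top
    rw [eLpNorm_eq_lintegral_rpow_enorm_toReal (p := 2) (by norm_num) (by norm_num)] at h2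
    intro hT
    apply h2
    simp only [ENNReal.toReal_ofNat, ENNReal.rpow_ofNat, ← hA, hT]
    norm_num
  have b1 : ∫⁻ ξ in S, ‖𝓕 W ξ‖ₑ ^ 2 ≤ 4⁻¹ * A := by
    have hle : ∀ ξ, ‖𝓕 W ξ‖ₑ ^ 2 ≤ volume (ball (0 : ℂ) 1) * A := fun ξ => by
      have h1 : ‖𝓕 W ξ‖ₑ ≤ ∫⁻ x, ‖W x‖ₑ := by
        rw [← ofReal_integral_norm_eq_lintegral_enorm hW1, ← ofReal_norm]
        exact ENNReal.ofReal_le_ofReal (Real.norm_fourier_apply_le W ξ)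
      have h2 : ∫⁻ x, ‖W x‖ₑ = ∫⁻ x in ball 0 1, ‖W x‖ₑ := by
        rw [← lintegral_indicator measurableSet_ball]
        congr 1
        ext x
        by_cases hx : x ∈ ball (0 : ℂ) 1
        · rw [indicator_of_mem hx]
        · rw [indicator_of_notMem hx, hW0 x hx, enorm_zero]
      calc ‖𝓕 W ξ‖ₑ ^ 2 ≤ (∫⁻ x in ball 0 1, ‖W x‖ₑ) ^ 2 := by rw [← h2]; gcongr
        _ ≤ _ := sq_lintegral_le hW1.aestronglyMeasurable.enorm.restrict
        _ ≤ _ := by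
          rw [Measure.restrict_apply_univ]
          gcongr
          exact setLIntegral_le_lintegral _ _
    calc _ ≤ ∫⁻ _ in S, volume (ball (0 : ℂ) 1) * A := lintegral_mono fun ξ => hle ξ
      _ = volume S * volume (ball (0 : ℂ) 1) * A := by rw [setLIntegral_const]; ring
      _ ≤ _ := by gcongr
  have b2 : ∫⁻ ξ in Sᶜ, ‖𝓕 W ξ‖ₑ ^ 2 ≤ 4⁻¹ * A := by
    have hk : ENNReal.ofReal (K ^ 2) ≠ 0 := by simpa using hK.ne'
    have h1 : ENNReal.ofReal (K ^ 2) * ∫⁻ ξ in Sᶜ, ‖𝓕 W ξ‖ₑ ^ 2 ≤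
        ENNReal.ofReal (K ^ 2) * (4⁻¹ * A) := by
      calc _ = ∫⁻ ξ in Sᶜ, ENNReal.ofReal (K ^ 2) * ‖𝓕 W ξ‖ₑ ^ 2 := by
            rw [lintegral_const_mul' _ _ ENNReal.ofReal_ne_top]
        _ ≤ ∫⁻ ξ in Sᶜ, ‖𝓕 G ξ‖ₑ ^ 2 := by
            refine setLIntegral_mono' hSm.compl fun ξ hξ => ?_
            rw [ENNReal.ofReal_pow hK.le, ← mul_pow, ← ofReal_norm, ← ENNReal.ofReal_mul hK.le,
              ← ofReal_norm]
            gcongr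
            exact h ξ hξ
        _ ≤ ∫⁻ ξ, ‖𝓕 G ξ‖ₑ ^ 2 := setLIntegral_le_lintegral _ _
        _ = ∫⁻ x, ‖G x‖ₑ ^ 2 := lintegral_enorm_fourier_sq hG1 hG2
        _ ≤ ∫⁻ x, ENNReal.ofReal (M ^ 2) * ‖W x‖ₑ ^ 2 := by
            refine lintegral_mono fun x => ?_
            rw [ENNReal.ofReal_pow hM, ← mul_pow, ← ofReal_norm, ← ofReal_norm,
              ← ENNReal.ofReal_mul hM]
            gcongr
            exact hWG x
        _ = ENNReal.ofReal (M ^ 2) * A := lintegral_const_mul' _ _ ENNReal.ofReal_ne_top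
        _ ≤ _ := by
            rw [← mul_assoc]
            gcongr
            have h4 : (4⁻¹ : ENNReal) = ENNReal.ofReal 4⁻¹ := by
              rw [ENNReal.ofReal_inv_of_pos (by norm_num)]; norm_num
            rw [h4, ← ENNReal.ofReal_mul (sq_nonneg K)]
            exact ENNReal.ofReal_le_ofReal (by nlinarith)
    exact (ENNReal.mul_le_mul_iff_right hk ENNReal.ofReal_ne_top).1 h1
  have hle : A ≤ 4⁻¹ * A + 4⁻¹ * A := by
    conv_lhs => rw [hA, ← lintegral_enorm_fourier_sq hW1 hW2, ← lintegral_add_compl _ hSm]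
    exact add_le_add b1 b2
  have hr := ENNReal.toReal_mono (by finiteness) hle
  rw [ENNReal.toReal_add (by finiteness) (by finiteness), ENNReal.toReal_mul,
    ENNReal.toReal_inv, ENNReal.toReal_ofNat] at hr
  have : A.toReal = 0 := le_antisymm (by linarith) ENNReal.toReal_nonneg
  exact ((ENNReal.toReal_eq_zero_iff A).1 this).resolve_right hAtop

open scoped FourierTransform in
lemma fourier_indicator_exp (f : ℂ → ℂ) (τ : ℝ) (ξ : ℂ) :
    𝓕 ((ball (0 : ℂ) 1).indicator fun x => f x * exp (τ * x.re)) ξ =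
      ∫ x in ball (0 : ℂ) 1, f x * exp (planeForm ((τ - 2 * Real.pi * ξ.re * I - 2 * Real.pi * ξ.im) / 2)
        ((τ - 2 * Real.pi * ξ.re * I + 2 * Real.pi * ξ.im) / 2) x) := by
  rw [Real.fourier_eq', ← integral_indicator measurableSet_ball]
  congr 1
  funext x
  by_cases hx : x ∈ ball (0 : ℂ) 1
  · rw [indicator_of_mem hx, indicator_of_mem hx, smul_eq_mul, mul_left_comm, ← Complex.exp_add]
    congr 2
    rw [planeForm, Complex.inner]
    apply Complex.ext <;> simp <;> ring
  · rw [indicator_of_notMem hx, indicator_of_notMem hx, smul_zero]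

/-- Where the symbol is small, the frequency is close to one of the two zeros of the symbol. -/
lemma mem_closedBall_of_norm_symbol_lt {τ K : ℝ} (hτ : 0 < τ) (hK : 0 < K) (hKτ : K ≤ τ ^ 2) {ξ : ℂ}
    (h : ‖((τ : ℂ) - 2 * Real.pi * ξ.re * I) ^ 2 - (2 * Real.pi * ξ.im) ^ 2‖ < K) :
    ξ ∈ closedBall ((τ / (2 * Real.pi) : ℝ) * I) (K / τ) ∪
      closedBall (-((τ / (2 * Real.pi) : ℝ) * I)) (K / τ) := by
  have hπ := Real.pi_gt_three
  set X := 2 * Real.pi * ξ.re with hX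
  set Y := 2 * Real.pi * ξ.im with hY
  have hre : |τ ^ 2 - X ^ 2 - Y ^ 2| < K := by
    refine lt_of_le_of_lt ?_ h
    refine le_trans (le_of_eq ?_) (abs_re_le_norm _)
    congr 1
    simp [sq, hX, hY]
  have him : |2 * τ * X| < K := by
    refine lt_of_le_of_lt ?_ h
    refine le_trans (le_of_eq ?_) (abs_im_le_norm _)
    rw [← abs_neg]
    congr 1
    simp [sq, hX]
    ring
  rw [abs_mul, abs_of_pos (by positivity : 0 < 2 * τ)] at him
  have hXX : X ^ 2 ≤ K / 4 := by
    have h1 : (2 * τ * |X|) ^ 2 ≤ K ^ 2 := by gcongr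
    rw [mul_pow, sq_abs] at h1
    have h2 : 4 * K * X ^ 2 ≤ K ^ 2 := by nlinarith [sq_nonneg X]
    nlinarith
  have hYY : |(|Y|) - τ| * τ ≤ 5 / 4 * K := by
    calc |(|Y|) - τ| * τ ≤ |(|Y|) - τ| * (|Y| + τ) := by gcongr; linarith [abs_nonneg Y]
      _ = |Y ^ 2 - τ ^ 2| := by
        rw [← sq_abs Y, ← abs_of_nonneg (by positivity : 0 ≤ |Y| + τ), ← abs_mul]
        congr 1
        ring
      _ ≤ _ := by rw [abs_lt] at hre; rw [abs_le]; constructor <;> nlinarith [sq_nonneg X]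
  have key : ∀ σ : ℝ, |Y - σ * τ| = |(|Y|) - τ| →
      ξ ∈ closedBall (((σ * τ) / (2 * Real.pi) : ℝ) * I) (K / τ) := fun σ hσ => by
    rw [mem_closedBall, dist_eq_norm, le_div_iff₀ hτ]
    have h1 : ξ.re = X / (2 * Real.pi) := by rw [hX]; field_simp
    have h2 : ξ.im - σ * τ / (2 * Real.pi) = (Y - σ * τ) / (2 * Real.pi) := by rw [hY]; field_simp
    have h3 := norm_le_abs_re_add_abs_im (ξ - ((σ * τ) / (2 * Real.pi) : ℝ) * I)
    simp only [sub_re, sub_im, re_ofReal_mul, im_ofReal_mul, I_re, I_im, mul_zero, mul_one,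
      sub_zero] at h3
    rw [h1, h2, abs_div, abs_div, hσ, abs_of_pos (by positivity : 0 < 2 * Real.pi),
      ← add_div] at h3
    calc _ ≤ (|X| + |(|Y|) - τ|) / (2 * Real.pi) * τ := by gcongr
      _ = (|X| * τ + |(|Y|) - τ| * τ) / (2 * Real.pi) := by ring
      _ ≤ _ := by rw [div_le_iff₀ (by positivity)]; nlinarith
  rcases le_total 0 Y with hy | hy
  · left
    have := key 1 (by rw [one_mul, abs_of_nonneg hy])
    rwa [one_mul] at this
  · right
    have := key (-1) (by rw [abs_of_nonpos hy, ← abs_neg]; congr 1; ring)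
    rwa [neg_one_mul, neg_div, ofReal_neg, neg_mul] at this

section Uniqueness

variable {ε : ℝ} {p m : ℂ → ℂ}

theorem ScalarMinimizer.eq_of_norm_eq (hp : ScalarMinimizer ε p) (hm : ScalarMinimizer ε m)
    (hn : ∀ x ∈ ball (0 : ℂ) 1, ‖p x‖ = ‖m x‖) {x : ℂ} (hx : x ∈ closedBall (0 : ℂ) 1) :
    p x = m x := by
  have hV : ContinuousOn (fun x => (((1 - ‖p x‖ ^ 2) / ε ^ 2 : ℝ) : ℂ)) (closedBall 0 1) :=
    continuous_ofReal.comp_continuousOn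
      ((continuousOn_const.sub (hp.fin.cont.norm.pow 2)).div_const _)
  have hc := (finiteDirichlet_conjDiff hp hm).cont
  obtain ⟨M, hM0, hM⟩ := hV.exists_bound_disk
  obtain ⟨K, hK⟩ : ∃ K, K = 2 * M + 1 := ⟨_, rfl⟩
  obtain ⟨τ, hτ⟩ : ∃ τ, τ = 10 * (K + 1) := ⟨_, rfl⟩
  have hK0 : 0 < K := by linarith
  have hτ0 : 0 < τ := by linarith
  have hE : ContinuousOn (fun x : ℂ => exp (τ * x.re)) (closedBall 0 1) :=
    Continuous.continuousOn (by fun_prop)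
  have hWc : ContinuousOn (fun x => conjDiff p m x * exp (τ * x.re)) (closedBall 0 1) := hc.mul hE
  have hGc : ContinuousOn (fun x => (((1 - ‖p x‖ ^ 2) / ε ^ 2 : ℝ) : ℂ) * conjDiff p m x *
    exp (τ * x.re)) (closedBall 0 1) := (hV.mul hc).mul hE
  have hL : ∀ f : ℂ → ℂ, ContinuousOn f (closedBall 0 1) →
      Integrable ((ball (0 : ℂ) 1).indicator f) ∧ MemLp ((ball (0 : ℂ) 1).indicator f) 2 := by
    intro f hf
    obtain ⟨C, -, hC⟩ := hf.exists_bound_disk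
    have : IsFiniteMeasure ((volume : Measure ℂ).restrict (ball 0 1)) :=
      ⟨by rw [Measure.restrict_apply_univ]; exact measure_ball_lt_top⟩
    refine ⟨(integrable_indicator_iff measurableSet_ball).2 hf.integrableOn_disk,
      (memLp_indicator_iff_restrict measurableSet_ball).2
      (MemLp.of_bound hf.integrableOn_disk.aestronglyMeasurable C
        ((ae_restrict_iff' measurableSet_ball).2 (ae_of_all _ fun x hx =>
          hC x (ball_subset_closedBall hx))))⟩
  have hzero := lintegral_sq_eq_zero_of_fourier_le (M := M) (K := K)
    (S := closedBall ((τ / (2 * Real.pi) : ℝ) * I) (K / τ) ∪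
      closedBall (-((τ / (2 * Real.pi) : ℝ) * I)) (K / τ)) (hL _ hWc).1 (hL _ hWc).2 (hL _ hGc).1
    (hL _ hGc).2 (fun x hx => indicator_of_notMem hx _) hM0 (fun x => ?_) hK0 (by linarith)
    (measurableSet_closedBall.union measurableSet_closedBall) ?_ (fun ξ hξ => ?_)
  · have hae : (ball (0 : ℂ) 1).indicator (fun x => conjDiff p m x * exp (τ * x.re)) =ᵐ[volume] 0 := by
      have h0 := (lintegral_eq_zero_iff' ((hL _ hWc).1.aestronglyMeasurable.enorm.pow_const 2)).1 hzero
      filter_upwards [h0] with x hx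
      simpa using hx
    have hae' : (fun x => conjDiff p m x * exp (τ * x.re)) =ᵐ[volume.restrict (ball 0 1)]
        fun _ => 0 := by
      rw [Filter.EventuallyEq, ae_restrict_iff' measurableSet_ball]
      filter_upwards [hae] with x hx hxb
      rwa [indicator_of_mem hxb] at hx
    have hon := Measure.eqOn_open_of_ae_eq hae' isOpen_ball (hWc.mono ball_subset_closedBall)
      continuousOn_const
    rcases (mem_closedBall_zero_iff.1 hx).lt_or_eq with h1 | h1
    · have h2 : conjDiff p m x * exp (τ * x.re) = 0 := hon (mem_ball_zero_iff.2 h1)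
      have h3 := (mul_eq_zero.1 h2).resolve_right (exp_ne_zero _)
      rw [conjDiff, map_eq_zero] at h3
      exact sub_eq_zero.1 h3
    · rw [hp.boundary x h1, hm.boundary x h1]
  · by_cases hxb : x ∈ ball (0 : ℂ) 1
    · rw [indicator_of_mem hxb, indicator_of_mem hxb, mul_assoc, norm_mul]
      gcongr
      exact hM x (ball_subset_closedBall hxb)
    · rw [indicator_of_notMem hxb, indicator_of_notMem hxb, norm_zero, mul_zero]
  · have hr : K / τ ≤ 1 / 10 := by rw [div_le_div_iff₀ hτ0 (by norm_num)]; linarith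
    have hb : ∀ c : ℂ, volume (closedBall c (K / τ)) ≤ ENNReal.ofReal (Real.pi / 100) := fun c => by
      calc volume (closedBall c (K / τ)) ≤ volume (closedBall c (1 / 10)) :=
            measure_mono (closedBall_subset_closedBall hr)
        _ = _ := by
          rw [Complex.volume_closedBall, ← ENNReal.ofReal_pow (by norm_num),
            ← ENNReal.ofReal_coe_nnreal, NNReal.coe_real_pi, ← ENNReal.ofReal_mul (by norm_num)]
          congr 1
          ring
    have h1 : volume (ball (0 : ℂ) 1) = ENNReal.ofReal Real.pi := by
      rw [Complex.volume_ball, ← NNReal.coe_real_pi, ENNReal.ofReal_coe_nnreal]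
      simp
    calc _ ≤ (ENNReal.ofReal (Real.pi / 100) + ENNReal.ofReal (Real.pi / 100)) *
          ENNReal.ofReal Real.pi := by
            rw [h1]
            gcongr
            exact (measure_union_le _ _).trans (add_le_add (hb _) (hb _))
      _ ≤ ENNReal.ofReal 4⁻¹ := by
          have hπ := Real.pi_pos
          rw [← ENNReal.ofReal_add (by positivity) (by positivity),
            ← ENNReal.ofReal_mul (by positivity)]
          exact ENNReal.ofReal_le_ofReal (by nlinarith [Real.pi_lt_d2])
      _ = 4⁻¹ := by rw [ENNReal.ofReal_inv_of_pos (by norm_num), ENNReal.ofReal_ofNat]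
  · have hlow : K ≤ ‖((τ : ℂ) - 2 * Real.pi * ξ.re * I) ^ 2 - (2 * Real.pi * ξ.im) ^ 2‖ := by
      by_contra! hlt
      exact hξ (mem_closedBall_of_norm_symbol_lt hτ0 hK0 (by nlinarith) hlt)
    have hid := integral_conjDiff_mul_exp hp hm hn
      ((τ - 2 * Real.pi * ξ.re * I - 2 * Real.pi * ξ.im) / 2)
      ((τ - 2 * Real.pi * ξ.re * I + 2 * Real.pi * ξ.im) / 2)
    rw [fourier_indicator_exp, fourier_indicator_exp, ← norm_neg (∫ x in ball (0 : ℂ) 1, _ * _ * _),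
      ← hid, norm_mul]
    gcongr
    refine hlow.trans (le_of_eq (congrArg norm ?_))
    ring

end Uniqueness

/-- If `β > 1` and `Ψ = (ψ₊,ψ₋)` is an admissible minimizer of `I_{[1,1]}(ε;β)`, then its
spin vanishes on the open disk (so `|ψ₊| = |ψ₋|`), `ψ₊ = ψ₋` on the closed disk, and
`u := √2·ψ₊` satisfies `G_ε(u) = I_GL(ε)`. -/
theorem statement1 (ε β : ℝ) (hε : 0 < ε) (hβ : 1 < β) (ψp ψm : ℂ → ℂ)
    (hadm : AdmissiblePair ε β 1 1 ψp ψm) (hmin : En ε β ψp ψm = Ival ε β 1 1) :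
    (∀ x ∈ ball (0 : ℂ) 1, spin ψp ψm x = 0) ∧
    (∀ x ∈ ball (0 : ℂ) 1, ‖ψp x‖ = ‖ψm x‖) ∧
    (∀ x ∈ closedBall (0 : ℂ) 1, ψp x = ψm x) ∧
    Gn ε (fun x => (Real.sqrt 2 : ℂ) * ψp x) = IGL ε := by
  obtain ⟨hn, hp, hm⟩ := minimizing_pair_reduction hε hβ hadm hmin
  refine ⟨fun x hx => by rw [spin, hn x hx, sub_self, mul_zero], hn, fun x hx => ?_, hp.Gn_eq⟩
  refine mul_left_cancel₀ sqrt_two_ne_zero (hp.eq_of_norm_eq hm (fun y hy => ?_) hx)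
  rw [norm_mul, norm_mul, hn y hy]
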